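/- Let p ∈ [1,∞), let ((λ_n)_{n∈ℤ}, (μ_n)_{n∈ℤ}) ∈ SD_p, let α_n := −1/(φ′(λ_n)ψ(λ_n)) be the associated positive constants, let H be the associated kernel and K ∈ G_p(M₂) the solution of the corresponding GLM equation, and set c_k(x) := c₀(x,λ_k) + ∫₀ˣ K(x,t) c₀(t,λ_k) dt for k ∈ ℤ. Then the system (c_k)_{k∈ℤ} is a complete orthogonal system in ℍ = L₂((0,1),ℂ²), and ⟨c_k, c_l⟩ = α_k^{−1} δ_{kl} for all k, l ∈ ℤ. -/

import Mathlib

open MeasureTheory Complex Filter Set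
open scoped Matrix.Norms.L2Operator ENNReal

noncomputable section

abbrev M2 := Matrix (Fin 2) (Fin 2) ℂ

def Bmat : M2 := !![0, 1; -1, 0]

def Jmat : M2 := !![1, 0; 0, -1]

/-- `expB τ = e^{-τ B} = [[cos τ, -sin τ],[sin τ, cos τ]]`. -/
def expB (τ : ℂ) : M2 := !![Complex.cos τ, -Complex.sin τ; Complex.sin τ, Complex.cos τ]

/-- Lebesgue measure restricted to `(0,1)`. -/
def μ01 : Measure ℝ := volume.restrict (Set.Ioo 0 1)

/-- Lebesgue measure restricted to `(-1,1)`. -/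
def μ11 : Measure ℝ := volume.restrict (Set.Ioo (-1) 1)

/-- A Dirac-form potential `Q = [[q₁,q₂],[q₂,-q₁]]`. -/
def IsDiracForm (Q : ℝ → M2) : Prop :=
  ∃ q1 q2 : ℝ → ℂ, ∀ x, Q x = !![q1 x, q2 x; q2 x, -q1 x]

/-- A Dirac-form potential with real-valued entries. -/
def IsRealDiracForm (Q : ℝ → M2) : Prop :=
  ∃ q1 q2 : ℝ → ℝ, ∀ x, Q x = !![(q1 x : ℂ), (q2 x : ℂ); (q2 x : ℂ), -(q1 x : ℂ)]

/-- `U` is an absolutely continuous matrix solution of `B U' + Q U = λ U` a.e. on `(0,1)`. -/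
def IsMatSolution (Q : ℝ → M2) (l : ℂ) (U : ℝ → M2) : Prop :=
  ∃ U' : ℝ → M2, IntegrableOn U' (Set.Ioo 0 1) ∧
    (∀ x ∈ Set.Icc (0:ℝ) 1, U x = U 0 + ∫ t in (0:ℝ)..x, U' t) ∧
    (∀ᵐ x ∂μ01, Bmat * U' x + Q x * U x = l • U x)

/-- `u` is an absolutely continuous `ℂ²`-valued solution of `B u' + Q u = λ u` a.e. on `(0,1)`. -/
def IsVecSolution (Q : ℝ → M2) (l : ℂ) (u : ℝ → Fin 2 → ℂ) : Prop :=
  ∃ u' : ℝ → Fin 2 → ℂ, IntegrableOn u' (Set.Ioo 0 1) ∧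
    (∀ x ∈ Set.Icc (0:ℝ) 1, u x = u 0 + ∫ t in (0:ℝ)..x, u' t) ∧
    (∀ᵐ x ∂μ01, Bmat.mulVec (u' x) + (Q x).mulVec (u x) = l • u x)

/-- `λ` is an eigenvalue of the Dirac operator `A_j` (`j = 0` for `A₁`, `j = 1` for `A₂`):
there is a nonzero AC solution with `u₂(0) = 0` and `u_j(1) = 0`. -/
def IsEigenvalue (Q : ℝ → M2) (j : Fin 2) (l : ℝ) : Prop :=
  ∃ u : ℝ → Fin 2 → ℂ, IsVecSolution Q (l : ℂ) u ∧
    (∃ x ∈ Set.Icc (0:ℝ) 1, u x ≠ 0) ∧ u 0 1 = 0 ∧ u 1 j = 0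

/-- `c₀(·,λ) = (cos λx, sin λx)ᵗ`. -/
def c0 (l : ℂ) (x : ℝ) : Fin 2 → ℂ := ![Complex.cos (l * x), Complex.sin (l * x)]

/-- n-th Fourier coefficient `e_n(g) = ∫₀¹ e^{-2πinx} g(x) dx`. -/
def fc (g : ℝ → ℂ) (n : ℤ) : ℂ :=
  ∫ x in (0:ℝ)..1, Complex.exp (-2 * Real.pi * Complex.I * n * x) * g x

/-- The square of the `ℍ = L₂((0,1),ℂ²)` norm of `u`. -/
def hnormSq (u : ℝ → Fin 2 → ℂ) : ℝ :=
  ∫ x in Set.Ioo (0:ℝ) 1, (‖u x 0‖ ^ 2 + ‖u x 1‖ ^ 2)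

/-- The `ℂ²` inner product `⟨v,w⟩ = v₁ w̄₁ + v₂ w̄₂`. -/
def ip2 (v w : Fin 2 → ℂ) : ℂ := v 0 * star (w 0) + v 1 * star (w 1)

/-- The eigenvalue asymptotics `λ_n = π(n+1/2) + e_n(g)` for some `g ∈ L_p(0,1)`. -/
def LamAsymp (p : ℝ≥0∞) (lam : ℤ → ℝ) : Prop :=
  ∃ g : ℝ → ℂ, MemLp g p μ01 ∧
    ∀ n : ℤ, (lam n : ℂ) = Real.pi * (n + 1/2) + fc g n

/-- The eigenvalue asymptotics `μ_n = πn + e_n(g)` for some `g ∈ L_p(0,1)`. -/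
def MuAsymp (p : ℝ≥0∞) (mu : ℤ → ℝ) : Prop :=
  ∃ g : ℝ → ℂ, MemLp g p μ01 ∧
    ∀ n : ℤ, (mu n : ℂ) = Real.pi * n + fc g n

/-- The norming-constant asymptotics `α_n = 1 + e_n(g)` for some `g ∈ L_p(0,1)`. -/
def AlAsymp (p : ℝ≥0∞) (al : ℤ → ℝ) : Prop :=
  ∃ g : ℝ → ℂ, MemLp g p μ01 ∧ ∀ n : ℤ, (al n : ℂ) = 1 + fc g n

/-- Membership in the class `SD_p` of spectral data. -/
def MemSD (p : ℝ≥0∞) (lam mu : ℤ → ℝ) : Prop :=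
  (∀ n : ℤ, lam (n - 1) < mu n ∧ mu n < lam n) ∧ LamAsymp p lam ∧ MuAsymp p mu

/-- Membership in the kernel space `G_p(M₂)`: all slices lie in `L_p` and the slice maps are
continuous from `[0,1]` to `L_p((0,1),M₂)`. -/
def MemGp (p : ℝ≥0∞) (K : ℝ → ℝ → M2) : Prop :=
  (∀ x ∈ Set.Icc (0:ℝ) 1, MemLp (K x) p μ01) ∧
  (∀ t ∈ Set.Icc (0:ℝ) 1, MemLp (fun x => K x t) p μ01) ∧
  (∀ x₀ ∈ Set.Icc (0:ℝ) 1, ∀ ε > (0:ℝ), ∃ δ > (0:ℝ), ∀ x ∈ Set.Icc (0:ℝ) 1,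
    |x - x₀| < δ → eLpNorm (fun t => K x t - K x₀ t) p μ01 < ENNReal.ofReal ε) ∧
  (∀ t₀ ∈ Set.Icc (0:ℝ) 1, ∀ ε > (0:ℝ), ∃ δ > (0:ℝ), ∀ t ∈ Set.Icc (0:ℝ) 1,
    |t - t₀| < δ → eLpNorm (fun x => K x t - K x t₀) p μ01 < ENNReal.ofReal ε)

/-- The norm of the space `G_p(M₂)` (as an extended real number). -/
def gpNorm (p : ℝ≥0∞) (K : ℝ → ℝ → M2) : ℝ≥0∞ :=
  max (⨆ x ∈ Set.Icc (0:ℝ) 1, eLpNorm (K x) p μ01)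
      (⨆ t ∈ Set.Icc (0:ℝ) 1, eLpNorm (fun x => K x t) p μ01)


/-- The kernel `F(x,t) = (1/2)[H((x-t)/2) + H((x+t)/2)J]` built from `H`. -/
def Fker (H : ℝ → M2) (x t : ℝ) : M2 := (2:ℂ)⁻¹ • (H ((x - t)/2) + H ((x + t)/2) * Jmat)

/-- `R` solves the Krein equation `R̃(x,t) + H(x-t) + ∫₀ˣ R̃(x,s)H(s-t) ds = 0` on the
triangle `{0 ≤ t ≤ x ≤ 1}` and is supported there. -/
def SolvesKrein (H : ℝ → M2) (R : ℝ → ℝ → M2) : Prop :=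
  (∀ x t : ℝ, ¬ (0 ≤ t ∧ t ≤ x ∧ x ≤ 1) → R x t = 0) ∧
  ∀ x ∈ Set.Icc (0:ℝ) 1, ∀ᵐ t ∂(volume.restrict (Set.Ioo 0 x)),
    R x t + H (x - t) + ∫ s in (0:ℝ)..x, R x s * H (s - t) = 0

/-- `K` solves the GLM equation `K(x,t) + F(x,t) + ∫₀ˣ K(x,s)F(s,t) ds = 0` on the triangle
`{0 ≤ t ≤ x ≤ 1}` and is supported there. -/
def SolvesGLMwith (F K : ℝ → ℝ → M2) : Prop :=
  (∀ x t : ℝ, ¬ (0 ≤ t ∧ t ≤ x ∧ x ≤ 1) → K x t = 0) ∧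
  ∀ x ∈ Set.Icc (0:ℝ) 1, ∀ᵐ t ∂(volume.restrict (Set.Ioo 0 x)),
    K x t + F x t + ∫ s in (0:ℝ)..x, K x s * F s t = 0

/-- `H ∈ L_p((-1,1),M₂)` is the sum of the series
`Σ_{n∈ℤ} (α_n e^{-2λ_n sB} - e^{-π(2n+1) sB})` (in the sense of symmetric partial sums for
`p > 1` and of Cesàro means for `p = 1`). -/
def IsHSum (p : ℝ≥0∞) (lam al : ℤ → ℝ) (H : ℝ → M2) : Prop :=
  MemLp H p μ11 ∧
  (1 < p → Tendsto (fun N : ℕ => eLpNorm (fun s : ℝ =>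
      (∑ n ∈ Finset.Icc (-(N:ℤ)) (N:ℤ),
        ((al n : ℂ) • expB (2 * (lam n : ℂ) * (s : ℂ)) -
          expB (Real.pi * (2 * (n : ℂ) + 1) * (s : ℂ)))) - H s) p μ11)
    atTop (nhds 0)) ∧
  (p = 1 → Tendsto (fun N : ℕ => eLpNorm (fun s : ℝ =>
      ((N : ℂ)⁻¹ • ∑ k ∈ Finset.Icc 1 N, ∑ n ∈ Finset.Icc (-(k:ℤ)) (k:ℤ),
        ((al n : ℂ) • expB (2 * (lam n : ℂ) * (s : ℂ)) -
          expB (Real.pi * (2 * (n : ℂ) + 1) * (s : ℂ)))) - H s) 1 μ11)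
    atTop (nhds 0))


/-! ### The Hilbert space -/

abbrev E2 := EuclideanSpace ℂ (Fin 2)

instance instFiniteMu01 : IsFiniteMeasure μ01 := by
  unfold μ01; infer_instance

abbrev HH := Lp E2 2 μ01

lemma mu01_univ : μ01 univ = 1 := by
  simp [μ01]

/-- The class in `ℍ` of a function (zero when the function is not square integrable). -/
def emb (f : ℝ → E2) : HH :=
  open Classical in if h : MemLp f 2 μ01 then h.toLp f else 0

lemma emb_coe {f : ℝ → E2} (h : MemLp f 2 μ01) : emb f =ᵐ[μ01] f := by
  unfold emb
  rw [dif_pos h]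
  exact h.coeFn_toLp

lemma emb_self (f : HH) : emb f = f := by
  unfold emb
  rw [dif_pos (Lp.memLp f)]
  exact Lp.toLp_coeFn f _

lemma memLp_of_bdd {f : ℝ → E2} (hm : AEStronglyMeasurable f μ01) (C : ℝ)
    (hC : ∀ x ∈ Ioo (0:ℝ) 1, ‖f x‖ ≤ C) {p : ℝ≥0∞} : MemLp f p μ01 := by
  refine MemLp.of_bound hm C ?_
  unfold μ01
  exact (ae_restrict_iff' measurableSet_Ioo).2 (Eventually.of_forall hC)

lemma memLp_of_continuous {f : ℝ → E2} (hf : Continuous f) {p : ℝ≥0∞} : MemLp f p μ01 := by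
  obtain ⟨C, hC⟩ := isCompact_Icc.exists_bound_of_continuousOn (s := Icc (0:ℝ) 1) hf.continuousOn
  exact memLp_of_bdd hf.aestronglyMeasurable C (fun x hx => hC x (Ioo_subset_Icc_self hx))

lemma inner_emb {f g : ℝ → E2} (hf : MemLp f 2 μ01) (hg : MemLp g 2 μ01) :
    inner ℂ (emb f) (emb g) = ∫ x, inner ℂ (f x) (g x) ∂μ01 := by
  rw [L2.inner_def]
  refine integral_congr_ae ?_
  filter_upwards [emb_coe hf, emb_coe hg] with x h1 h2
  rw [h1, h2]

lemma emb_congr {f g : ℝ → E2} (hf : MemLp f 2 μ01) (h : f =ᵐ[μ01] g) : emb f = emb g := by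
  have hg : MemLp g 2 μ01 := (memLp_congr_ae h).1 hf
  refine Lp.ext ?_
  exact (emb_coe hf).trans (h.trans (emb_coe hg).symm)

lemma eq_emb {F : HH} {f : ℝ → E2} (h : F =ᵐ[μ01] f) : F = emb f := by
  rw [← emb_self F]
  exact emb_congr (Lp.memLp F) h

lemma emb_add {f g : ℝ → E2} (hf : MemLp f 2 μ01) (hg : MemLp g 2 μ01) :
    emb (fun x => f x + g x) = emb f + emb g := by
  symm
  refine eq_emb ?_
  filter_upwards [Lp.coeFn_add (emb f) (emb g), emb_coe hf, emb_coe hg] with x h h1 h2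
  rw [h, Pi.add_apply, h1, h2]

lemma emb_sub {f g : ℝ → E2} (hf : MemLp f 2 μ01) (hg : MemLp g 2 μ01) :
    emb (fun x => f x - g x) = emb f - emb g := by
  symm
  refine eq_emb ?_
  filter_upwards [Lp.coeFn_sub (emb f) (emb g), emb_coe hf, emb_coe hg] with x h h1 h2
  rw [h, Pi.sub_apply, h1, h2]

lemma emb_smul {f : ℝ → E2} (c : ℂ) (hf : MemLp f 2 μ01) :
    emb (fun x => c • f x) = c • emb f := by
  symm
  refine eq_emb ?_
  filter_upwards [Lp.coeFn_smul c (emb f), emb_coe hf] with x h h1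
  rw [h, Pi.smul_apply, h1]

lemma emb_zero : emb (fun _ => 0) = 0 := by
  symm
  refine eq_emb ?_
  exact Lp.coeFn_zero _ _ _

lemma emb_sum {ι : Type*} (s : Finset ι) (f : ι → ℝ → E2) (hf : ∀ i, MemLp (f i) 2 μ01) :
    emb (fun x => ∑ i ∈ s, f i x) = ∑ i ∈ s, emb (f i) := by
  classical
  induction s using Finset.induction_on with
  | empty => simp [emb_zero]
  | insert a s ha ih =>
    simp only [Finset.sum_insert ha]
    rw [emb_add (hf a) (memLp_finsetSum s (fun i _ => hf i)), ih]

lemma exists_mulOp (A : ℝ → E2 →L[ℂ] E2) (hA : StronglyMeasurable A) (C : ℝ) (hC0 : 0 ≤ C)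
    (hC : ∀ x ∈ Ioo (0:ℝ) 1, ‖A x‖ ≤ C) :
    ∃ T : HH →L[ℂ] HH, ‖T‖ ≤ C ∧ ∀ f : HH, T f =ᵐ[μ01] fun x => A x (f x) := by
  have hbd : ∀ f : HH, ∀ᵐ x ∂μ01, ‖A x (f x)‖ ≤ C * ‖f x‖ := by
    intro f
    unfold μ01
    refine (ae_restrict_iff' measurableSet_Ioo).2 (Eventually.of_forall ?_)
    intro x hx
    exact ((A x).le_opNorm _).trans (by gcongr; exact hC x hx)
  have hmem : ∀ f : HH, MemLp (fun x => A x (f x)) 2 μ01 := by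
    intro f
    refine MemLp.of_le_mul (Lp.memLp f) ?_ (hbd f)
    exact ContinuousLinearMap.aestronglyMeasurable_comp₂ (ContinuousLinearMap.id ℂ (E2 →L[ℂ] E2))
      hA.aestronglyMeasurable (Lp.aestronglyMeasurable f)
  let L : HH →ₗ[ℂ] HH :=
    { toFun := fun f => (hmem f).toLp _
      map_add' := by
        intro f g
        refine Lp.ext ?_
        filter_upwards [(hmem (f+g)).coeFn_toLp, (hmem f).coeFn_toLp, (hmem g).coeFn_toLp,
          Lp.coeFn_add ((hmem f).toLp _) ((hmem g).toLp _), Lp.coeFn_add f g] with x h1 h2 h3 h4 h5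
        rw [h1, h4, Pi.add_apply, h2, h3, h5]
        simp
      map_smul' := by
        intro c f
        refine Lp.ext ?_
        filter_upwards [(hmem (c • f)).coeFn_toLp, (hmem f).coeFn_toLp,
          Lp.coeFn_smul c ((hmem f).toLp _), Lp.coeFn_smul c f] with x h1 h2 h4 h5
        rw [h1, RingHom.id_apply, h4, Pi.smul_apply, h2, h5]
        simp }
  refine ⟨L.mkContinuous C ?_, L.mkContinuous_norm_le hC0 _, ?_⟩
  · intro f
    refine Lp.norm_le_mul_norm_of_ae_le_mul ?_
    filter_upwards [(hmem f).coeFn_toLp, hbd f] with x h1 h2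
    show ‖((hmem f).toLp _ : HH) x‖ ≤ _
    rw [h1]; exact h2
  · intro f
    exact (hmem f).coeFn_toLp

lemma integrable_HH (f : HH) : Integrable f μ01 :=
  (Lp.memLp f).integrable (by norm_num)

lemma integral_norm_le_HH (f : HH) : ∫ x, ‖f x‖ ∂μ01 ≤ ‖f‖ := by
  have : IsProbabilityMeasure μ01 := ⟨mu01_univ⟩
  have h := eLpNorm_le_eLpNorm_of_exponent_le (μ := μ01) (p := 1) (q := 2) (by norm_num)
    (Lp.aestronglyMeasurable f) 
  rw [integral_norm_eq_lintegral_enorm (Lp.aestronglyMeasurable f), Lp.norm_def]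
  refine ENNReal.toReal_mono (Lp.eLpNorm_ne_top f) ?_
  rwa [eLpNorm_one_eq_lintegral_enorm] at h

lemma ii_eq (f : ℝ → E2) {x : ℝ} (hx : x ∈ Icc (0:ℝ) 1) :
    ∫ t in (0:ℝ)..x, f t = ∫ t, (Iio x).indicator f t ∂μ01 := by
  rw [intervalIntegral.integral_of_le hx.1, integral_indicator measurableSet_Iio, μ01,
    Measure.restrict_restrict measurableSet_Iio, ← integral_Ioc_eq_integral_Ioo.symm]
  congr 2
  ext t; simp only [mem_Ioo, mem_inter_iff, mem_Iio]
  exact ⟨fun h => ⟨h.2, h.1, h.2.trans_le hx.2⟩, fun h => ⟨h.2.1, h.1⟩⟩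

lemma exists_intOp :
    ∃ T : HH →L[ℂ] HH, ∀ f : HH, T f =ᵐ[μ01] fun x => ∫ t in (0:ℝ)..x, f t := by
  have hii : ∀ f : HH, ∀ x ∈ Icc (0:ℝ) 1, IntervalIntegrable f volume 0 x := by
    intro f x hx
    rw [intervalIntegrable_iff_integrableOn_Ioo_of_le hx.1]
    have := integrable_HH f
    unfold μ01 at this
    exact IntegrableOn.mono_set this (Ioo_subset_Ioo_right hx.2)
  have hbd : ∀ f : HH, ∀ x ∈ Icc (0:ℝ) 1, ‖∫ t in (0:ℝ)..x, f t‖ ≤ ‖f‖ := by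
    intro f x hx
    rw [ii_eq f hx]
    refine (norm_integral_le_integral_norm _).trans ?_
    refine le_trans ?_ (integral_norm_le_HH f)
    refine integral_mono_of_nonneg (Eventually.of_forall fun _ => norm_nonneg _)
      (integrable_HH f).norm (Eventually.of_forall fun t => ?_)
    exact norm_indicator_le_norm_self _ _
  have hcont : ∀ f : HH, ContinuousOn (fun x => ∫ t in (0:ℝ)..x, f t) (Icc 0 1) := by
    intro f
    have := intervalIntegral.continuousOn_primitive_interval' (hii f 1 (by simp)) (left_mem_uIcc)
    rwa [uIcc_of_le zero_le_one] at this
  have hae : ∀ᵐ x ∂μ01, x ∈ Icc (0:ℝ) 1 := by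
    unfold μ01
    exact (ae_restrict_iff' measurableSet_Ioo).2
      (Eventually.of_forall fun x hx => Ioo_subset_Icc_self hx)
  have hmem : ∀ f : HH, MemLp (fun x => ∫ t in (0:ℝ)..x, f t) 2 μ01 := by
    intro f
    refine memLp_of_bdd ?_ ‖f‖ (fun x hx => hbd f x (Ioo_subset_Icc_self hx))
    unfold μ01
    exact ((hcont f).mono Ioo_subset_Icc_self).aestronglyMeasurable measurableSet_Ioo
  have hiae : ∀ f : HH, ∀ g : ℝ → E2, f =ᵐ[μ01] g → ∀ x ∈ Icc (0:ℝ) 1,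
      ∫ t in (0:ℝ)..x, f t = ∫ t in (0:ℝ)..x, g t := by
    intro f g h x hx
    rw [ii_eq f hx, ii_eq g hx]
    refine integral_congr_ae ?_
    filter_upwards [h] with t ht
    simp only [indicator]; rw [ht]
  let L : HH →ₗ[ℂ] HH :=
    { toFun := fun f => (hmem f).toLp _
      map_add' := by
        intro f g
        refine Lp.ext ?_
        filter_upwards [(hmem (f+g)).coeFn_toLp, (hmem f).coeFn_toLp, (hmem g).coeFn_toLp,
          Lp.coeFn_add ((hmem f).toLp _) ((hmem g).toLp _), hae] with x h1 h2 h3 h4 h5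
        rw [h1, h4, Pi.add_apply, h2, h3, hiae _ _ (Lp.coeFn_add f g) x h5]
        exact intervalIntegral.integral_add (hii f x h5) (hii g x h5)
      map_smul' := by
        intro c f
        refine Lp.ext ?_
        filter_upwards [(hmem (c • f)).coeFn_toLp, (hmem f).coeFn_toLp,
          Lp.coeFn_smul c ((hmem f).toLp _), hae] with x h1 h2 h4 h5
        rw [h1, RingHom.id_apply, h4, Pi.smul_apply, h2, hiae _ _ (Lp.coeFn_smul c f) x h5]
        exact intervalIntegral.integral_smul c (fun t => f t) }
  refine ⟨L.mkContinuous 1 ?_, ?_⟩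
  · intro f
    have h1 := Lp.norm_le_of_ae_bound (f := L f) (C := ‖f‖) (norm_nonneg _) (by
      filter_upwards [(hmem f).coeFn_toLp, hae] with x h1 h2
      show ‖((hmem f).toLp _ : HH) x‖ ≤ _
      rw [h1]; exact hbd f x h2)
    simpa [Measure.real, mu01_univ, measureUnivNNReal] using h1
  · intro f
    exact (hmem f).coeFn_toLp


/-! ### The unperturbed orthonormal basis -/

lemma fourier_unique (g : ℝ → ℂ) (hg : MemLp g 2 (volume.restrict (Ioc (-1:ℝ) 1)))
    (h : ∀ n : ℤ, ∫ x in (-1:ℝ)..1, Complex.exp (-(Real.pi * n * x) * Complex.I) * g x = 0) :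
    ∀ᵐ x ∂(volume.restrict (Ioc (-1:ℝ) 1)), g x = 0 := by
  have hT : Fact ((0:ℝ) < 2) := ⟨by norm_num⟩
  have e1 : (-1:ℝ) + 2 = 1 := by norm_num
  have hg' : MemLp g 2 (volume.restrict (Ioc (-1:ℝ) (-1 + 2))) := by rwa [e1]
  have hL := hg'.memLp_liftIoc
  have hL' : MemLp (AddCircle.liftIoc 2 (-1) g) 2 (@AddCircle.haarAddCircle 2 hT) :=
    memLp_haarAddCircle_iff.2 hL
  have hz : hL'.toLp _ = 0 := by
    apply fourierBasis.repr.injective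
    rw [map_zero]
    ext n
    rw [fourierBasis_repr, fourierCoeff_congr_ae hL'.coeFn_toLp, fourierCoeff_liftIoc_eq,
      fourierCoeffOn_eq_integral]
    simp only [lp.coeFn_zero, Pi.zero_apply, smul_eq_zero]
    right
    rw [e1, ← h n]
    congr 1
    ext x
    rw [smul_eq_mul]
    congr 1
    rw [fourier_coe_apply]
    congr 1
    push_cast
    ring
  have h0 : AddCircle.liftIoc 2 (-1) g =ᵐ[@AddCircle.haarAddCircle 2 hT] 0 := by
    have h1 := hL'.coeFn_toLp
    rw [hz] at h1
    exact h1.symm.trans (Lp.coeFn_zero _ _ _)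
  have h1 : AddCircle.liftIoc 2 (-1) g =ᵐ[volume] 0 := by
    have : (volume : Measure (AddCircle (2:ℝ))) ≪ (@AddCircle.haarAddCircle 2 hT) := by
      rw [AddCircle.volume_eq_smul_haarAddCircle]
      exact Measure.smul_absolutelyContinuous
    exact this.ae_le h0
  have h2 := (AddCircle.measurePreserving_mk 2 (-1)).quasiMeasurePreserving.ae h1
  rw [e1] at h2
  filter_upwards [h2, ae_restrict_mem measurableSet_Ioc] with x hx hx'
  rw [AddCircle.liftIoc_coe_apply (by rwa [e1])] at hx
  exact hx

/-- `c₀` as an `E2`-valued function. -/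
def c0E (l : ℝ) (x : ℝ) : E2 := WithLp.toLp 2 (c0 (l : ℂ) x)

lemma c0E_zero (l x : ℝ) : c0E l x 0 = Complex.cos (l * x) := rfl
lemma c0E_one (l x : ℝ) : c0E l x 1 = Complex.sin (l * x) := rfl

lemma continuous_c0E (l : ℝ) : Continuous (c0E l) := by
  unfold c0E c0
  refine (PiLp.continuous_toLp 2 _).comp ?_
  refine continuous_pi fun i => ?_
  fin_cases i <;> simp <;> fun_prop

lemma memLp_c0E (l : ℝ) : MemLp (c0E l) 2 μ01 := memLp_of_continuous (continuous_c0E l)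

lemma inner_c0E_left (l x : ℝ) (v : E2) :
    inner ℂ (c0E l x) v = Complex.cos (l * x) * v 0 + Complex.sin (l * x) * v 1 := by
  rw [PiLp.inner_apply, Fin.sum_univ_two, c0E_zero, c0E_one]
  simp only [RCLike.inner_apply]
  rw [← Complex.ofReal_mul, ← Complex.ofReal_cos, ← Complex.ofReal_sin, Complex.conj_ofReal,
    Complex.conj_ofReal]
  ring

/-- The class of `c₀(·,l)` in `ℍ`. -/
def cv (l : ℝ) : HH := emb (c0E l)

/-- The unperturbed points. -/
def lam0 (n : ℤ) : ℝ := Real.pi * (n + 1/2)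

lemma integral_mu01 {F : Type*} [NormedAddCommGroup F] [NormedSpace ℝ F] (f : ℝ → F) :
    ∫ x, f x ∂μ01 = ∫ x in (0:ℝ)..1, f x := by
  rw [intervalIntegral.integral_of_le zero_le_one, μ01, integral_Ioc_eq_integral_Ioo]

lemma inner_cv (a b : ℝ) : inner ℂ (cv a) (cv b) = ((∫ x in (0:ℝ)..1, Real.cos ((a - b) * x) : ℝ) : ℂ) := by
  unfold cv
  rw [inner_emb (memLp_c0E a) (memLp_c0E b), integral_mu01, ← intervalIntegral.integral_ofReal]
  congr 1
  ext x
  rw [inner_c0E_left, c0E_zero, c0E_one]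
  push_cast
  rw [show ((a:ℂ) - b) * x = a * x - b * x by ring, Complex.cos_sub]

lemma orthonormal_e : Orthonormal ℂ (fun n : ℤ => cv (lam0 n)) := by
  rw [orthonormal_iff_ite]
  intro m n
  rw [inner_cv]
  split_ifs with h
  · subst h; simp
  · have hne : lam0 m - lam0 n ≠ 0 := by
      unfold lam0
      have : ((m:ℝ) - n) ≠ 0 := by
        rw [sub_ne_zero]; exact_mod_cast h
      have h2 : Real.pi * (m + 1/2) - Real.pi * (n + 1/2) = Real.pi * ((m:ℝ) - n) := by ring
      rw [h2]
      exact mul_ne_zero Real.pi_ne_zero this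
    rw [intervalIntegral.integral_comp_mul_left (fun y => Real.cos y) hne]
    have h3 : Real.sin (lam0 m - lam0 n) = 0 := by
      rw [Real.sin_eq_zero_iff]
      exact ⟨m - n, by unfold lam0; push_cast; ring⟩
    simp [h3]

lemma coord_memLp (f : HH) (i : Fin 2) : MemLp (fun x => f x i) 2 μ01 := by
  refine MemLp.of_le (Lp.memLp f) ?_ (Eventually.of_forall fun x => PiLp.norm_apply_le (f x) i)
  exact (EuclideanSpace.proj (𝕜 := ℂ) i).continuous.comp_aestronglyMeasurable
    (Lp.aestronglyMeasurable f)

lemma mu01_eq_Ioc : μ01 = volume.restrict (Ioc (0:ℝ) 1) := by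
  unfold μ01
  exact Measure.restrict_congr_set Ioo_ae_eq_Ioc

lemma e_complete (f : HH) (h : ∀ n : ℤ, inner ℂ (cv (lam0 n)) f = 0) : f = 0 := by
  set p : ℝ → ℂ := fun x => f x 0 + I * f x 1 with hp
  set q : ℝ → ℂ := fun x => f x 0 - I * f x 1 with hq
  have hpm : MemLp p 2 μ01 := (coord_memLp f 0).add ((coord_memLp f 1).const_mul I)
  have hqm : MemLp q 2 μ01 := (coord_memLp f 0).sub ((coord_memLp f 1).const_mul I)
  set r : ℝ → ℂ := fun x => (Ioc (0:ℝ) 1).indicator p x + (Ico (-1:ℝ) 0).indicator (fun y => q (-y)) x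
    with hr
  have hpm' : MemLp ((Ioc (0:ℝ) 1).indicator p) 2 volume := by
    rw [memLp_indicator_iff_restrict measurableSet_Ioc, ← mu01_eq_Ioc]; exact hpm
  have hqm' : MemLp ((Ioc (0:ℝ) 1).indicator q) 2 volume := by
    rw [memLp_indicator_iff_restrict measurableSet_Ioc, ← mu01_eq_Ioc]; exact hqm
  have hq2 : MemLp ((Ico (-1:ℝ) 0).indicator (fun y => q (-y))) 2 volume := by
    have := hqm'.comp_measurePreserving (Measure.measurePreserving_neg volume)
    convert this using 1
    ext y
    simp only [Function.comp, indicator, mem_Ico, mem_Ioc]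
    congr 1
    apply propext
    constructor <;> rintro ⟨h1, h2⟩ <;> constructor <;> linarith
  have hrm : MemLp r 2 volume := hpm'.add hq2
  set g : ℝ → ℂ := fun x => Complex.exp (-(Real.pi / 2 * x) * I) * r x with hgdef
  have hexp : ∀ a : ℝ, ∀ x : ℝ, ‖Complex.exp (-(a * x) * I)‖ = 1 := by
    intro a x
    have : (-((a:ℂ) * x) * I) = ((-(a * x) : ℝ) : ℂ) * I := by push_cast; ring
    rw [this, Complex.norm_exp_ofReal_mul_I]
  have hmul : ∀ a : ℝ, ∀ s : ℝ → ℂ, ∀ μ : Measure ℝ, MemLp s 2 μ →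
      MemLp (fun x : ℝ => Complex.exp (-(a * x) * I) * s x) 2 μ := by
    intro a s μ hs
    refine MemLp.of_le hs ?_ (Eventually.of_forall fun x => ?_)
    · exact (Continuous.aestronglyMeasurable (by fun_prop)).mul hs.aestronglyMeasurable
    · rw [norm_mul, hexp, one_mul]
  have hgm : MemLp g 2 volume := by
    have := hmul (Real.pi/2) r volume hrm
    simpa [hgdef] using this
  have hprod : ∀ n : ℤ, ∀ x : ℝ, Complex.exp (-(Real.pi * n * x) * I) * g x =
      Complex.exp (-(lam0 n * x) * I) * r x := by
    intro n x
    rw [hgdef]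
    simp only
    rw [← mul_assoc, ← Complex.exp_add]
    congr 2
    unfold lam0
    push_cast
    ring
  have hfour : ∀ n : ℤ, ∫ x in (-1:ℝ)..1, Complex.exp (-(Real.pi * n * x) * I) * g x = 0 := by
    intro n
    simp only [hprod]
    have hI : ∀ a b : ℝ, IntervalIntegrable (fun x : ℝ => Complex.exp (-(lam0 n * x) * I) * r x)
        volume a b := by
      intro a b
      rw [intervalIntegrable_iff]
      have hfin : IsFiniteMeasure (volume.restrict (uIoc a b)) := by rw [uIoc]; infer_instance
      exact ((hmul (lam0 n) r volume hrm).restrict _).integrable (by norm_num)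
    rw [← intervalIntegral.integral_add_adjacent_intervals (hI (-1) 0) (hI 0 1)]
    have hneg : ∫ x in (-1:ℝ)..0, Complex.exp (-(lam0 n * x) * I) * r x
        = ∫ x in (0:ℝ)..1, Complex.exp (-(lam0 n * (-x : ℝ)) * I) * r (-x) := by
      have := intervalIntegral.integral_comp_neg (a := 0) (b := 1)
        (fun x : ℝ => Complex.exp (-(lam0 n * x) * I) * r x)
      rw [this]; simp
    have hI2 : IntervalIntegrable
        (fun x : ℝ => Complex.exp (-(lam0 n * (-x : ℝ)) * I) * r (-x)) volume 0 1 := by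
      have := (hI 0 (-1)).comp_sub_left 0
      simpa using this
    rw [hneg, ← intervalIntegral.integral_add hI2 (hI 0 1)]
    have h2 := h n
    unfold cv at h2
    rw [← emb_self f, inner_emb (memLp_c0E _) (Lp.memLp f), integral_mu01] at h2
    have h3 : ∫ x in (0:ℝ)..1, (Complex.exp (-(lam0 n * (-x : ℝ)) * I) * r (-x)
        + Complex.exp (-(lam0 n * x) * I) * r x)
        = ∫ x in (0:ℝ)..1, 2 * inner ℂ (c0E (lam0 n) x) (f x) := by
      rw [intervalIntegral.integral_of_le zero_le_one, intervalIntegral.integral_of_le zero_le_one]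
      refine setIntegral_congr_fun measurableSet_Ioc ?_
      intro x hx
      have r1 : r x = p x := by
        have : x ∉ Ico (-1:ℝ) 0 := fun h' => absurd h'.2 (not_lt.2 hx.1.le)
        simp [hr, hx.1, hx.2, indicator_of_notMem this]
      have r2 : r (-x) = q x := by
        have : -x ∉ Ioc (0:ℝ) 1 := fun h' => by have := h'.1; have := hx.1; linarith
        have h'' : -x ∈ Ico (-1:ℝ) 0 := ⟨by linarith [hx.2], by linarith [hx.1]⟩
        simp only [hr]
        rw [indicator_of_notMem this, indicator_of_mem h'']; simp
      simp only [r1, r2, inner_c0E_left, hp, hq, Complex.cos, Complex.sin]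
      have e1 : -(((lam0 n : ℝ) : ℂ) * ((-x : ℝ) : ℂ)) * I = (lam0 n : ℂ) * x * I := by
        push_cast; ring
      have e2 : -(((lam0 n : ℝ) : ℂ) * (x : ℂ)) * I = -(lam0 n : ℂ) * x * I := by ring
      have e3 : -(((lam0 n : ℝ) : ℂ) * (x : ℂ) * I) = -(lam0 n : ℂ) * x * I := by ring
      rw [e1, e2]
      have hII : I * I = -1 := Complex.I_mul_I
      linear_combination 0 * hII
    rw [h3]
    rw [intervalIntegral.integral_const_mul, h2, mul_zero]
  have hg0 := fourier_unique g (hgm.restrict _) hfour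
  rw [ae_restrict_iff' measurableSet_Ioc] at hg0
  have hg1 := (Measure.measurePreserving_neg (volume : Measure ℝ)).quasiMeasurePreserving.ae hg0
  refine Lp.ext ?_
  have hboth : ∀ᵐ x ∂μ01, f x = 0 := by
    unfold μ01
    rw [ae_restrict_iff' measurableSet_Ioo]
    filter_upwards [hg0, hg1] with x h1 h2 hx
    have h1' := h1 ⟨by linarith [hx.1], hx.2.le⟩
    have h2' := h2 ⟨by linarith [hx.2], by linarith [hx.1]⟩
    simp only [hgdef, mul_eq_zero, Complex.exp_ne_zero, false_or] at h1' h2'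
    have r1 : r x = p x := by
      have : x ∉ Ico (-1:ℝ) 0 := fun h' => absurd h'.2 (not_lt.2 hx.1.le)
      simp [hr, hx.1, hx.2.le, indicator_of_notMem this]
    have r2 : r (-x) = q x := by
      have : -x ∉ Ioc (0:ℝ) 1 := fun h' => by have := h'.1; have := hx.1; linarith
      have h'' : -x ∈ Ico (-1:ℝ) 0 := ⟨by linarith [hx.2], by linarith [hx.1]⟩
      simp only [hr]
      rw [indicator_of_notMem this, indicator_of_mem h'']; simp
    rw [r1] at h1'
    rw [r2] at h2'
    simp only [hp, hq] at h1' h2'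
    have a0 : f x 0 = 0 := by linear_combination (h1' + h2') / 2
    have a1 : f x 1 = 0 := by
      rw [a0] at h1'
      simpa using h1'
    ext i
    fin_cases i
    · exact a0
    · exact a1
  filter_upwards [hboth, Lp.coeFn_zero E2 2 μ01] with x h1 h2
  rw [h1, h2]; rfl

/-- The orthonormal basis `c₀(·, π(n+1/2))` of `ℍ`. -/
def eB : HilbertBasis ℤ ℂ HH :=
  HilbertBasis.mkOfOrthogonalEqBot orthonormal_e (by
    rw [Submodule.eq_bot_iff]
    intro f hf
    refine e_complete f fun n => ?_
    exact (Submodule.mem_orthogonal _ f).1 hf _ (Submodule.subset_span ⟨n, rfl⟩))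

lemma eB_apply (n : ℤ) : eB n = cv (lam0 n) := by
  unfold eB
  rw [HilbertBasis.coe_mkOfOrthogonalEqBot]


/-! ### Rotations and nonharmonic systems -/

/-- The rotation by angle `θ` on `E2`. -/
def RotC (θ : ℝ) : E2 →L[ℂ] E2 := Matrix.toEuclideanCLM (n := Fin 2) (𝕜 := ℂ) (expB (θ : ℂ))

lemma RotC_zero (θ : ℝ) (v : E2) : RotC θ v 0 = Complex.cos θ * v 0 - Complex.sin θ * v 1 := by
  have : (RotC θ v) 0 = ((expB θ).mulVec (WithLp.ofLp v)) 0 := rfl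
  rw [this]
  simp [expB, Matrix.mulVec, dotProduct, Fin.sum_univ_two]
  ring

lemma RotC_one (θ : ℝ) (v : E2) : RotC θ v 1 = Complex.sin θ * v 0 + Complex.cos θ * v 1 := by
  have : (RotC θ v) 1 = ((expB θ).mulVec (WithLp.ofLp v)) 1 := rfl
  rw [this]
  simp [expB, Matrix.mulVec, dotProduct, Fin.sum_univ_two]

lemma E2_ext {v w : E2} (h0 : v 0 = w 0) (h1 : v 1 = w 1) : v = w := by
  ext i
  fin_cases i
  · exact h0
  · exact h1

lemma E2_norm_sq (v : E2) : ‖v‖ ^ 2 = ‖v 0‖ ^ 2 + ‖v 1‖ ^ 2 := by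
  rw [EuclideanSpace.norm_sq_eq, Fin.sum_univ_two]

lemma norm_RotC_apply (θ : ℝ) (v : E2) : ‖RotC θ v‖ = ‖v‖ := by
  have h : ‖RotC θ v‖ ^ 2 = ‖v‖ ^ 2 := by
    rw [E2_norm_sq, E2_norm_sq, RotC_zero, RotC_one, ← Complex.ofReal_cos, ← Complex.ofReal_sin]
    simp only [← Complex.normSq_eq_norm_sq, Complex.normSq_apply]
    simp [-Complex.ofReal_cos, -Complex.ofReal_sin]
    have := Real.sin_sq_add_cos_sq θ
    linear_combination ((v 0).re ^ 2 + (v 0).im ^ 2 + (v 1).re ^ 2 + (v 1).im ^ 2) * this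
  exact (sq_eq_sq₀ (norm_nonneg _) (norm_nonneg _)).1 h

lemma norm_RotC_le (θ : ℝ) : ‖RotC θ‖ ≤ 1 :=
  ContinuousLinearMap.opNorm_le_bound _ zero_le_one fun v => by rw [norm_RotC_apply, one_mul]

lemma RotC_c0E (a l x : ℝ) : RotC (a * x) (c0E l x) = c0E (l + a) x := by
  refine E2_ext ?_ ?_
  · rw [RotC_zero, c0E_zero, c0E_one, c0E_zero]
    push_cast
    rw [show ((l:ℂ) + a) * x = a * x + l * x by ring, Complex.cos_add]
  · rw [RotC_one, c0E_zero, c0E_one, c0E_one]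
    push_cast
    rw [show ((l:ℂ) + a) * x = a * x + l * x by ring, Complex.sin_add]

lemma RotC_add (a b : ℝ) (v : E2) : RotC a (RotC b v) = RotC (a + b) v := by
  refine E2_ext ?_ ?_
  · simp only [RotC_zero, RotC_one]
    push_cast
    rw [Complex.cos_add, Complex.sin_add]; ring
  · simp only [RotC_zero, RotC_one]
    push_cast
    rw [Complex.cos_add, Complex.sin_add]; ring

/-- Rotation by a right angle. -/
def Rop : E2 →L[ℂ] E2 := RotC (Real.pi / 2)

lemma Rop_zero (v : E2) : Rop v 0 = - v 1 := by
  unfold Rop; rw [RotC_zero, ← Complex.ofReal_cos, ← Complex.ofReal_sin]; simp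

lemma Rop_one (v : E2) : Rop v 1 = v 0 := by
  unfold Rop; rw [RotC_one, ← Complex.ofReal_cos, ← Complex.ofReal_sin]; simp

lemma norm_c0E (l x : ℝ) : ‖c0E l x‖ = 1 := by
  have h : ‖c0E l x‖ ^ 2 = 1 := by
    rw [E2_norm_sq, c0E_zero, c0E_one, ← Complex.ofReal_mul, ← Complex.ofReal_cos,
      ← Complex.ofReal_sin, Complex.norm_real, Complex.norm_real]
    simp
  exact (sq_eq_sq₀ (norm_nonneg _) zero_le_one).1 (by rw [h]; norm_num)

lemma norm_emb_le {f : ℝ → E2} (hf : MemLp f 2 μ01) {C : ℝ} (hC0 : 0 ≤ C)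
    (hC : ∀ x ∈ Ioo (0:ℝ) 1, ‖f x‖ ≤ C) : ‖emb f‖ ≤ C := by
  have h : ∀ᵐ x ∂μ01, ‖(emb f : HH) x‖ ≤ C := by
    have h1 : ∀ᵐ x ∂μ01, x ∈ Ioo (0:ℝ) 1 := ae_restrict_mem measurableSet_Ioo
    filter_upwards [emb_coe hf, h1] with x hx hx'
    rw [hx]; exact hC x hx'
  have := Lp.norm_le_of_ae_bound hC0 h
  rw [measureUnivNNReal] at this
  rw [mu01_univ] at this
  simpa using this

lemma continuous_RotC_mul (a : ℝ) : Continuous (fun x : ℝ => RotC (a * x)) := by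
  have hl : ∀ θ : ℝ, RotC θ = (Real.cos θ : ℂ) • (1 : E2 →L[ℂ] E2) + (Real.sin θ : ℂ) • Rop := by
    intro θ
    ext1 v
    refine E2_ext ?_ ?_
    · rw [RotC_zero]; simp [Rop_zero]; ring
    · rw [RotC_one]; simp [Rop_one]; ring
  simp only [hl]
  fun_prop

lemma RotC_lin_estimate (δ : ℝ) (hδ : |δ| ≤ 1) (v : E2) :
    ‖RotC δ v - v - (δ : ℂ) • Rop v‖ ≤ 2 * δ ^ 2 * ‖v‖ := by
  have h1 := Complex.norm_exp_sub_one_sub_id_le (x := (δ : ℂ) * I) (by simpa using hδ)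
  have e1 : Complex.exp ((δ:ℂ) * I) - 1 - δ * I =
      ((Real.cos δ - 1 : ℝ) : ℂ) + ((Real.sin δ - δ : ℝ) : ℂ) * I := by
    rw [Complex.exp_mul_I]; push_cast; ring
  rw [e1] at h1
  have hre := (Complex.abs_re_le_norm _).trans h1
  have him := (Complex.abs_im_le_norm _).trans h1
  simp only [Complex.add_re, Complex.ofReal_re, Complex.mul_re, Complex.I_re, Complex.I_im,
    Complex.ofReal_im, Complex.add_im, Complex.mul_im, norm_mul, Complex.norm_I,
    Complex.norm_real, Real.norm_eq_abs] at hre him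
  simp at hre him
  have e2 : RotC δ v - v - (δ : ℂ) • Rop v =
      ((Real.cos δ - 1 : ℝ) : ℂ) • v + ((Real.sin δ - δ : ℝ) : ℂ) • Rop v := by
    refine E2_ext ?_ ?_
    · simp [RotC_zero, Rop_zero]; ring
    · simp [RotC_one, Rop_one]; ring
  have e3 : ‖Rop v‖ = ‖v‖ := norm_RotC_apply _ _
  rw [e2]
  refine (norm_add_le _ _).trans ?_
  rw [norm_smul, norm_smul, e3, Complex.norm_real, Complex.norm_real, Real.norm_eq_abs,
    Real.norm_eq_abs]
  nlinarith [norm_nonneg v]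

/-- Existence of the generator `X` (multiplication by `x R`). -/
lemma exists_X : ∃ X : HH →L[ℂ] HH, ‖X‖ ≤ 1 ∧
    ∀ f : HH, X f =ᵐ[μ01] fun x => (x : ℂ) • Rop (f x) := by
  obtain ⟨X, h1, h2⟩ := exists_mulOp (fun x => (x : ℂ) • Rop)
    (Continuous.stronglyMeasurable (by fun_prop)) 1 zero_le_one (by
      intro x hx
      rw [norm_smul, Complex.norm_real, Real.norm_eq_abs, abs_of_pos hx.1]
      have := norm_RotC_le (Real.pi / 2)
      have h3 : ‖Rop‖ ≤ 1 := this
      nlinarith [hx.1, hx.2, norm_nonneg Rop])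
  exact ⟨X, h1, h2⟩

lemma hasDerivAt_cv (X : HH →L[ℂ] HH)
    (hX : ∀ f : HH, X f =ᵐ[μ01] fun x => (x : ℂ) • Rop (f x)) (l : ℝ) :
    HasDerivAt cv (X (cv l)) l := by
  have hXc : X (cv l) = emb (fun x => (x : ℂ) • Rop (c0E l x)) := by
    refine eq_emb ?_
    filter_upwards [hX (cv l), emb_coe (memLp_c0E l)] with x h1 h2
    rw [h1, cv, h2]
  have hm : MemLp (fun x : ℝ => (x : ℂ) • Rop (c0E l x)) 2 μ01 :=
    memLp_of_continuous (by have := continuous_c0E l; fun_prop)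
  rw [hasDerivAt_iff_isLittleO_nhds_zero]
  refine Asymptotics.IsBigO.trans_isLittleO (g := fun h : ℝ => h ^ 2) ?_ ?_
  · refine Asymptotics.IsBigO.of_bound 2 ?_
    have : ∀ᶠ h : ℝ in nhds 0, |h| < 1 := by
      have := Metric.ball_mem_nhds (0:ℝ) one_pos
      filter_upwards [this] with h hh
      simpa using hh
    filter_upwards [this] with h hh
    have e : cv (l + h) - cv l - h • X (cv l)
        = emb (fun x => c0E (l + h) x - c0E l x - (h : ℂ) • ((x : ℂ) • Rop (c0E l x))) := by
      have e1 := emb_sub (f := fun x => c0E (l + h) x - c0E l x)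
        (g := fun x : ℝ => (h : ℂ) • ((x : ℂ) • Rop (c0E l x)))
        ((memLp_c0E (l + h)).sub (memLp_c0E l)) (hm.const_smul (h:ℂ))
      have e2 := emb_sub (memLp_c0E (l + h)) (memLp_c0E l)
      have e3 := emb_smul (h : ℂ) hm
      rw [e1, e2, e3, ← hXc]
      rfl
    rw [e]
    refine norm_emb_le (((memLp_c0E _).sub (memLp_c0E _)).sub (hm.const_smul (h:ℂ)))
      (by positivity) ?_
    intro x hx
    have h3 : |h * x| ≤ |h| := by
      rw [abs_mul, abs_of_pos hx.1]; nlinarith [hx.2, abs_nonneg h]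
    have := RotC_lin_estimate (h * x) (h3.trans hh.le) (c0E l x)
    rw [RotC_c0E, norm_c0E, mul_one] at this
    have e4 : (c0E (l + h) - c0E l - (h:ℂ) • fun x : ℝ => (x:ℂ) • Rop (c0E l x)) x
        = c0E (l + h) x - c0E l x - ((h * x : ℝ) : ℂ) • Rop (c0E l x) := by
      simp only [Pi.sub_apply, Pi.smul_apply]
      rw [smul_smul, ← Complex.ofReal_mul]
    rw [e4]
    refine this.trans ?_
    rw [← sq_abs (h * x), Real.norm_eq_abs, abs_of_nonneg (sq_nonneg h), ← sq_abs h]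
    gcongr
  · have : (fun h : ℝ => h ^ 2) = fun h : ℝ => h ^ 2 := rfl
    exact Asymptotics.isLittleO_pow_id one_lt_two

lemma exp_X_cv (X : HH →L[ℂ] HH)
    (hX : ∀ f : HH, X f =ᵐ[μ01] fun x => (x : ℂ) • Rop (f x)) (l s : ℝ) :
    NormedSpace.exp ((s : ℂ) • X) (cv l) = cv (l + s) := by
  -- the derivative of `exp (-s X) (cv (l + s))` vanishes
  have hd : ∀ s : ℝ, HasDerivAt (fun s : ℝ => NormedSpace.exp ((s : ℂ) • (-X)) (cv (l + s))) 0 s := by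
    intro s
    have h1 : HasDerivAt (fun s : ℝ => NormedSpace.exp ((s : ℂ) • (-X)))
        (NormedSpace.exp ((s : ℂ) • (-X)) * (-X)) s := by
      have := (hasDerivAt_exp_smul_const (𝕂 := ℂ) (-X) (s : ℂ)).scomp s
        (Complex.ofRealCLM.hasDerivAt (x := s))
      simpa [Function.comp_def] using this
    have h2 : HasDerivAt (fun s : ℝ => cv (l + s)) (X (cv (l + s))) s := by
      have := (hasDerivAt_cv X hX (l + s)).comp_const_add l s
      exact this
    have h1r := (ContinuousLinearMap.restrictScalarsL ℂ HH HH ℝ ℝ).hasFDerivAt.comp_hasDerivAt s h1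
    have := h1r.clm_apply h2
    have e0 : (0:HH) = (NormedSpace.exp ((s : ℂ) • (-X))) ((-X) (cv (l + s)))
        + (NormedSpace.exp ((s : ℂ) • (-X))) (X (cv (l + s))) := by
      rw [← map_add]
      simp
    rw [e0]
    exact this
  have hconst := is_const_of_deriv_eq_zero (fun s => (hd s).differentiableAt)
    (fun s => (hd s).deriv) s 0
  simp only [Complex.ofReal_zero, zero_smul, NormedSpace.exp_zero, add_zero,
    one_apply_eq_self] at hconst
  let _ : NormedAlgebra ℚ (HH →L[ℂ] HH) := NormedAlgebra.restrictScalars ℚ ℂ (HH →L[ℂ] HH)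
  rw [← hconst, ← mul_apply_eq_comp, smul_neg, ← NormedSpace.exp_add_of_commute]
  · simp
  · exact (Commute.refl _).neg_right

instance instNontrivialHH : Nontrivial HH := ⟨⟨cv (lam0 0), 0, orthonormal_e.ne_zero 0⟩⟩

lemma exists_diag (a : ℤ → ℂ) (C : ℝ) (hC0 : 0 ≤ C) (hC : ∀ n, ‖a n‖ ≤ C) :
    ∃ D : HH →L[ℂ] HH, ‖D‖ ≤ C ∧ ∀ n, D (cv (lam0 n)) = a n • cv (lam0 n) := by
  have hmem : ∀ f : lp (fun _ : ℤ => ℂ) 2, Memℓp (fun n => a n * f n) 2 := by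
    intro f
    have h1 : Memℓp (fun n => (C:ℂ) * f n) 2 := (lp.memℓp f).const_mul (C:ℂ)
    refine h1.mono' fun n => ?_
    rw [norm_mul, norm_mul, Complex.norm_real, Real.norm_eq_abs, abs_of_nonneg hC0]
    gcongr; exact hC n
  let L : lp (fun _ : ℤ => ℂ) 2 →ₗ[ℂ] lp (fun _ : ℤ => ℂ) 2 :=
    { toFun := fun f => ⟨fun n => a n * f n, hmem f⟩
      map_add' := by
        intro f g; ext n; exact mul_add _ _ _
      map_smul' := by
        intro c f; ext n; simp; ring }
  let L' : lp (fun _ : ℤ => ℂ) 2 →L[ℂ] lp (fun _ : ℤ => ℂ) 2 := L.mkContinuous C (by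
    intro f
    have h2 : ‖(C:ℂ) • f‖ = C * ‖f‖ := by
      rw [norm_smul, Complex.norm_real, Real.norm_eq_abs, abs_of_nonneg hC0]
    rw [← h2]
    refine lp.norm_mono (by norm_num) fun n => ?_
    show ‖a n * f n‖ ≤ ‖(C:ℂ) * f n‖
    rw [norm_mul, norm_mul, Complex.norm_real, Real.norm_eq_abs, abs_of_nonneg hC0]
    gcongr; exact hC n)
  have hL' : ‖L'‖ ≤ C := L.mkContinuous_norm_le hC0 _
  refine ⟨(eB.repr.symm : lp (fun _ : ℤ => ℂ) 2 →L[ℂ] HH) ∘L L' ∘L (eB.repr : HH →L[ℂ] _), ?_, ?_⟩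
  · refine ContinuousLinearMap.opNorm_le_bound _ hC0 fun f => ?_
    simp only [ContinuousLinearMap.comp_apply]
    have : ‖eB.repr.symm (L' (eB.repr f))‖ ≤ C * ‖f‖ := by
      rw [LinearIsometryEquiv.norm_map]
      refine (L'.le_opNorm _).trans ?_
      rw [LinearIsometryEquiv.norm_map]
      gcongr
    exact this
  · intro n
    show eB.repr.symm (L' (eB.repr (cv (lam0 n)))) = _
    rw [← eB_apply]
    apply eB.repr.injective
    rw [LinearIsometryEquiv.apply_symm_apply, map_smul, HilbertBasis.repr_self]
    ext m
    show a m * (lp.single 2 n (1:ℂ) : lp (fun _ : ℤ => ℂ) 2) m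
      = a n * (lp.single 2 n (1:ℂ) : lp (fun _ : ℤ => ℂ) 2) m
    by_cases h : m = n
    · rw [h]
    · simp [lp.single_apply, h]

/-- The perturbation operator mapping `c₀(·,π(n+1/2))` to `c₀(·,π(n+1/2)+ε n)`. -/
lemma exists_pert (ε : ℤ → ℝ) (C : ℝ) (hC0 : 0 ≤ C) (hC : ∀ n, |ε n| ≤ C) :
    ∃ T : HH →L[ℂ] HH, ‖T - 1‖ ≤ Real.exp C - 1 ∧ ∀ n, T (cv (lam0 n)) = cv (lam0 n + ε n) := by
  obtain ⟨X, hX1, hX⟩ := exists_X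
  obtain ⟨D, hD1, hD⟩ := exists_diag (fun n => (ε n : ℂ)) C hC0 (fun n => by simpa using hC n)
  set t : ℕ → HH →L[ℂ] HH := fun j => ((j.factorial : ℂ)⁻¹) • (X ^ j * D ^ j) with ht
  have hnorm : ∀ j, ‖t j‖ ≤ C ^ j / j.factorial := by
    intro j
    rw [ht]
    simp only
    rw [norm_smul, norm_inv, Complex.norm_natCast, inv_mul_eq_div]
    gcongr
    calc ‖X ^ j * D ^ j‖ ≤ ‖X ^ j‖ * ‖D ^ j‖ := norm_mul_le _ _
      _ ≤ 1 * C ^ j := by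
        gcongr
        · exact (norm_pow_le X j).trans (pow_le_one₀ (norm_nonneg _) hX1)
        · exact (norm_pow_le D j).trans (by gcongr)
      _ = C ^ j := one_mul _
  have hsumR : HasSum (fun j : ℕ => C ^ j / j.factorial) (Real.exp C) := by
    rw [Real.exp_eq_exp_ℝ]
    exact NormedSpace.expSeries_div_hasSum_exp C
  have hs : Summable t := Summable.of_norm_bounded hsumR.summable hnorm
  refine ⟨∑' j, t j, ?_, ?_⟩
  · have h0 : t 0 = 1 := by simp [ht]
    have e : ∑' j, t j - 1 = ∑' j, t (j + 1) := by
      rw [hs.tsum_eq_zero_add, h0]; abel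
    rw [e]
    have h1 : HasSum (fun j : ℕ => C ^ (j+1) / (j+1).factorial) (Real.exp C - 1) := by
      have := (hasSum_nat_add_iff' 1).2 hsumR
      simpa using this
    exact tsum_of_norm_bounded h1 fun j => hnorm (j+1)
  · intro n
    have h1 : (∑' j, t j) (cv (lam0 n)) = ∑' j, t j (cv (lam0 n)) := by
      exact (ContinuousLinearMap.apply ℂ HH (cv (lam0 n))).map_tsum hs
    have hDj : ∀ j : ℕ, (D ^ j) (cv (lam0 n)) = ((ε n : ℂ) ^ j) • cv (lam0 n) := by
      intro j
      induction j with
      | zero => simp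
      | succ j ih =>
        rw [pow_succ, mul_apply_eq_comp, hD, map_smul, ih, smul_smul, pow_succ]
        ring_nf
    have h2 := NormedSpace.exp_series_hasSum_exp' (𝕂 := ℂ) ((ε n : ℂ) • X)
    have h3 := h2.mapL (ContinuousLinearMap.apply ℂ HH (cv (lam0 n)))
    rw [h1, ← exp_X_cv X hX]
    refine HasSum.tsum_eq ?_
    have h4 : (fun j => t j (cv (lam0 n))) = fun j : ℕ => (ContinuousLinearMap.apply ℂ HH (cv (lam0 n)))
        (((j.factorial : ℂ)⁻¹) • ((ε n : ℂ) • X) ^ j) := by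
      ext1 j
      simp only [ht, ContinuousLinearMap.apply_apply, _root_.smul_apply,
        mul_apply_eq_comp, hDj, smul_pow, map_smul]
    rw [h4]
    exact h3


lemma hasDerivAt_c0E (l x : ℝ) : HasDerivAt (c0E l) ((l : ℂ) • Rop (c0E l x)) x := by
  have hc : HasDerivAt (fun y : ℝ => ((Real.cos (l * y) : ℝ) : ℂ)) ((-(Real.sin (l * x)) * l : ℝ) : ℂ) x := by
    have h1 : HasDerivAt (fun y : ℝ => l * y) l x := by
      simpa using (hasDerivAt_id x).const_mul l
    exact (HasDerivAt.ofReal_comp h1.cos)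
  have hs : HasDerivAt (fun y : ℝ => ((Real.sin (l * y) : ℝ) : ℂ)) ((Real.cos (l * x) * l : ℝ) : ℂ) x := by
    have h1 : HasDerivAt (fun y : ℝ => l * y) l x := by
      simpa using (hasDerivAt_id x).const_mul l
    exact (HasDerivAt.ofReal_comp h1.sin)
  have h := (hc.smul_const (EuclideanSpace.single (0 : Fin 2) (1:ℂ))).add
    (hs.smul_const (EuclideanSpace.single (1 : Fin 2) (1:ℂ)))
  have e1 : c0E l = ((fun y : ℝ => ((Real.cos (l * y) : ℝ) : ℂ) • EuclideanSpace.single (0 : Fin 2) (1:ℂ))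
      + fun y : ℝ => ((Real.sin (l * y) : ℝ) : ℂ) • EuclideanSpace.single (1 : Fin 2) (1:ℂ)) := by
    ext1 y
    refine E2_ext ?_ ?_
    · rw [c0E_zero]; simp
    · rw [c0E_one]; simp
  rw [e1]
  have e2 : (l : ℂ) • Rop (((fun y : ℝ => ((Real.cos (l * y) : ℝ) : ℂ) • EuclideanSpace.single (0 : Fin 2) (1:ℂ))
      + fun y : ℝ => ((Real.sin (l * y) : ℝ) : ℂ) • EuclideanSpace.single (1 : Fin 2) (1:ℂ)) x) =
      ((-(Real.sin (l * x)) * l : ℝ) : ℂ) • EuclideanSpace.single (0 : Fin 2) (1:ℂ)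
      + ((Real.cos (l * x) * l : ℝ) : ℂ) • EuclideanSpace.single (1 : Fin 2) (1:ℂ) := by
    refine E2_ext ?_ ?_
    · simp [Rop_zero]; ring
    · simp [Rop_one]; ring
  rw [e2]
  exact h

/-- The Cauchy solution operator. -/
lemma exists_V (a : ℝ) : ∃ V : HH →L[ℂ] HH, ∀ z : ℝ, z ≠ a →
    V (cv z) = ((z - a : ℝ) : ℂ)⁻¹ • (cv z - cv a) := by
  obtain ⟨T, hT⟩ := exists_intOp
  obtain ⟨P, -, hP⟩ := exists_mulOp (fun x => RotC (a * x))
    (continuous_RotC_mul a).stronglyMeasurable 1 zero_le_one (fun x _ => norm_RotC_le _)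
  obtain ⟨Q, -, hQ⟩ := exists_mulOp (fun x => Rop ∘L RotC ((-a) * x))
    (Continuous.stronglyMeasurable (by have := continuous_RotC_mul (-a); fun_prop)) 1 zero_le_one
    (fun x _ => (ContinuousLinearMap.opNorm_comp_le _ _).trans
      (mul_le_one₀ (norm_RotC_le _) (norm_nonneg _) (norm_RotC_le _)))
  refine ⟨P ∘L T ∘L Q, fun z hz => ?_⟩
  have hza : ((z - a : ℝ) : ℂ) ≠ 0 := by exact_mod_cast sub_ne_zero.2 hz
  have hcR : ∀ l : ℝ, Continuous (fun x => Rop (c0E l x)) := fun l => by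
    have := continuous_c0E l; fun_prop
  have h1 : Q (cv z) = emb (fun x => Rop (c0E (z - a) x)) := by
    refine eq_emb ?_
    filter_upwards [hQ (cv z), emb_coe (memLp_c0E z)] with x h1 h2
    rw [h1, cv, h2, ContinuousLinearMap.comp_apply, RotC_c0E, sub_eq_add_neg]
  have h2 : T (Q (cv z)) = emb (fun x => ((z - a : ℝ) : ℂ)⁻¹ • (c0E (z - a) x - c0E 0 x)) := by
    refine eq_emb ?_
    have hm : ∀ᵐ x ∂μ01, x ∈ Ioo (0:ℝ) 1 := ae_restrict_mem measurableSet_Ioo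
    filter_upwards [hT (Q (cv z)), hm] with x hx hx'
    rw [hx]
    have hcong : ∫ t in (0:ℝ)..x, (Q (cv z)) t = ∫ t in (0:ℝ)..x, Rop (c0E (z - a) t) := by
      rw [ii_eq _ (Ioo_subset_Icc_self hx'), ii_eq _ (Ioo_subset_Icc_self hx')]
      refine integral_congr_ae ?_
      rw [h1]
      filter_upwards [emb_coe (memLp_of_continuous (p := 2) (hcR (z - a)))] with t ht
      simp only [indicator]; rw [ht]; rfl
    rw [hcong]
    have hder : ∀ t ∈ uIcc 0 x, HasDerivAt (fun t => ((z - a : ℝ) : ℂ)⁻¹ • c0E (z - a) t)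
        (Rop (c0E (z - a) t)) t := by
      intro t _
      have := (hasDerivAt_c0E (z - a) t).const_smul (((z - a : ℝ) : ℂ)⁻¹)
      rw [smul_smul, inv_mul_cancel₀ hza, one_smul] at this
      exact this
    rw [intervalIntegral.integral_eq_sub_of_hasDerivAt hder ((hcR _).intervalIntegrable _ _),
      smul_sub]
    congr 2
    refine E2_ext ?_ ?_
    · simp [c0E_zero]
    · simp [c0E_one]
  have hmm : MemLp (fun x => ((z - a : ℝ) : ℂ)⁻¹ • (c0E (z - a) x - c0E 0 x)) 2 μ01 :=
    MemLp.const_smul (f := fun x => c0E (z - a) x - c0E 0 x) ((memLp_c0E (z - a)).sub (memLp_c0E 0))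
      (((z - a : ℝ) : ℂ)⁻¹)
  have h3 : P (T (Q (cv z))) = emb (fun x => ((z - a : ℝ) : ℂ)⁻¹ • (c0E z x - c0E a x)) := by
    refine eq_emb ?_
    filter_upwards [hP (T (Q (cv z))), emb_coe hmm] with x hx hx2
    rw [hx, h2, hx2, map_smul, map_sub, RotC_c0E, RotC_c0E]
    simp
  have e1 := emb_smul (((z - a : ℝ) : ℂ)⁻¹) (f := fun x => c0E z x - c0E a x)
    ((memLp_c0E z).sub (memLp_c0E a))
  have e2 := emb_sub (memLp_c0E z) (memLp_c0E a)
  show P (T (Q (cv z))) = _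
  rw [h3, e1, e2]
  rfl

lemma replace_step (a b : ℝ) (f : HH) (hf : inner ℂ (cv a) f = 0) :
    ∃ f' : HH, ∀ z : ℝ, z ≠ a →
      inner ℂ (cv z) f' = (((z - b) / (z - a) : ℝ) : ℂ) * inner ℂ (cv z) f := by
  obtain ⟨V, hV⟩ := exists_V a
  refine ⟨f + ((a - b : ℝ) : ℂ) • (ContinuousLinearMap.adjoint V f), fun z hz => ?_⟩
  have hza : (z : ℂ) - a ≠ 0 := by exact_mod_cast sub_ne_zero.2 hz
  rw [inner_add_right, inner_smul_right, ContinuousLinearMap.adjoint_inner_right, hV z hz,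
    inner_smul_left, inner_sub_left, hf, map_inv₀, Complex.conj_ofReal]
  push_cast
  field_simp
  ring

/-- Completeness of a system. -/
def ComplSys (s : ℤ → ℝ) : Prop := ∀ f : HH, (∀ n, inner ℂ (cv (s n)) f = 0) → f = 0

/-- Existence of a biorthogonal family. -/
def Biorth (s : ℤ → ℝ) : Prop :=
  ∀ k, ∃ w : HH, ∀ n, inner ℂ (cv (s n)) w = if n = k then 1 else 0

lemma small_pert (s : ℤ → ℝ) (h : ∀ n, |s n - lam0 n| ≤ 1/2) : ComplSys s ∧ Biorth s := by
  obtain ⟨T, hT1, hT⟩ := exists_pert (fun n => s n - lam0 n) (1/2) (by norm_num) h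
  have hT' : ∀ n, T (cv (lam0 n)) = cv (s n) := fun n => by rw [hT]; congr 1; ring
  have hlt : ‖1 - T‖ < 1 := by
    rw [norm_sub_rev]
    refine hT1.trans_lt ?_
    have h1 : Real.exp (1/2) ^ 2 = Real.exp 1 := by rw [← Real.exp_nat_mul]; norm_num
    have h2 := Real.exp_one_lt_d9
    nlinarith [Real.exp_pos (1/2 : ℝ)]
  have hU : IsUnit T := by
    have := isUnit_one_sub_of_norm_lt_one hlt
    simpa using this
  obtain ⟨U, rfl⟩ := hU
  set W : HH →L[ℂ] HH := ((U⁻¹ : (HH →L[ℂ] HH)ˣ) : HH →L[ℂ] HH) with hW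
  have hUW : ∀ x, (U : HH →L[ℂ] HH) (W x) = x := fun x => by
    rw [← mul_apply_eq_comp, hW, Units.mul_inv]; rfl
  have hWU : ∀ x, W ((U : HH →L[ℂ] HH) x) = x := fun x => by
    rw [← mul_apply_eq_comp, hW, Units.inv_mul]; rfl
  constructor
  · intro f hf
    have h0 : ContinuousLinearMap.adjoint (U : HH →L[ℂ] HH) f = 0 := by
      refine e_complete _ fun n => ?_
      rw [ContinuousLinearMap.adjoint_inner_right, hT', hf]
    rw [← inner_self_eq_zero (𝕜 := ℂ)]
    nth_rewrite 1 [← hUW f]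
    rw [← ContinuousLinearMap.adjoint_inner_right, h0, inner_zero_right]
  · intro k
    refine ⟨ContinuousLinearMap.adjoint W (cv (lam0 k)), fun n => ?_⟩
    rw [ContinuousLinearMap.adjoint_inner_right, ← hT', hWU]
    exact orthonormal_iff_ite.1 orthonormal_e n k

lemma compl_biorth (lam : ℤ → ℝ) (hinj : Function.Injective lam)
    (ht : Tendsto (fun n => lam n - lam0 n) cofinite (nhds 0)) : ComplSys lam ∧ Biorth lam := by
  classical
  have hfin : {n : ℤ | ¬ |lam n - lam0 n| < 1/2}.Finite := by
    have := ht.eventually (Metric.ball_mem_nhds (0:ℝ) (by norm_num : (0:ℝ) < 1/2))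
    rw [eventually_cofinite] at this
    refine this.subset ?_
    intro n hn
    simpa [Real.norm_eq_abs] using hn
  set S := hfin.toFinset with hS
  have hSmem : ∀ n, n ∉ S → |lam n - lam0 n| < 1/2 := by
    intro n hn
    by_contra h
    exact hn (by rw [hS, Set.Finite.mem_toFinset]; exact h)
  obtain ⟨η, ⟨hη1, hη2⟩, hη3⟩ : ∃ η ∈ Ioo (0:ℝ) (1/2),
      η ∉ ((S ×ˢ S).image (fun q : ℤ × ℤ => lam q.1 - lam0 q.2) : Finset ℝ) := by
    have h1 : (Ioo (0:ℝ) (1/2)).Infinite := Ioo_infinite (by norm_num)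
    obtain ⟨η, h2, h3⟩ := h1.exists_notMem_finset
      ((S ×ˢ S).image (fun q : ℤ × ℤ => lam q.1 - lam0 q.2))
    exact ⟨η, h2, h3⟩
  set b : ℤ → ℝ := fun n => lam0 n + η with hb
  have hgap : ∀ m n : ℤ, m ≠ n → 3 < |lam0 m - lam0 n| := by
    intro m n hmn
    have h1 : lam0 m - lam0 n = Real.pi * ((m - n : ℤ) : ℝ) := by unfold lam0; push_cast; ring
    have h2 : (1:ℝ) ≤ |((m - n : ℤ) : ℝ)| := by
      have : (1:ℤ) ≤ |m - n| := Int.one_le_abs (sub_ne_zero.2 hmn)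
      exact_mod_cast this
    rw [h1, abs_mul, abs_of_pos Real.pi_pos]
    nlinarith [Real.pi_gt_three]
  have hb0 : ∀ m n, lam0 m ≠ b n := by
    intro m n h
    by_cases hmn : m = n
    · subst hmn; simp only [hb] at h; linarith
    · have := hgap m n hmn
      rw [h, hb] at this
      simp only [add_sub_cancel_left] at this
      rw [abs_of_pos hη1] at this
      linarith
  have hbinj : ∀ m n, m ≠ n → b m ≠ b n := by
    intro m n hmn h
    have := hgap m n hmn
    simp only [hb] at h
    rw [add_right_cancel h] at this
    simp at this
    linarith
  have hblam : ∀ m, ∀ n ∈ S, lam m ≠ b n := by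
    intro m n hn h
    by_cases hm : m ∈ S
    · apply hη3
      rw [Finset.mem_image]
      exact ⟨(m, n), Finset.mk_mem_product hm hn, by simp only [h, hb]; ring⟩
    · have h1 := hSmem m hm
      have hmn : m ≠ n := fun h' => hm (h' ▸ hn)
      have h2 := hgap m n hmn
      rw [h, hb] at h1
      simp only at h1
      rw [abs_lt] at h1
      have h3 : |lam0 m - lam0 n| ≤ 1 := by
        rw [abs_le]; constructor <;> linarith
      linarith
  set sq : Finset ℤ → ℤ → ℝ := fun s n => if n ∈ s then b n else lam n with hsq
  have key : ∀ s : Finset ℤ, s ⊆ S → (ComplSys (sq s) ∧ Biorth (sq s)) → (ComplSys (sq ∅) ∧ Biorth (sq ∅)) := by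
    intro s
    induction s using Finset.induction_on with
    | empty => exact fun _ h => h
    | insert n s hn ih =>
      intro hsub ⟨hC, hB⟩
      have hnS : n ∈ S := hsub (Finset.mem_insert_self _ _)
      have hsn : sq s n = lam n := by simp [hsq, hn]
      have hsn' : sq (insert n s) n = b n := by simp [hsq]
      have hsm : ∀ m, m ≠ n → sq (insert n s) m = sq s m := by
        intro m hm; simp [hsq, hm]
      have hne1 : ∀ m, m ≠ n → sq s m ≠ lam n := by
        intro m hm
        by_cases hms : m ∈ s
        · simp only [hsq, hms, if_true]
          exact (hblam n m (hsub (Finset.mem_insert_of_mem hms))).symm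
        · simp only [hsq, hms, if_false]
          exact fun h => hm (hinj h)
      have hne2 : ∀ m, sq s m ≠ b n := by
        intro m
        by_cases hms : m ∈ s
        · simp only [hsq, hms, if_true]
          exact hbinj m n (fun h => hn (h ▸ hms))
        · simp only [hsq, hms, if_false]
          exact hblam m n hnS
      have hab : lam n ≠ b n := hblam n n hnS
      have hC' : ComplSys (sq s) := by
        intro f hf
        have hfa : inner ℂ (cv (lam n)) f = 0 := by rw [← hsn]; exact hf n
        obtain ⟨f', hf'⟩ := replace_step (lam n) (b n) f hfa
        have hf0 : f' = 0 := by
          refine hC f' fun m => ?_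
          by_cases hm : m = n
          · subst hm
            rw [hsn', hf' _ hab.symm]
            simp
          · rw [hsm m hm, hf' _ (hne1 m hm), hf m, mul_zero]
        refine e_complete f fun m => ?_
        by_cases hm : lam0 m = lam n
        · rw [hm]; exact hfa
        · have h1 := hf' _ hm
          rw [hf0, inner_zero_right] at h1
          have h2 : (((lam0 m - b n) / (lam0 m - lam n) : ℝ) : ℂ) ≠ 0 := by
            exact_mod_cast div_ne_zero (sub_ne_zero.2 (hb0 m n)) (sub_ne_zero.2 hm)
          exact (mul_eq_zero.1 h1.symm).resolve_left h2
      refine ih ((Finset.subset_insert _ _).trans hsub) ⟨hC', ?_⟩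
      intro k
      by_cases hk : k = n
      · subst hk
        obtain ⟨w, hw⟩ := hB k
        have hw0 : ∀ m, m ≠ k → inner ℂ (cv (sq s m)) w = 0 := by
          intro m hm
          rw [← hsm m hm, hw m, if_neg hm]
        have hc : inner ℂ (cv (sq s k)) w ≠ 0 := by
          intro h0
          have : w = 0 := hC' w fun m => by
            by_cases hm : m = k
            · rw [hm]; exact h0
            · exact hw0 m hm
          have h1 := hw k
          rw [this] at h1
          simp at h1
        refine ⟨(inner ℂ (cv (sq s k)) w)⁻¹ • w, fun m => ?_⟩
        rw [inner_smul_right]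
        by_cases hm : m = k
        · rw [hm, if_pos rfl, inv_mul_cancel₀ hc]
        · rw [if_neg hm, hw0 m hm, mul_zero]
      · obtain ⟨w, hw⟩ := hB k
        have hwb : inner ℂ (cv (b n)) w = 0 := by
          rw [← hsn', hw n, if_neg (Ne.symm hk)]
        obtain ⟨f', hf'⟩ := replace_step (b n) (lam n) w hwb
        set c : ℂ := (((sq s k - lam n) / (sq s k - b n) : ℝ) : ℂ) with hc
        have hc0 : c ≠ 0 := by
          rw [hc]
          exact_mod_cast div_ne_zero (sub_ne_zero.2 (hne1 k hk)) (sub_ne_zero.2 (hne2 k))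
        refine ⟨c⁻¹ • f', fun m => ?_⟩
        rw [inner_smul_right, hf' _ (hne2 m)]
        by_cases hm : m = k
        · subst hm
          rw [if_pos rfl, ← hc, ← hsm m hk, hw m, if_pos rfl, mul_one, inv_mul_cancel₀ hc0]
        · rw [if_neg hm]
          by_cases hmn : m = n
          · subst hmn
            rw [hsn]; simp
          · rw [← hsm m hmn, hw m, if_neg hm]; simp
  have hfinal := key S (Finset.Subset.refl _) (small_pert (sq S) (by
    intro n
    by_cases hn : n ∈ S
    · simp only [hsq, hn, if_true, hb, add_sub_cancel_left]
      rw [abs_of_pos hη1]; exact hη2.le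
    · simp only [hsq, hn, if_false]
      exact (hSmem n hn).le))
  have e : sq ∅ = lam := by ext n; simp [hsq]
  rwa [e] at hfinal


/-- The operator on `ℂ²` of a matrix. -/
def opM (M : M2) : E2 →L[ℂ] E2 := Matrix.toEuclideanCLM (n := Fin 2) (𝕜 := ℂ) M

lemma norm_opM (M : M2) : ‖opM M‖ = ‖M‖ := rfl

lemma opM_add (M N : M2) : opM (M + N) = opM M + opM N := map_add _ _ _

lemma opM_sub (M N : M2) : opM (M - N) = opM M - opM N := map_sub _ _ _

lemma opM_smul (c : ℂ) (N : M2) : opM (c • N) = c • opM N := map_smul _ _ _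

lemma opM_mul (M N : M2) : opM (M * N) = opM M * opM N := map_mul _ _ _

lemma opM_mul_apply (M N : M2) (v : E2) : opM (M * N) v = opM M (opM N v) := by
  rw [opM_mul]; rfl

lemma opM_sum {ι : Type*} (s : Finset ι) (f : ι → M2) : opM (∑ i ∈ s, f i) = ∑ i ∈ s, opM (f i) :=
  map_sum _ _ _

lemma opM_zero : opM 0 = 0 := map_zero _

lemma opM_toLp (M : M2) (v : Fin 2 → ℂ) : opM M (WithLp.toLp 2 v) = WithLp.toLp 2 (M.mulVec v) :=
  Matrix.toEuclideanCLM_toLp M v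

lemma opM_le (M : M2) (v : E2) : ‖opM M v‖ ≤ ‖M‖ * ‖v‖ := (opM M).le_opNorm v

lemma opM_apply0 (M : M2) (v : E2) : opM M v 0 = M 0 0 * v 0 + M 0 1 * v 1 := by
  have h := opM_toLp M v.ofLp
  rw [show opM M v = _ from h]
  simp [Matrix.mulVec, dotProduct, Fin.sum_univ_two]

lemma opM_apply1 (M : M2) (v : E2) : opM M v 1 = M 1 0 * v 0 + M 1 1 * v 1 := by
  have h := opM_toLp M v.ofLp
  rw [show opM M v = _ from h]
  simp [Matrix.mulVec, dotProduct, Fin.sum_univ_two]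

/-- `opM` as a continuous bilinear map. -/
def opML : M2 →L[ℂ] (E2 →L[ℂ] E2) :=
  LinearMap.mkContinuous ⟨⟨opM, opM_add⟩, opM_smul⟩ 1 (fun M => by
    rw [one_mul]; exact le_of_eq (norm_opM M))

lemma opML_apply (M : M2) : opML M = opM M := rfl

lemma continuous_opM : Continuous opM := opML.continuous

lemma opM_F_exp (l : ℝ) (x t : ℝ) (v : E2) :
    opM (Fker (fun s => expB (2 * (l:ℂ) * (s:ℂ))) x t) v = inner ℂ (c0E l t) v • c0E l x := by
  have e1 : (2 * (l:ℂ) * (((x - t)/2 : ℝ):ℂ)) = l * x - l * t := by push_cast; ring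
  have e2 : (2 * (l:ℂ) * (((x + t)/2 : ℝ):ℂ)) = l * x + l * t := by push_cast; ring
  have hF : Fker (fun s => expB (2 * (l:ℂ) * (s:ℂ))) x t =
      (2:ℂ)⁻¹ • (expB (l * x - l * t) + expB (l * x + l * t) * Jmat) := by
    show (2:ℂ)⁻¹ • (expB (2 * (l:ℂ) * (((x - t)/2 : ℝ):ℂ)) +
      expB (2 * (l:ℂ) * (((x + t)/2 : ℝ):ℂ)) * Jmat) = _
    rw [e1, e2]
  rw [hF, inner_c0E_left]
  refine E2_ext ?_ ?_
  · rw [opM_apply0]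
    simp [expB, Jmat, c0E_zero, Complex.cos_sub, Complex.cos_add,
      Complex.sin_sub, Complex.sin_add]
    ring
  · rw [opM_apply1]
    simp [expB, Jmat, c0E_one, Complex.cos_sub, Complex.cos_add,
      Complex.sin_sub, Complex.sin_add]
    ring

/-- Finite trigonometric sums. -/
def hfun {ι : Type} [Fintype ι] (c l : ι → ℝ) (s : ℝ) : M2 :=
  ∑ i, (c i : ℂ) • expB (2 * (l i : ℂ) * (s : ℂ))

lemma opM_F_hfun {ι : Type} [Fintype ι] (c l : ι → ℝ) (x t : ℝ) (v : E2) :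
    opM (Fker (hfun c l) x t) v = ∑ i, (c i : ℂ) • (inner ℂ (c0E (l i) t) v • c0E (l i) x) := by
  have : Fker (hfun c l) x t =
      ∑ i, (c i : ℂ) • Fker (fun s => expB (2 * (l i:ℂ) * (s:ℂ))) x t := by
    unfold Fker hfun
    rw [Finset.sum_mul, ← Finset.sum_add_distrib, Finset.smul_sum]
    refine Finset.sum_congr rfl (fun i _ => ?_)
    rw [Matrix.smul_mul, ← smul_add, smul_comm]
  rw [this, opM_sum, _root_.sum_apply]
  refine Finset.sum_congr rfl (fun i _ => ?_)
  rw [opM_smul, _root_.smul_apply, opM_F_exp]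

lemma continuous_expB : Continuous expB := by
  refine continuous_matrix (fun i j => ?_)
  fin_cases i <;> fin_cases j <;> simp [expB] <;> fun_prop

lemma continuous_hfun {ι : Type} [Fintype ι] (c l : ι → ℝ) : Continuous (hfun c l) := by
  unfold hfun
  refine continuous_finsetSum _ (fun i _ => ?_)
  have h1 : Continuous (fun s : ℝ => 2 * (l i : ℂ) * (s : ℂ)) := by fun_prop
  exact (continuous_expB.comp h1).const_smul (c i : ℂ)

lemma norm_Jmat_le : ‖Jmat‖ ≤ 1 := by
  have : Jmat = Matrix.diagonal ![1, -1] := by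
    ext i j; fin_cases i <;> fin_cases j <;> simp [Jmat]
  rw [this, Matrix.l2_opNorm_diagonal, pi_norm_le_iff_of_nonneg zero_le_one]
  intro i; fin_cases i <;> simp

lemma norm_Fker_le (h : ℝ → M2) (x t : ℝ) :
    ‖Fker h x t‖ ≤ 2⁻¹ * (‖h ((x - t)/2)‖ + ‖h ((x + t)/2)‖) := by
  unfold Fker
  rw [norm_smul]
  have e : ‖(2:ℂ)⁻¹‖ = 2⁻¹ := by simp
  rw [e]
  refine mul_le_mul_of_nonneg_left ?_ (by norm_num)
  refine (norm_add_le _ _).trans (add_le_add le_rfl ?_)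
  refine (norm_mul_le _ _).trans ?_
  exact mul_le_of_le_one_right (norm_nonneg _) norm_Jmat_le

lemma Fker_row {h : ℝ → M2} (hi : Integrable h) (x : ℝ) :
    Integrable (fun t => Fker h x t) ∧ ∫ t, ‖Fker h x t‖ ≤ 2 * ∫ s, ‖h s‖ := by
  have h1 : Integrable (fun t => h ((x - t)/2)) :=
    (hi.comp_div (two_ne_zero)).comp_sub_left x
  have h2 : Integrable (fun t => h ((x + t)/2)) :=
    (hi.comp_div (two_ne_zero)).comp_add_left x
  have h3 : Integrable (fun t => Fker h x t) := by
    unfold Fker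
    exact (h1.add (h2.mul_const Jmat)).smul (2:ℂ)⁻¹
  refine ⟨h3, ?_⟩
  have e1 : ∫ t, ‖h ((x - t)/2)‖ = 2 * ∫ s, ‖h s‖ := by
    rw [integral_sub_left_eq_self (fun u => ‖h (u/2)‖) volume x,
      Measure.integral_comp_div (fun u => ‖h u‖)]
    simp
  have e2 : ∫ t, ‖h ((x + t)/2)‖ = 2 * ∫ s, ‖h s‖ := by
    rw [integral_add_left_eq_self (fun u => ‖h (u/2)‖) x,
      Measure.integral_comp_div (fun u => ‖h u‖)]
    simp
  calc ∫ t, ‖Fker h x t‖ ≤ ∫ t, 2⁻¹ * (‖h ((x - t)/2)‖ + ‖h ((x + t)/2)‖) :=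
        integral_mono h3.norm ((h1.norm.add h2.norm).const_mul _) (fun t => norm_Fker_le h x t)
    _ = 2 * ∫ s, ‖h s‖ := by
        rw [integral_const_mul, integral_add h1.norm h2.norm, e1, e2]; ring

lemma Fker_col {h : ℝ → M2} (hi : Integrable h) (t : ℝ) :
    Integrable (fun x => Fker h x t) ∧ ∫ x, ‖Fker h x t‖ ≤ 2 * ∫ s, ‖h s‖ := by
  have h1 : Integrable (fun x => h ((x - t)/2)) :=
    (hi.comp_div (two_ne_zero)).comp_sub_right t
  have h2 : Integrable (fun x => h ((x + t)/2)) :=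
    (hi.comp_div (two_ne_zero)).comp_add_right t
  have h3 : Integrable (fun x => Fker h x t) := by
    unfold Fker
    exact (h1.add (h2.mul_const Jmat)).smul (2:ℂ)⁻¹
  refine ⟨h3, ?_⟩
  have e1 : ∫ x, ‖h ((x - t)/2)‖ = 2 * ∫ s, ‖h s‖ := by
    rw [integral_sub_right_eq_self (fun u => ‖h (u/2)‖) t,
      Measure.integral_comp_div (fun u => ‖h u‖)]
    simp
  have e2 : ∫ x, ‖h ((x + t)/2)‖ = 2 * ∫ s, ‖h s‖ := by
    rw [integral_add_right_eq_self (fun u => ‖h (u/2)‖) t,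
      Measure.integral_comp_div (fun u => ‖h u‖)]
    simp
  calc ∫ x, ‖Fker h x t‖ ≤ ∫ x, 2⁻¹ * (‖h ((x - t)/2)‖ + ‖h ((x + t)/2)‖) :=
        integral_mono h3.norm ((h1.norm.add h2.norm).const_mul _) (fun x => norm_Fker_le h x t)
    _ = 2 * ∫ s, ‖h s‖ := by
        rw [integral_const_mul, integral_add h1.norm h2.norm, e1, e2]; ring

/-- Rows on `(0,1)`. -/
lemma Fker_row01 {h : ℝ → M2} (hi : Integrable h) (x : ℝ) :
    Integrable (fun t => Fker h x t) μ01 ∧ ∫ t, ‖Fker h x t‖ ∂μ01 ≤ 2 * ∫ s, ‖h s‖ := by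
  obtain ⟨h1, h2⟩ := Fker_row hi x
  refine ⟨h1.restrict, le_trans ?_ h2⟩
  exact setIntegral_le_integral h1.norm (Eventually.of_forall fun _ => norm_nonneg _)

lemma Fker_col01 {h : ℝ → M2} (hi : Integrable h) (t : ℝ) :
    Integrable (fun x => Fker h x t) μ01 ∧ ∫ x, ‖Fker h x t‖ ∂μ01 ≤ 2 * ∫ s, ‖h s‖ := by
  obtain ⟨h1, h2⟩ := Fker_col hi t
  refine ⟨h1.restrict, le_trans ?_ h2⟩
  exact setIntegral_le_integral h1.norm (Eventually.of_forall fun _ => norm_nonneg _)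

lemma stronglyMeasurable_Fker {h : ℝ → M2} (hm : StronglyMeasurable h) :
    StronglyMeasurable (fun z : ℝ × ℝ => Fker h z.1 z.2) := by
  unfold Fker
  have h1 : StronglyMeasurable (fun z : ℝ × ℝ => h ((z.1 - z.2)/2)) :=
    hm.comp_measurable (by fun_prop)
  have h2 : StronglyMeasurable (fun z : ℝ × ℝ => h ((z.1 + z.2)/2)) :=
    hm.comp_measurable (by fun_prop)
  exact (h1.add (h2.mul stronglyMeasurable_const)).const_smul (2:ℂ)⁻¹

lemma schur_half {k : ℝ × ℝ → ℝ} (hk : StronglyMeasurable k) (hk0 : ∀ z, 0 ≤ k z) {R : ℝ}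
    (hrow : ∀ x, Integrable (fun t => k (x, t)) μ01 ∧ ∫ t, k (x, t) ∂μ01 ≤ R)
    {q : ℝ → ℝ} (hq : Integrable q μ01) (hq0 : ∀ x, 0 ≤ q x) :
    Integrable (fun z : ℝ × ℝ => k z * q z.1) (μ01.prod μ01) ∧
      ∫ z, k z * q z.1 ∂(μ01.prod μ01) ≤ R * ∫ x, q x ∂μ01 := by
  have hm : AEStronglyMeasurable (fun z : ℝ × ℝ => k z * q z.1) (μ01.prod μ01) :=
    hk.aestronglyMeasurable.mul hq.aestronglyMeasurable.comp_fst
  have hle : ∀ x, ∫ t, k (x, t) * q x ∂μ01 ≤ R * q x := by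
    intro x
    rw [integral_mul_const]
    exact mul_le_mul_of_nonneg_right (hrow x).2 (hq0 x)
  have hi : Integrable (fun z : ℝ × ℝ => k z * q z.1) (μ01.prod μ01) := by
    rw [integrable_prod_iff hm]
    refine ⟨Eventually.of_forall fun x => (hrow x).1.mul_const (q x), ?_⟩
    refine (hq.const_mul R).mono' hm.norm.integral_prod_right' (Eventually.of_forall fun x => ?_)
    have e : ∫ t, ‖k (x, t) * q x‖ ∂μ01 = ∫ t, k (x, t) * q x ∂μ01 := by
      refine integral_congr_ae (Eventually.of_forall fun t => ?_)
      exact Real.norm_of_nonneg (mul_nonneg (hk0 _) (hq0 _))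
    have e0 : 0 ≤ ∫ t, k (x, t) * q x ∂μ01 :=
      integral_nonneg fun t => mul_nonneg (hk0 _) (hq0 _)
    show ‖∫ t, ‖k (x, t) * q x‖ ∂μ01‖ ≤ R * q x
    rw [e, Real.norm_of_nonneg e0]
    exact hle x
  refine ⟨hi, ?_⟩
  rw [integral_prod _ hi, ← integral_const_mul]
  exact integral_mono hi.integral_prod_left (hq.const_mul R) hle

lemma schur_half' {k : ℝ × ℝ → ℝ} (hk : StronglyMeasurable k) (hk0 : ∀ z, 0 ≤ k z) {R : ℝ}
    (hcol : ∀ t, Integrable (fun x => k (x, t)) μ01 ∧ ∫ x, k (x, t) ∂μ01 ≤ R)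
    {q : ℝ → ℝ} (hq : Integrable q μ01) (hq0 : ∀ x, 0 ≤ q x) :
    Integrable (fun z : ℝ × ℝ => k z * q z.2) (μ01.prod μ01) ∧
      ∫ z, k z * q z.2 ∂(μ01.prod μ01) ≤ R * ∫ x, q x ∂μ01 := by
  obtain ⟨h1, h2⟩ := schur_half (k := fun z => k z.swap) (hk.comp_measurable measurable_swap)
    (fun z => hk0 _) hcol hq hq0
  refine ⟨h1.swap, ?_⟩
  rw [← integral_prod_swap]
  exact h2

lemma integrable_inner_memLp {f g : ℝ → E2} (hf : MemLp f 2 μ01) (hg : MemLp g 2 μ01) :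
    Integrable (fun x => inner ℂ (f x) (g x)) μ01 := by
  refine (L2.integrable_inner (𝕜 := ℂ) (emb f) (emb g)).congr ?_
  filter_upwards [emb_coe hf, emb_coe hg] with x h1 h2
  rw [h1, h2]

lemma sq_HH (f : HH) : Integrable (fun x => ‖f x‖ ^ 2) μ01 ∧ ∫ x, ‖f x‖ ^ 2 ∂μ01 = ‖f‖ ^ 2 := by
  refine ⟨(Lp.memLp f).integrable_norm_pow (by norm_num), ?_⟩
  have h := L2.inner_def (𝕜 := ℂ) f f
  rw [inner_self_eq_norm_sq_to_K] at h
  have h2 : ∫ a, inner ℂ (f a) (f a) ∂μ01 = ((∫ x, ‖f x‖ ^ 2 ∂μ01 : ℝ) : ℂ) := by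
    refine Eq.trans ?_ integral_ofReal
    refine integral_congr_ae (Eventually.of_forall fun x => ?_)
    show inner ℂ (f x) (f x) = _
    rw [inner_self_eq_norm_sq_to_K]
    simp
  rw [h2] at h
  have h3 : ((‖f‖ ^ 2 : ℝ) : ℂ) = ((∫ x, ‖f x‖ ^ 2 ∂μ01 : ℝ) : ℂ) := by
    rw [← h]; simp
  exact (Complex.ofReal_injective h3).symm

/-- The finite rank operator with kernel `Fker (hfun c l)`. -/
def fr {ι : Type} [Fintype ι] (c l : ι → ℝ) : HH →L[ℂ] HH :=
  ∑ i, (c i : ℂ) • InnerProductSpace.rankOne ℂ (cv (l i)) (cv (l i))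

lemma fr_apply {ι : Type} [Fintype ι] (c l : ι → ℝ) (f : HH) :
    fr c l f = ∑ i, (c i : ℂ) • (inner ℂ (cv (l i)) f • cv (l i)) := by
  unfold fr
  rw [_root_.sum_apply]
  refine Finset.sum_congr rfl (fun i _ => ?_)
  rw [_root_.smul_apply, InnerProductSpace.rankOne_apply]

lemma inner_fr {ι : Type} [Fintype ι] (c l : ι → ℝ) (f g : HH) :
    inner ℂ g (fr c l f) = ∑ i, (c i : ℂ) * (inner ℂ (cv (l i)) f * inner ℂ g (cv (l i))) := by
  rw [fr_apply, inner_sum]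
  refine Finset.sum_congr rfl (fun i _ => ?_)
  rw [inner_smul_right, inner_smul_right]

lemma fr_symm {ι : Type} [Fintype ι] (c l : ι → ℝ) (f g : HH) :
    inner ℂ g (fr c l f) = inner ℂ (fr c l g) f := by
  rw [← inner_conj_symm (fr c l g) f, inner_fr, inner_fr, map_sum]
  refine Finset.sum_congr rfl (fun i _ => ?_)
  simp only [map_mul, inner_conj_symm, Complex.conj_ofReal]
  ring

lemma norm_le_of_form (T : HH →L[ℂ] HH) (r : ℝ) (hr : 0 ≤ r)
    (h : ∀ f g : HH, ‖inner ℂ g (T f)‖ ≤ r / 2 * (‖f‖ ^ 2 + ‖g‖ ^ 2)) : ‖T‖ ≤ r := by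
  refine T.opNorm_le_bound hr (fun f => ?_)
  by_cases hT : T f = 0
  · rw [hT, norm_zero]; positivity
  have hT' : 0 < ‖T f‖ := norm_pos_iff.2 hT
  have hf : 0 < ‖f‖ := by
    rw [norm_pos_iff]; rintro rfl; exact hT (map_zero _)
  have h1 := h f (((‖f‖ / ‖T f‖ : ℝ) : ℂ) • T f)
  have e1 : ‖inner ℂ (((‖f‖ / ‖T f‖ : ℝ) : ℂ) • T f) (T f)‖ = ‖f‖ * ‖T f‖ := by
    rw [inner_smul_left, norm_mul, inner_self_eq_norm_sq_to_K, Complex.conj_ofReal,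
      Complex.norm_real, Real.norm_of_nonneg (by positivity), norm_pow]
    simp
    field_simp
  have e2 : ‖((‖f‖ / ‖T f‖ : ℝ) : ℂ) • T f‖ = ‖f‖ := by
    rw [norm_smul, Complex.norm_real, Real.norm_of_nonneg (by positivity)]
    field_simp
  rw [e1, e2] at h1
  have h2 : ‖f‖ * ‖T f‖ ≤ ‖f‖ * (r * ‖f‖) := by linarith [h1]
  exact le_of_mul_le_mul_left h2 hf

/-- truncation to `(-1,1)`. -/
def tr (h : ℝ → M2) : ℝ → M2 := (Ioo (-1:ℝ) 1).indicator h

lemma Fker_tr (h : ℝ → M2) {x t : ℝ} (hx : x ∈ Icc (0:ℝ) 1) (ht : t ∈ Ioo (0:ℝ) 1) :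
    Fker (tr h) x t = Fker h x t := by
  unfold Fker tr
  rw [indicator_of_mem, indicator_of_mem]
  · exact ⟨by linarith [hx.1, hx.2, ht.1, ht.2], by linarith [hx.1, hx.2, ht.1, ht.2]⟩
  · exact ⟨by linarith [hx.1, hx.2, ht.1, ht.2], by linarith [hx.1, hx.2, ht.1, ht.2]⟩

lemma integrable_tr {h : ℝ → M2} (hi : Integrable h μ11) : Integrable (tr h) :=
  (integrable_indicator_iff measurableSet_Ioo).2 hi

lemma integral_tr (h : ℝ → M2) : ∫ s, ‖tr h s‖ = ∫ s, ‖h s‖ ∂μ11 := by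
  unfold tr μ11
  rw [← integral_indicator measurableSet_Ioo]
  congr 1; ext s
  rw [norm_indicator_eq_indicator_norm]

lemma integrable_hfun {ι : Type} [Fintype ι] (c l : ι → ℝ) : Integrable (hfun c l) μ11 := by
  have := (continuous_hfun c l).integrableOn_Icc (μ := volume) (a := -1) (b := 1)
  exact this.mono_set Ioo_subset_Icc_self

lemma norm_fr_le {ι : Type} [Fintype ι] (c l : ι → ℝ) :
    ‖fr c l‖ ≤ 2 * ∫ s, ‖hfun c l s‖ ∂μ11 := by
  have hi := integrable_tr (integrable_hfun c l)
  rw [← integral_tr]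
  have hm : StronglyMeasurable (tr (hfun c l)) :=
    (continuous_hfun c l).stronglyMeasurable.indicator measurableSet_Ioo
  refine norm_le_of_form _ _ (by positivity) (fun f g => ?_)
  set R := 2 * ∫ s, ‖tr (hfun c l) s‖ with hR
  have hk := (stronglyMeasurable_Fker hm).norm
  obtain ⟨a1, a2⟩ := schur_half hk (fun z => norm_nonneg _) (R := R)
    (fun x => ⟨(Fker_row01 hi x).1.norm, (Fker_row01 hi x).2⟩) (sq_HH g).1 (fun x => by positivity)
  obtain ⟨b1, b2⟩ := schur_half' hk (fun z => norm_nonneg _) (R := R)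
    (fun x => ⟨(Fker_col01 hi x).1.norm, (Fker_col01 hi x).2⟩) (sq_HH f).1 (fun x => by positivity)
  have key : inner ℂ g (fr c l f) =
      ∫ z : ℝ × ℝ, inner ℂ (g z.1) (opM (Fker (hfun c l) z.1 z.2) (f z.2)) ∂(μ01.prod μ01) := by
    rw [inner_fr]
    have e : ∀ z : ℝ × ℝ, inner ℂ (g z.1) (opM (Fker (hfun c l) z.1 z.2) (f z.2)) =
        ∑ i, (c i : ℂ) * (inner ℂ (g z.1) (c0E (l i) z.1) * inner ℂ (c0E (l i) z.2) (f z.2)) := by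
      intro z
      rw [opM_F_hfun, inner_sum]
      refine Finset.sum_congr rfl (fun i _ => ?_)
      rw [inner_smul_right, inner_smul_right]; ring
    simp_rw [e]
    have i1 : ∀ i, Integrable (fun x => inner ℂ (g x) (c0E (l i) x)) μ01 := fun i =>
      integrable_inner_memLp (Lp.memLp g) (memLp_c0E (l i))
    have i2 : ∀ i, Integrable (fun x => inner ℂ (c0E (l i) x) (f x)) μ01 := fun i =>
      integrable_inner_memLp (memLp_c0E (l i)) (Lp.memLp f)
    rw [integral_finsetSum _ (fun i _ => ((i1 i).mul_prod (i2 i)).const_mul _)]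
    refine Finset.sum_congr rfl (fun i _ => ?_)
    rw [integral_const_mul, integral_prod_mul (fun x => inner ℂ (g x) (c0E (l i) x))
      (fun x => inner ℂ (c0E (l i) x) (f x))]
    have e1 : inner ℂ (cv (l i)) f = ∫ x, inner ℂ (c0E (l i) x) (f x) ∂μ01 := by
      conv_lhs => rw [← emb_self f]
      exact inner_emb (memLp_c0E _) (Lp.memLp f)
    have e2 : inner ℂ g (cv (l i)) = ∫ x, inner ℂ (g x) (c0E (l i) x) ∂μ01 := by
      conv_lhs => rw [← emb_self g]
      exact inner_emb (Lp.memLp g) (memLp_c0E _)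
    rw [e1, e2]; ring
  rw [key]
  have hae : ∀ᵐ z ∂(μ01.prod μ01), z ∈ Ioo (0:ℝ) 1 ×ˢ Ioo (0:ℝ) 1 := by
    unfold μ01
    rw [Measure.prod_restrict]
    exact ae_restrict_mem (measurableSet_Ioo.prod measurableSet_Ioo)
  refine (norm_integral_le_of_norm_le ((a1.add b1).const_mul 2⁻¹) ?_).trans ?_
  · filter_upwards [hae] with z hz
    refine (norm_inner_le_norm _ _).trans ?_
    have h1 := opM_le (Fker (hfun c l) z.1 z.2) (f z.2)
    rw [← Fker_tr _ (Ioo_subset_Icc_self hz.1) hz.2] at h1 ⊢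
    simp only [Pi.add_apply]
    have h2 : ‖g z.1‖ * ‖opM (Fker (tr (hfun c l)) z.1 z.2) (f z.2)‖ ≤
      ‖g z.1‖ * (‖Fker (tr (hfun c l)) z.1 z.2‖ * ‖f z.2‖) :=
      mul_le_mul_of_nonneg_left h1 (norm_nonneg _)
    refine h2.trans ?_
    have h3 := mul_nonneg (norm_nonneg (Fker (tr (hfun c l)) z.1 z.2)) (sq_nonneg (‖g z.1‖ - ‖f z.2‖))
    nlinarith [h3]
  · rw [integral_const_mul]
    have h4 := integral_add a1 b1
    simp only [Pi.add_apply] at h4 ⊢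
    rw [h4]
    rw [(sq_HH g).2] at a2
    rw [(sq_HH f).2] at b2
    linarith


/-- Index type of the `m`-th partial sum. -/
abbrev IxS (m : ℕ) : Type := ↥(Finset.Icc (-(m:ℤ)) (m:ℤ)) ⊕ ↥(Finset.Icc (-(m:ℤ)) (m:ℤ))

/-- Coefficients of the `m`-th weighted partial sum. -/
def cS (th : ℤ → ℝ) (al : ℤ → ℝ) (m : ℕ) : IxS m → ℝ :=
  Sum.elim (fun n => th n * al n) (fun n => - th n)

/-- Frequencies of the `m`-th weighted partial sum. -/
def lS (lam : ℤ → ℝ) (m : ℕ) : IxS m → ℝ :=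
  Sum.elim (fun n => lam n) (fun n => lam0 n)

lemma hfun_S (th al lam : ℤ → ℝ) (m : ℕ) (s : ℝ) :
    hfun (cS th al m) (lS lam m) s = ∑ n ∈ Finset.Icc (-(m:ℤ)) (m:ℤ), (th n : ℂ) •
      ((al n : ℂ) • expB (2 * (lam n : ℂ) * (s : ℂ)) -
          expB (Real.pi * (2 * (n : ℂ) + 1) * (s : ℂ))) := by
  unfold hfun
  rw [Fintype.sum_sum_type]
  simp only [cS, lS, Sum.elim_inl, Sum.elim_inr]
  rw [Finset.sum_coe_sort (Finset.Icc (-(m:ℤ)) (m:ℤ)) (fun n => ((th n * al n : ℝ) : ℂ) •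
      expB (2 * (lam n : ℂ) * (s : ℂ))),
    Finset.sum_coe_sort (Finset.Icc (-(m:ℤ)) (m:ℤ)) (fun n => ((- th n : ℝ) : ℂ) •
      expB (2 * (lam0 n : ℂ) * (s : ℂ))), ← Finset.sum_add_distrib]
  refine Finset.sum_congr rfl (fun n _ => ?_)
  have e : 2 * (lam0 n : ℂ) * (s : ℂ) = Real.pi * (2 * (n : ℂ) + 1) * (s : ℂ) := by
    unfold lam0; push_cast; ring
  rw [e, smul_sub, smul_smul]
  push_cast
  rw [neg_smul, sub_eq_add_neg]

lemma inner_fr_S (th al lam : ℤ → ℝ) (m : ℕ) (f g : HH) :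
    inner ℂ g (fr (cS th al m) (lS lam m) f) = ∑ n ∈ Finset.Icc (-(m:ℤ)) (m:ℤ), (th n : ℂ) *
      ((al n : ℂ) * (inner ℂ (cv (lam n)) f * inner ℂ g (cv (lam n))) -
        inner ℂ (cv (lam0 n)) f * inner ℂ g (cv (lam0 n))) := by
  rw [inner_fr, Fintype.sum_sum_type]
  simp only [cS, lS, Sum.elim_inl, Sum.elim_inr]
  rw [Finset.sum_coe_sort (Finset.Icc (-(m:ℤ)) (m:ℤ)) (fun n => ((th n * al n : ℝ) : ℂ) *
      (inner ℂ (cv (lam n)) f * inner ℂ g (cv (lam n)))),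
    Finset.sum_coe_sort (Finset.Icc (-(m:ℤ)) (m:ℤ)) (fun n => ((- th n : ℝ) : ℂ) *
      (inner ℂ (cv (lam0 n)) f * inner ℂ g (cv (lam0 n)))), ← Finset.sum_add_distrib]
  refine Finset.sum_congr rfl (fun n _ => ?_)
  push_cast
  ring

instance instFiniteMu11 : IsFiniteMeasure μ11 := by
  unfold μ11; infer_instance

lemma tendsto_integral_of_eLpNorm {f : ℕ → ℝ → M2} (hf : ∀ n, Integrable (f n) μ11)
    (h : Tendsto (fun n => eLpNorm (f n) 1 μ11) atTop (nhds 0)) :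
    Tendsto (fun n => ∫ s, ‖f n s‖ ∂μ11) atTop (nhds 0) := by
  have e : ∀ n, ∫ s, ‖f n s‖ ∂μ11 = (eLpNorm (f n) 1 μ11).toReal := by
    intro n
    rw [eLpNorm_one_eq_lintegral_enorm, integral_norm_eq_lintegral_enorm (hf n).aestronglyMeasurable]
  simp_rw [e]
  have := (ENNReal.tendsto_toReal (ENNReal.zero_ne_top)).comp h
  simp only [ENNReal.toReal_zero] at this
  exact this

lemma eLpNorm_one_tendsto {p : ℝ≥0∞} (hp : 1 ≤ p) {f : ℕ → ℝ → M2}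
    (hf : ∀ n, AEStronglyMeasurable (f n) μ11)
    (h : Tendsto (fun n => eLpNorm (f n) p μ11) atTop (nhds 0)) :
    Tendsto (fun n => eLpNorm (f n) 1 μ11) atTop (nhds 0) := by
  set C := μ11 univ ^ (1 / (1:ℝ≥0∞).toReal - 1 / p.toReal) with hC
  have hC' : C ≠ ∞ := by
    have h1 : p.toReal = 0 ∨ 1 ≤ p.toReal := by
      by_cases hpt : p = ∞
      · left; simp [hpt]
      · right
        have := ENNReal.toReal_mono hpt hp
        simpa using this
    refine ENNReal.rpow_ne_top_of_nonneg ?_ (measure_ne_top _ _)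
    rcases h1 with h1 | h1
    · rw [h1]; simp
    · simp only [ENNReal.toReal_one, div_one, sub_nonneg]
      exact (div_le_one (by linarith)).2 h1
  have h2 : Tendsto (fun n => eLpNorm (f n) p μ11 * C) atTop (nhds (0 * C)) :=
    ENNReal.Tendsto.mul_const h (Or.inr hC')
  rw [zero_mul] at h2
  exact tendsto_of_tendsto_of_tendsto_of_le_of_le tendsto_const_nhds h2 (fun _ => zero_le)
    (fun n => eLpNorm_le_eLpNorm_mul_rpow_measure_univ hp (hf n))

/-- Cesaro weights. -/
def cesw (N : ℕ) (n : ℤ) : ℝ := (N:ℝ)⁻¹ * ((Finset.Icc 1 N).filter (fun k : ℕ => n.natAbs ≤ k)).card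

lemma cesw_nonneg (N : ℕ) (n : ℤ) : 0 ≤ cesw N n := by unfold cesw; positivity

lemma cesw_le (N : ℕ) (n : ℤ) : cesw N n ≤ 1 := by
  unfold cesw
  have h := Finset.card_filter_le (Finset.Icc 1 N) (fun k : ℕ => n.natAbs ≤ k)
  rw [Nat.card_Icc] at h
  have h1 : ((((Finset.Icc 1 N).filter (fun k : ℕ => n.natAbs ≤ k)).card : ℕ) : ℝ) ≤ N := by
    exact_mod_cast h
  rcases Nat.eq_zero_or_pos N with h0 | h0
  · subst h0; simp
  · rw [inv_mul_le_iff₀ (by exact_mod_cast h0), mul_one]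
    exact h1

lemma cesw_ge (N : ℕ) (n : ℤ) (hN : 0 < N) : 1 - (n.natAbs : ℝ) / N ≤ cesw N n := by
  unfold cesw
  have h : N ≤ ((Finset.Icc 1 N).filter (fun k : ℕ => n.natAbs ≤ k)).card + n.natAbs := by
    have h2 : Finset.Icc (n.natAbs + 1) N ⊆ (Finset.Icc 1 N).filter (fun k : ℕ => n.natAbs ≤ k) := by
      intro k hk
      rw [Finset.mem_Icc] at hk
      rw [Finset.mem_filter, Finset.mem_Icc]
      omega
    have h3 := Finset.card_le_card h2
    rw [Nat.card_Icc] at h3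
    omega
  have h1 : (N : ℝ) ≤ ((((Finset.Icc 1 N).filter (fun k : ℕ => n.natAbs ≤ k)).card : ℕ) : ℝ) +
      n.natAbs := by exact_mod_cast h
  have hN' : (0:ℝ) < N := by exact_mod_cast hN
  rw [inv_mul_eq_div, le_div_iff₀ hN', sub_mul, div_mul_cancel₀ _ hN'.ne']
  linarith

lemma cesw_tendsto (n : ℤ) : Tendsto (fun N => cesw N n) atTop (nhds 1) := by
  have h1 : Tendsto (fun N : ℕ => 1 - (n.natAbs : ℝ) / N) atTop (nhds (1 - 0)) :=
    tendsto_const_nhds.sub (tendsto_const_div_atTop_nhds_zero_nat _)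
  rw [sub_zero] at h1
  refine tendsto_of_tendsto_of_tendsto_of_le_of_le' h1 tendsto_const_nhds ?_ ?_
  · filter_upwards [eventually_gt_atTop 0] with N hN using cesw_ge N n hN
  · exact Eventually.of_forall fun N => cesw_le N n

lemma cesw_sum (a : ℤ → M2) (N : ℕ) :
    (N : ℂ)⁻¹ • ∑ k ∈ Finset.Icc 1 N, ∑ n ∈ Finset.Icc (-(k:ℤ)) (k:ℤ), a n =
      ∑ n ∈ Finset.Icc (-(N:ℤ)) (N:ℤ), (cesw N n : ℂ) • a n := by
  have h1 : ∀ k ∈ Finset.Icc 1 N, ∑ n ∈ Finset.Icc (-(k:ℤ)) (k:ℤ), a n =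
      ∑ n ∈ Finset.Icc (-(N:ℤ)) (N:ℤ), if n.natAbs ≤ k then a n else 0 := by
    intro k hk
    rw [Finset.mem_Icc] at hk
    rw [← Finset.sum_filter]
    refine Finset.sum_congr ?_ (fun _ _ => rfl)
    ext n
    rw [Finset.mem_filter, Finset.mem_Icc, Finset.mem_Icc]
    omega
  rw [Finset.sum_congr rfl h1, Finset.sum_comm, Finset.smul_sum]
  refine Finset.sum_congr rfl (fun n _ => ?_)
  rw [← Finset.sum_filter, Finset.sum_const]
  unfold cesw
  push_cast
  rw [← smul_smul, Nat.cast_smul_eq_nsmul]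

lemma exists_weights {p : ℝ≥0∞} (hp : 1 ≤ p) {lam al : ℤ → ℝ} {H : ℝ → M2}
    (hH : IsHSum p lam al H) :
    ∃ th : ℕ → ℤ → ℝ, (∀ m n, 0 ≤ th m n) ∧ (∀ m n, th m n ≤ 1) ∧
      (∀ n, Tendsto (fun m => th m n) atTop (nhds 1)) ∧
      Tendsto (fun m => ∫ s, ‖hfun (cS (th m) al m) (lS lam m) s - H s‖ ∂μ11) atTop (nhds 0) := by
  obtain ⟨hL, h1, h2⟩ := hH
  have hHi : Integrable H μ11 := hL.integrable hp
  rcases hp.eq_or_lt with hp1 | hp1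
  · refine ⟨cesw, cesw_nonneg, cesw_le, cesw_tendsto, ?_⟩
    refine tendsto_integral_of_eLpNorm (fun m => (integrable_hfun _ _).sub hHi) ?_
    refine (h2 hp1.symm).congr (fun m => ?_)
    congr 1; ext1 s
    rw [hfun_S, cesw_sum]
  · refine ⟨fun _ _ => 1, fun _ _ => zero_le_one, fun _ _ => le_rfl,
      fun _ => tendsto_const_nhds, ?_⟩
    refine tendsto_integral_of_eLpNorm (fun m => (integrable_hfun _ _).sub hHi) ?_
    refine eLpNorm_one_tendsto hp (fun m => ((integrable_hfun _ _).sub hHi).aestronglyMeasurable) ?_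
    refine (h1 hp1).congr (fun m => ?_)
    congr 1; ext1 s
    rw [hfun_S]
    simp

lemma fr_isCompact {ι : Type} [Fintype ι] (c l : ι → ℝ) : IsCompactOperator (fr c l) := by
  have hid : IsCompactOperator (id : ℂ → ℂ) :=
    ⟨Metric.closedBall 0 1, isCompact_closedBall _ _, by
      simpa using Metric.closedBall_mem_nhds (0:ℂ) one_pos⟩
  have h1 : ∀ y : HH, IsCompactOperator (fun f : HH => inner ℂ y f • y) := by
    intro y
    have h2 := (hid.comp_clm (innerSL ℂ y)).clm_comp (ContinuousLinearMap.toSpanSingleton ℂ y)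
    exact h2
  have h2 : ∀ s : Finset ι, IsCompactOperator
      (fun f : HH => ∑ i ∈ s, (c i : ℂ) • (inner ℂ (cv (l i)) f • cv (l i))) := by
    classical
    intro s
    induction s using Finset.induction_on with
    | empty => 
      simp only [Finset.sum_empty]
      exact (isCompactOperator_zero : IsCompactOperator (0 : HH → HH))
    | insert a s ha ih =>
      simp_rw [Finset.sum_insert ha]
      exact ((h1 (cv (l a))).smul (c a : ℂ)).add ih
  have e : (fr c l : HH → HH) = fun f : HH => ∑ i, (c i : ℂ) • (inner ℂ (cv (l i)) f • cv (l i)) := by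
    ext1 f; exact fr_apply c l f
  rw [e]
  exact h2 _

lemma norm_fr_sub_le {ι κ : Type} [Fintype ι] [Fintype κ] (c l : ι → ℝ) (c' l' : κ → ℝ) :
    ‖fr c l - fr c' l'‖ ≤ 2 * ∫ s, ‖hfun c l s - hfun c' l' s‖ ∂μ11 := by
  have e1 : fr c l - fr c' l' = fr (Sum.elim c (fun i => - c' i)) (Sum.elim l l') := by
    unfold fr
    rw [Fintype.sum_sum_type]
    simp [sub_eq_add_neg]
  have e2 : ∀ s, hfun c l s - hfun c' l' s = hfun (Sum.elim c (fun i => - c' i)) (Sum.elim l l') s := by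
    intro s
    unfold hfun
    rw [Fintype.sum_sum_type]
    simp [sub_eq_add_neg]
  simp_rw [e1, e2]
  exact norm_fr_le _ _


/-- The operator data attached to the kernel `Hf`. -/
structure Sys (lam al : ℤ → ℝ) (Hf : ℝ → M2) (T : HH →L[ℂ] HH) : Prop where
  meas : StronglyMeasurable Hf
  int : Integrable Hf
  symm : ∀ f g : HH, inner ℂ g (T f) = inner ℂ (T g) f
  approx : ∀ ε > (0:ℝ), ∃ (ι : Type) (_ : Fintype ι) (c l : ι → ℝ),
    ‖T - fr c l‖ ≤ ε ∧ ∫ s, ‖Hf s - tr (hfun c l) s‖ ≤ ε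
  coer : ∃ κ > (0:ℝ), ∀ f : HH, κ * ‖f‖ ^ 2 ≤ (inner ℂ f (f + T f)).re
  bio : ∀ k : ℤ, ∃ w : HH, (∀ n, inner ℂ (cv (lam n)) w = if n = k then 1 else 0) ∧
    w + T w = (al k : ℂ) • cv (lam k)

/-- A symmetric operator `1 + T`, `T` compact, positive and injective, is coercive. -/
lemma coercive_of_compact (T : HH →L[ℂ] HH) (hT : IsCompactOperator T)
    (hs : ∀ f g : HH, inner ℂ g (T f) = inner ℂ (T g) f)
    (hpos : ∀ f : HH, 0 ≤ (inner ℂ f (f + T f)).re)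
    (hinj : ∀ f : HH, f + T f = 0 → f = 0) :
    ∃ κ > (0:ℝ), ∀ f : HH, κ * ‖f‖ ^ 2 ≤ (inner ℂ f (f + T f)).re := by
  have hne : ¬ Module.End.HasEigenvalue (T : Module.End ℂ HH) (-1) := by
    intro h
    obtain ⟨v, hv⟩ := h.exists_hasEigenvector
    have h1 := hv.apply_eq_smul
    refine hv.2 (hinj v ?_)
    have h2 : T v = (-1:ℂ) • v := h1
    rw [h2]; simp
  obtain ⟨K, hK⟩ := IsCompactOperator.antilipschitz_of_not_hasEigenvalue hT (by norm_num : (-1:ℂ) ≠ 0) hne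
  have hb : ∀ f : HH, ‖f‖ ≤ K * ‖f + T f‖ := by
    intro f
    have h := hK.le_mul_dist f 0
    rw [map_zero, dist_zero_right, dist_zero_right] at h
    have e : (T - (-1:ℂ) • (1 : HH →L[ℂ] HH)) f = f + T f := by
      simp [add_comm]
    rw [e] at h
    exact h
  set L : ℝ := ‖(1 : HH →L[ℂ] HH) + T‖ + 1 with hL
  have hL0 : 0 < L := by positivity
  have hGle : ∀ f : HH, ‖f + T f‖ ≤ L * ‖f‖ := by
    intro f
    have h1 := ((1 : HH →L[ℂ] HH) + T).le_opNorm f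
    have e : ((1 : HH →L[ℂ] HH) + T) f = f + T f := by simp
    rw [e] at h1
    refine h1.trans (mul_le_mul_of_nonneg_right (by linarith) (norm_nonneg _))
  have key : ∀ f : HH, ‖f + T f‖ ^ 2 ≤ L * (inner ℂ f (f + T f)).re := by
    intro f
    set g := f + T f with hg
    set τ : ℝ := L⁻¹ with hτ
    have h1 := hpos (f - (τ:ℂ) • g)
    have hGg : (inner ℂ g (g + T g)).re ≤ L * ‖g‖ ^ 2 := by
      calc (inner ℂ g (g + T g)).re ≤ ‖inner ℂ g (g + T g)‖ := Complex.re_le_norm _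
        _ ≤ ‖g‖ * ‖g + T g‖ := norm_inner_le_norm _ _
        _ ≤ ‖g‖ * (L * ‖g‖) := mul_le_mul_of_nonneg_left (hGle g) (norm_nonneg _)
        _ = L * ‖g‖ ^ 2 := by ring
    have e1 : (f - (τ:ℂ) • g) + T (f - (τ:ℂ) • g) = g - (τ:ℂ) • (g + T g) := by
      have e0 : T f = g - f := by rw [hg]; abel
      rw [map_sub, map_smul, smul_add (τ:ℂ) g (T g), e0]; abel
    have e3 : inner ℂ f (g + T g) = inner ℂ g g := by
      rw [inner_add_right, hs g f, ← inner_add_left]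
    have e4 : (inner ℂ g g : ℂ) = ((‖g‖ ^ 2 : ℝ) : ℂ) := by
      rw [inner_self_eq_norm_sq_to_K]; simp
    have e2 : (inner ℂ (f - (τ:ℂ) • g) (g - (τ:ℂ) • (g + T g))).re =
        (inner ℂ f g).re - 2 * τ * ‖g‖ ^ 2 + τ ^ 2 * (inner ℂ g (g + T g)).re := by
      rw [inner_sub_left, inner_sub_right, inner_sub_right, inner_smul_left, inner_smul_right,
        inner_smul_left, inner_smul_right, e3, e4, Complex.conj_ofReal]
      simp only [Complex.sub_re, Complex.re_ofReal_mul, Complex.ofReal_re]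
      ring
    rw [e1, e2] at h1
    have h3 : τ ^ 2 * (inner ℂ g (g + T g)).re ≤ τ * ‖g‖ ^ 2 := by
      calc τ ^ 2 * (inner ℂ g (g + T g)).re ≤ τ ^ 2 * (L * ‖g‖ ^ 2) :=
            mul_le_mul_of_nonneg_left hGg (by positivity)
        _ = τ * ‖g‖ ^ 2 := by rw [hτ]; field_simp
    have h4 : τ * ‖g‖ ^ 2 ≤ (inner ℂ f g).re := by linarith
    rw [hτ, inv_mul_le_iff₀ hL0] at h4
    exact h4
  set K' : ℝ := K + 1 with hK'
  have hK0 : 0 < K' := by positivity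
  refine ⟨(K' ^ 2 * L)⁻¹, by positivity, fun f => ?_⟩
  rw [inv_mul_le_iff₀ (by positivity)]
  have h1 : ‖f‖ ≤ K' * ‖f + T f‖ :=
    (hb f).trans (mul_le_mul_of_nonneg_right (by linarith) (norm_nonneg _))
  calc ‖f‖ ^ 2 ≤ (K' * ‖f + T f‖) ^ 2 := by gcongr
    _ = K' ^ 2 * ‖f + T f‖ ^ 2 := by ring
    _ ≤ K' ^ 2 * (L * (inner ℂ f (f + T f)).re) :=
        mul_le_mul_of_nonneg_left (key f) (by positivity)
    _ = _ := by ring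

theorem exists_Sys {lam al : ℤ → ℝ} (hc : ComplSys lam) (hbi : Biorth lam)
    (hal : ∀ n, 0 < al n) {H Hf : ℝ → M2} (hHi : Integrable H μ11)
    (hm : StronglyMeasurable Hf) (hsupp : tr Hf = Hf) (hae : Hf =ᵐ[μ11] H)
    (th : ℕ → ℤ → ℝ) (h0 : ∀ m n, 0 ≤ th m n) (h1 : ∀ m n, th m n ≤ 1)
    (ht : ∀ n, Tendsto (fun m => th m n) atTop (nhds 1))
    (hlim : Tendsto (fun m => ∫ s, ‖hfun (cS (th m) al m) (lS lam m) s - H s‖ ∂μ11)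
      atTop (nhds 0)) : ∃ T, Sys lam al Hf T := by
  set A : ℕ → HH →L[ℂ] HH := fun m => fr (cS (th m) al m) (lS lam m) with hA
  set ρ : ℕ → ℝ := fun m => ∫ s, ‖hfun (cS (th m) al m) (lS lam m) s - H s‖ ∂μ11 with hρ
  have hii : ∀ m, Integrable (fun s => hfun (cS (th m) al m) (lS lam m) s - H s) μ11 :=
    fun m => (integrable_hfun _ _).sub hHi
  have hdiff : ∀ m m', ‖A m - A m'‖ ≤ 2 * (ρ m + ρ m') := by
    intro m m'
    refine (norm_fr_sub_le _ _ _ _).trans (mul_le_mul_of_nonneg_left ?_ (by norm_num))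
    rw [hρ]
    simp only
    rw [← integral_add (hii m).norm (hii m').norm]
    refine integral_mono_of_nonneg (Eventually.of_forall fun s => norm_nonneg _)
      ((hii m).norm.add (hii m').norm) (Eventually.of_forall fun s => ?_)
    show ‖hfun (cS (th m) al m) (lS lam m) s - hfun (cS (th m') al m') (lS lam m') s‖ ≤ _
    rw [← sub_sub_sub_cancel_right _ _ (H s)]
    exact norm_sub_le _ _
  have hcau : CauchySeq A := by
    rw [Metric.cauchySeq_iff']
    intro ε hε
    obtain ⟨N, hN⟩ := (Metric.tendsto_atTop.1 hlim) (ε / 4) (by positivity)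
    refine ⟨N, fun m hm => ?_⟩
    rw [dist_eq_norm]
    have a1 := hN m hm
    have a2 := hN N le_rfl
    rw [Real.dist_0_eq_abs] at a1 a2
    have a3 := (abs_lt.1 a1).2
    have a4 := (abs_lt.1 a2).2
    have := hdiff m N
    linarith
  obtain ⟨T, hT⟩ := cauchySeq_tendsto_of_complete hcau
  have hTd : ∀ m, ‖T - A m‖ ≤ 2 * ρ m := by
    intro m
    have b1 : Tendsto (fun m' => ‖A m' - A m‖) atTop (nhds ‖T - A m‖) :=
      (hT.sub tendsto_const_nhds).norm
    have b2 : Tendsto (fun m' => 2 * (ρ m' + ρ m)) atTop (nhds (2 * (0 + ρ m))) :=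
      (hlim.add tendsto_const_nhds).const_mul 2
    rw [zero_add] at b2
    exact le_of_tendsto_of_tendsto b1 b2 (Eventually.of_forall fun m' => hdiff m' m)
  have hinn : ∀ f g : HH, Tendsto (fun m => inner ℂ g (A m f)) atTop (nhds (inner ℂ g (T f))) := by
    intro f g
    have b1 : Tendsto (fun m => A m f) atTop (nhds (T f)) :=
      ((ContinuousLinearMap.apply ℂ HH f).continuous.tendsto T).comp hT
    exact tendsto_const_nhds.inner b1
  have hsym : ∀ f g : HH, inner ℂ g (T f) = inner ℂ (T g) f := by
    intro f g
    have b1 := hinn f g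
    have b2 := (Complex.continuous_conj.tendsto _).comp (hinn g f)
    rw [inner_conj_symm] at b2
    refine tendsto_nhds_unique b1 (b2.congr (fun m => ?_))
    simp only [Function.comp]
    rw [inner_conj_symm]
    exact (fr_symm _ _ _ _).symm
  have hcmp : IsCompactOperator T :=
    isCompactOperator_of_tendsto hT (Eventually.of_forall fun m => fr_isCompact _ _)
  have hge : ∀ (f : HH) (k : ℤ), al k * ‖inner ℂ (cv (lam k)) f‖ ^ 2 ≤ (inner ℂ f (f + T f)).re := by
    intro f k
    have b1 : Tendsto (fun m => th m k * (al k * ‖inner ℂ (cv (lam k)) f‖ ^ 2)) atTop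
        (nhds (1 * (al k * ‖inner ℂ (cv (lam k)) f‖ ^ 2))) := (ht k).mul_const _
    have b2 : Tendsto (fun m => ‖f‖ ^ 2 + (inner ℂ f (A m f)).re) atTop
        (nhds (‖f‖ ^ 2 + (inner ℂ f (T f)).re)) :=
      tendsto_const_nhds.add ((Complex.continuous_re.tendsto _).comp (hinn f f))
    have e1 : (inner ℂ f (f + T f)).re = ‖f‖ ^ 2 + (inner ℂ f (T f)).re := by
      rw [inner_add_right, Complex.add_re, inner_self_eq_norm_sq_to_K]
      norm_cast
    rw [e1]
    rw [one_mul] at b1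
    refine le_of_tendsto_of_tendsto b1 b2 ?_
    filter_upwards [eventually_ge_atTop k.natAbs] with m hmk
    rw [hA]; simp only
    rw [inner_fr_S, Complex.re_sum]
    have e2 : ∀ n, ((th m n : ℂ) * ((al n : ℂ) * (inner ℂ (cv (lam n)) f * inner ℂ f (cv (lam n))) -
        inner ℂ (cv (lam0 n)) f * inner ℂ f (cv (lam0 n)))).re =
        th m n * (al n * ‖inner ℂ (cv (lam n)) f‖ ^ 2) - th m n * ‖inner ℂ (cv (lam0 n)) f‖ ^ 2 := by
      intro n
      have e3 : ∀ y : HH, inner ℂ y f * inner ℂ f y = ((‖inner ℂ y f‖ ^ 2 : ℝ) : ℂ) := by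
        intro y
        rw [← inner_conj_symm f y, Complex.mul_conj, Complex.normSq_eq_norm_sq]
      rw [e3, e3]
      norm_cast
      ring
    rw [Finset.sum_congr rfl (fun n _ => e2 n), Finset.sum_sub_distrib]
    have e4 : ∑ n ∈ Finset.Icc (-(m:ℤ)) (m:ℤ), th m n * ‖inner ℂ (cv (lam0 n)) f‖ ^ 2 ≤ ‖f‖ ^ 2 := by
      refine le_trans (Finset.sum_le_sum (fun n _ => ?_))
        (orthonormal_e.sum_inner_products_le f (s := Finset.Icc (-(m:ℤ)) (m:ℤ)))
      exact mul_le_of_le_one_left (by positivity) (h1 m n)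
    have e5 : th m k * (al k * ‖inner ℂ (cv (lam k)) f‖ ^ 2) ≤
        ∑ n ∈ Finset.Icc (-(m:ℤ)) (m:ℤ), th m n * (al n * ‖inner ℂ (cv (lam n)) f‖ ^ 2) := by
      refine Finset.single_le_sum (f := fun n => th m n * (al n * ‖inner ℂ (cv (lam n)) f‖ ^ 2))
        (fun n _ => mul_nonneg (h0 m n) (mul_nonneg (hal n).le (by positivity))) ?_
      rw [Finset.mem_Icc]; omega
    linarith
  have hinj : ∀ f : HH, f + T f = 0 → f = 0 := by
    intro f hf
    refine hc f (fun n => ?_)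
    have b := hge f n
    rw [hf, inner_zero_right, Complex.zero_re] at b
    have b3 : ‖inner ℂ (cv (lam n)) f‖ ^ 2 ≤ 0 := by
      by_contra hcon
      push Not at hcon
      nlinarith [mul_pos (hal n) hcon]
    have b4 : ‖inner ℂ (cv (lam n)) f‖ = 0 := by
      have := sq_nonneg ‖inner ℂ (cv (lam n)) f‖
      exact pow_eq_zero_iff (two_ne_zero) |>.1 (le_antisymm b3 this)
    exact norm_eq_zero.1 b4
  have hHfi : Integrable Hf := by
    rw [← hsupp]
    exact integrable_tr ((integrable_congr hae).2 hHi)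
  refine ⟨T, hm, hHfi, hsym, ?_, ?_, ?_⟩
  · intro ε hε
    obtain ⟨N, hN⟩ := (Metric.tendsto_atTop.1 hlim) (ε / 2) (by positivity)
    have a1 := hN N le_rfl
    rw [Real.dist_0_eq_abs] at a1
    have a2 : ρ N < ε / 2 := (abs_lt.1 a1).2
    refine ⟨_, inferInstance, cS (th N) al N, lS lam N, ?_, ?_⟩
    · have := hTd N
      exact this.trans (by linarith)
    · have e : ∀ s, ‖Hf s - tr (hfun (cS (th N) al N) (lS lam N)) s‖ =
          ‖tr (fun s => Hf s - hfun (cS (th N) al N) (lS lam N) s) s‖ := by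
        intro s
        conv_lhs => rw [← hsupp]
        unfold tr
        by_cases hs : s ∈ Ioo (-1:ℝ) 1
        · simp only [indicator_of_mem hs]
        · simp only [indicator_of_notMem hs, sub_zero]
      simp_rw [e]
      rw [integral_tr]
      have e2 : ∫ s, ‖Hf s - hfun (cS (th N) al N) (lS lam N) s‖ ∂μ11 = ρ N := by
        refine integral_congr_ae ?_
        filter_upwards [hae] with s hs
        rw [hs, norm_sub_rev]
      rw [e2]; linarith
  · refine coercive_of_compact T hcmp hsym (fun f => le_trans ?_ (hge f 0)) hinj
    exact mul_nonneg (hal 0).le (by positivity)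
  · intro k
    obtain ⟨w, hw⟩ := hbi k
    refine ⟨w, hw, ?_⟩
    rw [← sub_eq_zero]
    refine e_complete _ (fun j => ?_)
    rw [inner_sub_right, inner_smul_right, inner_add_right, sub_eq_zero]
    have b1 := (hinn w (cv (lam0 j))).const_add (inner ℂ (cv (lam0 j)) w)
    have b2 : Tendsto (fun m => inner ℂ (cv (lam0 j)) w + ((th m k : ℂ) * ((al k : ℂ) *
        inner ℂ (cv (lam0 j)) (cv (lam k))) - (th m j : ℂ) * inner ℂ (cv (lam0 j)) w)) atTop
        (nhds (inner ℂ (cv (lam0 j)) w + (((1:ℝ) : ℂ) * ((al k : ℂ) *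
        inner ℂ (cv (lam0 j)) (cv (lam k))) - ((1:ℝ) : ℂ) * inner ℂ (cv (lam0 j)) w))) := by
      refine tendsto_const_nhds.add (Tendsto.sub (Tendsto.mul_const _ ?_) (Tendsto.mul_const _ ?_))
      · exact (Complex.continuous_ofReal.tendsto _).comp (ht k)
      · exact (Complex.continuous_ofReal.tendsto _).comp (ht j)
    have e6 : inner ℂ (cv (lam0 j)) w + (((1:ℝ) : ℂ) * ((al k : ℂ) *
        inner ℂ (cv (lam0 j)) (cv (lam k))) - ((1:ℝ) : ℂ) * inner ℂ (cv (lam0 j)) w) =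
        (al k : ℂ) * inner ℂ (cv (lam0 j)) (cv (lam k)) := by
      push_cast; ring
    rw [e6] at b2
    refine tendsto_nhds_unique b1 (b2.congr' ?_)
    filter_upwards [eventually_ge_atTop k.natAbs, eventually_ge_atTop j.natAbs] with m hmk hmj
    congr 1
    rw [hA]; simp only
    rw [inner_fr_S]
    simp_rw [mul_sub]
    rw [Finset.sum_sub_distrib, Finset.sum_eq_single k, Finset.sum_eq_single j]
    · have o := orthonormal_iff_ite.1 orthonormal_e j j
      simp only [if_true] at o
      rw [hw k, if_pos rfl, o, one_mul, mul_one]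
    · intro n _ hn
      have o := orthonormal_iff_ite.1 orthonormal_e j n
      simp only [if_neg (Ne.symm hn)] at o
      rw [o]; ring
    · intro h
      exact absurd (by rw [Finset.mem_Icc]; omega) h
    · intro n _ hn
      rw [hw n, if_neg hn]; ring
    · intro h
      exact absurd (by rw [Finset.mem_Icc]; omega) h


lemma ae_mem_Ioo : ∀ᵐ t ∂μ01, t ∈ Ioo (0:ℝ) 1 := by
  unfold μ01
  exact ae_restrict_mem measurableSet_Ioo

/-- Pointwise action of the integral operator with kernel `Fker h`. -/
def Fap (h : ℝ → M2) (a : HH) (s : ℝ) : E2 := ∫ t, opM (Fker h s t) (a t) ∂μ01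

/-- Almost everywhere bounded elements. -/
def Bdd (a : HH) (N : ℝ) : Prop := ∀ᵐ t ∂μ01, ‖a t‖ ≤ N

lemma Bdd.sub {a b : HH} {N M : ℝ} (ha : Bdd a N) (hb : Bdd b M) : Bdd (a - b) (N + M) := by
  unfold Bdd at *
  filter_upwards [ha, hb, Lp.coeFn_sub a b] with t h1 h2 h3
  rw [h3, Pi.sub_apply]
  exact (norm_sub_le _ _).trans (add_le_add h1 h2)

lemma Fap_integrable {h : ℝ → M2} (hi : Integrable h) {a : HH} {N : ℝ} (ha : Bdd a N) (s : ℝ) :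
    Integrable (fun t => opM (Fker h s t) (a t)) μ01 := by
  obtain ⟨h1, _⟩ := Fker_row01 hi s
  refine (h1.norm.mul_const N).mono' ?_ ?_
  · exact opML.aestronglyMeasurable_comp₂ h1.aestronglyMeasurable (Lp.aestronglyMeasurable a)
  · filter_upwards [ha] with t ht
    exact (opM_le _ _).trans (mul_le_mul_of_nonneg_left ht (norm_nonneg _))

lemma Bdd.nonneg {a : HH} {N : ℝ} (ha : Bdd a N) : 0 ≤ N := by
  by_contra hN
  push Not at hN
  have h : ∀ᵐ t ∂μ01, False := by
    filter_upwards [ha] with t ht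
    linarith [norm_nonneg (a t)]
  rw [eventually_false_iff_eq_bot, ae_eq_bot] at h
  have := mu01_univ
  rw [h] at this
  simp at this

lemma Fap_le {h : ℝ → M2} (hi : Integrable h) {a : HH} {N : ℝ} (ha : Bdd a N) (s : ℝ) :
    ‖Fap h a s‖ ≤ 2 * (∫ s, ‖h s‖) * N := by
  obtain ⟨h1, h2⟩ := Fker_row01 hi s
  refine (norm_integral_le_of_norm_le (h1.norm.mul_const N) ?_).trans ?_
  · filter_upwards [ha] with t ht
    exact (opM_le _ _).trans (mul_le_mul_of_nonneg_left ht (norm_nonneg _))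
  · rw [integral_mul_const]
    exact mul_le_mul_of_nonneg_right h2 ha.nonneg

lemma Fap_sub {h : ℝ → M2} (hi : Integrable h) {a b : HH} {N M : ℝ} (ha : Bdd a N) (hb : Bdd b M)
    (s : ℝ) : Fap h (a - b) s = Fap h a s - Fap h b s := by
  unfold Fap
  rw [← integral_sub (Fap_integrable hi ha s) (Fap_integrable hi hb s)]
  refine integral_congr_ae ?_
  filter_upwards [Lp.coeFn_sub a b] with t h3
  rw [h3, Pi.sub_apply, map_sub]

lemma Fker_sub (h h' : ℝ → M2) (s t : ℝ) :
    Fker (fun r => h r - h' r) s t = Fker h s t - Fker h' s t := by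
  unfold Fker
  rw [← smul_sub, sub_mul]
  congr 1
  exact sub_add_sub_comm _ _ _ _

lemma Fap_sub_ker {h h' : ℝ → M2} (hi : Integrable h) (hi' : Integrable h') {a : HH} {N : ℝ}
    (ha : Bdd a N) (s : ℝ) : Fap (fun r => h r - h' r) a s = Fap h a s - Fap h' a s := by
  unfold Fap
  rw [← integral_sub (Fap_integrable hi ha s) (Fap_integrable hi' ha s)]
  refine integral_congr_ae (Eventually.of_forall fun t => ?_)
  show opM (Fker (fun r => h r - h' r) s t) (a t) = _
  rw [Fker_sub, opM_sub]; rfl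

lemma inner_cv_left (l : ℝ) (a : HH) : inner ℂ (cv l) a = ∫ x, inner ℂ (c0E l x) (a x) ∂μ01 := by
  conv_lhs => rw [← emb_self a]
  exact inner_emb (memLp_c0E _) (Lp.memLp a)

lemma norm_cv_le (l : ℝ) : ‖cv l‖ ≤ 1 :=
  norm_emb_le (memLp_c0E l) zero_le_one (fun x _ => (norm_c0E l x).le)

lemma Fap_hfun {ι : Type} [Fintype ι] (c l : ι → ℝ) (a : HH) {s : ℝ} (hs : s ∈ Icc (0:ℝ) 1) :
    Fap (tr (hfun c l)) a s = ∑ i, (c i : ℂ) • (inner ℂ (cv (l i)) a • c0E (l i) s) := by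
  unfold Fap
  have e : ∀ᵐ t ∂μ01, opM (Fker (tr (hfun c l)) s t) (a t) =
      ∑ i, (c i : ℂ) • (inner ℂ (c0E (l i) t) (a t) • c0E (l i) s) := by
    filter_upwards [ae_mem_Ioo] with t ht
    rw [Fker_tr _ hs ht, opM_F_hfun]
  have i2 : ∀ i, Integrable (fun x => inner ℂ (c0E (l i) x) (a x)) μ01 := fun i =>
      integrable_inner_memLp (memLp_c0E (l i)) (Lp.memLp a)
  rw [integral_congr_ae e, integral_finsetSum]
  · refine Finset.sum_congr rfl (fun i _ => ?_)
    rw [integral_smul, integral_smul_const, inner_cv_left]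
  · intro i _
    exact ((i2 i).smul_const _).smul (c i : ℂ)

lemma fr_ae {ι : Type} [Fintype ι] (c l : ι → ℝ) (a : HH) :
    fr c l a = emb (fun s => ∑ i, (c i : ℂ) • (inner ℂ (cv (l i)) a • c0E (l i) s)) := by
  have hmi : ∀ i, MemLp (fun s => inner ℂ (cv (l i)) a • c0E (l i) s) 2 μ01 := fun i =>
    (memLp_c0E (l i)).const_smul (inner ℂ (cv (l i)) a)
  rw [fr_apply, emb_sum _ (fun i s => (c i : ℂ) • (inner ℂ (cv (l i)) a • c0E (l i) s))
    (fun i => (hmi i).const_smul (c i : ℂ))]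
  refine Finset.sum_congr rfl (fun i _ => ?_)
  rw [emb_smul _ (hmi i), emb_smul _ (memLp_c0E (l i))]
  rfl

lemma frfun_le {ι : Type} [Fintype ι] (c l : ι → ℝ) (a : HH) (s : ℝ) :
    ‖∑ i, (c i : ℂ) • (inner ℂ (cv (l i)) a • c0E (l i) s)‖ ≤ (∑ i, |c i|) * ‖a‖ := by
  refine (norm_sum_le _ _).trans ?_
  rw [Finset.sum_mul]
  refine Finset.sum_le_sum (fun i _ => ?_)
  rw [norm_smul, norm_smul, norm_c0E, mul_one, Complex.norm_real, Real.norm_eq_abs]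
  refine mul_le_mul_of_nonneg_left ?_ (abs_nonneg _)
  refine (norm_inner_le_norm _ _).trans ?_
  exact mul_le_of_le_one_left (norm_nonneg _) (norm_cv_le _)

lemma frfun_memLp {ι : Type} [Fintype ι] (c l : ι → ℝ) (a : HH) :
    MemLp (fun s => ∑ i, (c i : ℂ) • (inner ℂ (cv (l i)) a • c0E (l i) s)) 2 μ01 := by
  refine memLp_of_continuous (continuous_finsetSum _ (fun i _ => ?_))
  exact ((continuous_c0E (l i)).const_smul (inner ℂ (cv (l i)) a)).const_smul (c i : ℂ)

section SysLemmas
variable {lam al : ℤ → ℝ} {Hf : ℝ → M2} {T : HH →L[ℂ] HH}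

lemma integrable_diff (S : Sys lam al Hf T) {ι : Type} [Fintype ι] (c l : ι → ℝ) :
    Integrable (fun s => Hf s - tr (hfun c l) s) :=
  S.int.sub (integrable_tr (integrable_hfun c l))

lemma Fap_meas (S : Sys lam al Hf T) (a : HH) : AEStronglyMeasurable (Fap Hf a) μ01 := by
  unfold Fap
  have h : AEStronglyMeasurable (fun z : ℝ × ℝ => opM (Fker Hf z.1 z.2) (a z.2)) (μ01.prod μ01) :=
    opML.aestronglyMeasurable_comp₂ (stronglyMeasurable_Fker S.meas).aestronglyMeasurable
      (Lp.aestronglyMeasurable a).comp_snd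
  exact h.integral_prod_right'

lemma Fap_memLp (S : Sys lam al Hf T) {a : HH} {N : ℝ} (ha : Bdd a N) : MemLp (Fap Hf a) 2 μ01 :=
  memLp_of_bdd (Fap_meas S a) _ (fun x _ => Fap_le S.int ha x)

/-- The operator `T` acts on bounded elements through the kernel. -/
lemma T_ae (S : Sys lam al Hf T) {a : HH} {N : ℝ} (ha : Bdd a N) : T a =ᵐ[μ01] Fap Hf a := by
  have hN := ha.nonneg
  have key : T a = emb (Fap Hf a) := by
    rw [← sub_eq_zero, ← norm_le_zero_iff]
    refine le_of_forall_pos_le_add (fun ε hε => ?_)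
    rw [zero_add]
    set D := ‖a‖ + 2 * N + 1 with hD
    have hD0 : 0 < D := by positivity
    obtain ⟨ι, _, c, l, h1, h2⟩ := S.approx (ε / D) (by positivity)
    have e : T a - emb (Fap Hf a) = (T - fr c l) a - emb (fun s => Fap Hf a s -
        ∑ i, (c i : ℂ) • (inner ℂ (cv (l i)) a • c0E (l i) s)) := by
      rw [emb_sub (Fap_memLp S ha) (frfun_memLp c l a), ← fr_ae, _root_.sub_apply]
      abel
    have b1 : ‖(T - fr c l) a‖ ≤ ε / D * ‖a‖ := ((T - fr c l).le_opNorm a).trans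
      (mul_le_mul_of_nonneg_right h1 (norm_nonneg _))
    have b2 : ‖emb (fun s => Fap Hf a s -
        ∑ i, (c i : ℂ) • (inner ℂ (cv (l i)) a • c0E (l i) s))‖ ≤ 2 * (ε / D) * N := by
      refine norm_emb_le ((Fap_memLp S ha).sub (frfun_memLp c l a)) (by positivity) (fun x hx => ?_)
      show ‖Fap Hf a x - ∑ i, (c i:ℂ) • (inner ℂ (cv (l i)) a • c0E (l i) x)‖ ≤ _
      rw [← Fap_hfun c l a (Ioo_subset_Icc_self hx), ← Fap_sub_ker S.int
        (integrable_tr (integrable_hfun c l)) ha]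
      refine (Fap_le (integrable_diff S c l) ha x).trans ?_
      refine mul_le_mul_of_nonneg_right ?_ hN
      linarith
    rw [e]
    refine (norm_sub_le _ _).trans ?_
    have : ε / D * ‖a‖ + 2 * (ε / D) * N ≤ ε / D * D := by
      have : 0 < ε / D := by positivity
      nlinarith
    rw [div_mul_cancel₀ _ hD0.ne'] at this
    linarith
  rw [key]
  exact emb_coe (Fap_memLp S ha)

lemma Fap_split (S : Sys lam al Hf T) (ε : ℝ) (hε : 0 < ε) : ∃ C : ℝ, 0 ≤ C ∧
    ∀ (a : HH) (N : ℝ), Bdd a N → ∀ s ∈ Icc (0:ℝ) 1, ‖Fap Hf a s‖ ≤ C * ‖a‖ + ε * N := by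
  obtain ⟨ι, _, c, l, h1, h2⟩ := S.approx (ε / 2) (by positivity)
  refine ⟨∑ i, |c i|, Finset.sum_nonneg fun i _ => abs_nonneg _, fun a N ha s hs => ?_⟩
  have e := Fap_sub_ker S.int (integrable_tr (integrable_hfun c l)) ha s
  have e2 : Fap Hf a s = Fap (tr (hfun c l)) a s + Fap (fun r => Hf r - tr (hfun c l) r) a s := by
    rw [e]; abel
  rw [e2]
  refine (norm_add_le _ _).trans (add_le_add ?_ ?_)
  · rw [Fap_hfun c l a hs]
    exact frfun_le c l a s
  · refine (Fap_le (integrable_diff S c l) ha s).trans ?_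
    exact mul_le_mul_of_nonneg_right (by linarith) ha.nonneg

end SysLemmas


lemma exists_Pc (x : ℝ) : ∃ P : HH →L[ℂ] HH, ‖P‖ ≤ 1 ∧
    ∀ f : HH, P f =ᵐ[μ01] (Iio x).indicator f := by
  obtain ⟨P, h1, h2⟩ := exists_mulOp ((Iio x).indicator (fun _ => ContinuousLinearMap.id ℂ E2))
    (stronglyMeasurable_const.indicator measurableSet_Iio) 1 zero_le_one (by
      intro y _
      refine (norm_indicator_le_norm_self _ _).trans ?_
      exact ContinuousLinearMap.norm_id_le)
  refine ⟨P, h1, fun f => ?_⟩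
  filter_upwards [h2 f] with t ht
  rw [ht]
  by_cases h : t ∈ Iio x <;> simp [h]

/-- The cut-off projection onto functions supported in `(0,x)`. -/
def Pc (x : ℝ) : HH →L[ℂ] HH := (exists_Pc x).choose

lemma Pc_ae (x : ℝ) (f : HH) : Pc x f =ᵐ[μ01] (Iio x).indicator f := (exists_Pc x).choose_spec.2 f

lemma norm_Pc_le (x : ℝ) (f : HH) : ‖Pc x f‖ ≤ ‖f‖ :=
  ((Pc x).le_opNorm f).trans (mul_le_of_le_one_left (norm_nonneg _) (exists_Pc x).choose_spec.1)

lemma Pc_symm (x : ℝ) (f g : HH) : inner ℂ (Pc x f) g = inner ℂ f (Pc x g) := by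
  rw [L2.inner_def, L2.inner_def]
  refine integral_congr_ae ?_
  filter_upwards [Pc_ae x f, Pc_ae x g] with t h1 h2
  rw [h1, h2]
  by_cases h : t ∈ Iio x <;> simp [h]

lemma Pc_left {x y : ℝ} (h : x ≤ y) (f : HH) : Pc x (Pc y f) = Pc x f := by
  refine Lp.ext ?_
  filter_upwards [Pc_ae x f, Pc_ae y f, Pc_ae x (Pc y f)] with t h1 h2 h3
  rw [h1, h3]
  by_cases hx : t ∈ Iio x
  · have hy : t ∈ Iio y := lt_of_lt_of_le hx h
    rw [indicator_of_mem hx, indicator_of_mem hx, h2, indicator_of_mem hy]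
  · rw [indicator_of_notMem hx, indicator_of_notMem hx]

lemma Pc_right {x y : ℝ} (h : x ≤ y) (f : HH) : Pc y (Pc x f) = Pc x f := by
  refine Lp.ext ?_
  filter_upwards [Pc_ae x f, Pc_ae y (Pc x f)] with t h1 h3
  rw [h3]
  by_cases hx : t ∈ Iio x
  · have hy : t ∈ Iio y := lt_of_lt_of_le hx h
    rw [indicator_of_mem hy]
  · rw [h1, indicator_of_notMem hx]
    by_cases hy : t ∈ Iio y
    · rw [indicator_of_mem hy, h1, indicator_of_notMem hx]
    · rw [indicator_of_notMem hy]

lemma Pc_one (f : HH) : Pc 1 f = f := by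
  refine Lp.ext ?_
  filter_upwards [Pc_ae 1 f, ae_mem_Ioo] with t h1 h2
  rw [h1, indicator_of_mem (show t ∈ Iio (1:ℝ) from h2.2)]

lemma Pc_zero (f : HH) : Pc 0 f = 0 := by
  refine Lp.ext ?_
  filter_upwards [Pc_ae 0 f, ae_mem_Ioo, Lp.coeFn_zero E2 2 μ01] with t h1 h2 h3
  rw [h1, indicator_of_notMem (by simpa using h2.1.le), h3]
  rfl

lemma Bdd.Pc {a : HH} {N : ℝ} (ha : Bdd a N) (x : ℝ) : Bdd (Pc x a) N := by
  unfold Bdd at *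
  filter_upwards [ha, Pc_ae x a] with t h1 h2
  rw [h2]
  exact (norm_indicator_le_norm_self _ _).trans h1

lemma Bdd_emb {u : ℝ → E2} (hu : MemLp u 2 μ01) {N : ℝ} (h : ∀ t ∈ Ioo (0:ℝ) 1, ‖u t‖ ≤ N) :
    Bdd (emb u) N := by
  unfold Bdd
  filter_upwards [emb_coe hu, ae_mem_Ioo] with t h1 h2
  rw [h1]; exact h t h2

lemma Bdd_zero {N : ℝ} (hN : 0 ≤ N) : Bdd 0 N := by
  unfold Bdd
  filter_upwards [Lp.coeFn_zero E2 2 μ01] with t h1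
  rw [h1]; simpa using hN

lemma Bdd_lim {a : ℕ → HH} {w : HH} {N : ℝ} (ha : ∀ n, Bdd (a n) N)
    (h : Tendsto a atTop (nhds w)) : Bdd w N := by
  obtain ⟨ns, _, h2⟩ := (tendstoInMeasure_of_tendsto_Lp h).exists_seq_tendsto_ae
  unfold Bdd at *
  filter_upwards [h2, ae_all_iff.2 ha] with t h3 h4
  exact le_of_tendsto h3.norm (Eventually.of_forall fun n => h4 _)

/-- `w` solves the truncated equation `P(1+T)Pw = Pf`. -/
def Sol (T : HH →L[ℂ] HH) (x : ℝ) (f w : HH) : Prop := Pc x w = w ∧ Pc x (w + T w) = Pc x f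

section SysLemmas
variable {lam al : ℤ → ℝ} {Hf : ℝ → M2} {T : HH →L[ℂ] HH}

lemma Sol_exists (S : Sys lam al Hf T) (x : ℝ) (f : HH) : ∃ w, Sol T x f w := by
  obtain ⟨κ, hκ, hco⟩ := S.coer
  set A : HH →L[ℂ] HH := (Pc x) ∘L (1 + T) ∘L (Pc x) + (1 - Pc x) with hA
  have hAa : ∀ g, A g = Pc x (Pc x g + T (Pc x g)) + (g - Pc x g) := fun g => rfl
  have idem : ∀ g, Pc x (Pc x g) = Pc x g := Pc_left le_rfl
  have hm : 0 < min κ 1 := lt_min hκ one_pos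
  have key : ∀ g, min κ 1 * ‖g‖ ^ 2 ≤ (inner ℂ g (A g)).re := by
    intro g
    have o : inner ℂ (Pc x g) (g - Pc x g) = 0 := by
      rw [Pc_symm, map_sub, idem, sub_self, inner_zero_right]
    have e1 : inner ℂ g (A g) = inner ℂ (Pc x g) (Pc x g + T (Pc x g))
        + inner ℂ (g - Pc x g) (g - Pc x g) := by
      rw [hAa, inner_add_right, ← Pc_symm]
      congr 1
      conv_lhs => rw [show g = Pc x g + (g - Pc x g) by abel]
      rw [inner_add_left]
      have : Pc x g + (g - Pc x g) - Pc x (Pc x g + (g - Pc x g)) = g - Pc x g := by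
        rw [map_add, map_sub, idem]; abel
      rw [this, o, zero_add]
    have pyth : ‖g‖ ^ 2 = ‖Pc x g‖ ^ 2 + ‖g - Pc x g‖ ^ 2 := by
      have := norm_add_sq_eq_norm_sq_add_norm_sq_of_inner_eq_zero (𝕜 := ℂ) (Pc x g) (g - Pc x g) o
      rw [add_sub_cancel] at this
      nlinarith
    rw [e1, Complex.add_re, pyth]
    have h1 := hco (Pc x g)
    have h2 : (inner ℂ (g - Pc x g) (g - Pc x g)).re = ‖g - Pc x g‖ ^ 2 := by
      exact inner_self_eq_norm_sq (𝕜 := ℂ) (g - Pc x g)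
    rw [h2]
    have a1 := min_le_left κ 1
    have a2 := min_le_right κ 1
    nlinarith [sq_nonneg ‖Pc x g‖, sq_nonneg ‖g - Pc x g‖]
  have hu : IsUnit A := by
    refine ContinuousLinearMap.isUnit_of_forall_le_norm_inner_map A (c := ⟨min κ 1, hm.le⟩) hm ?_
    intro g
    rw [← inner_conj_symm, RCLike.norm_conj]
    refine le_trans ?_ ((Complex.abs_re_le_norm _).trans' (le_abs_self _))
    have := key g
    show ‖g‖ ^ 2 * min κ 1 ≤ _
    linarith
  rw [ContinuousLinearMap.isUnit_iff_bijective] at hu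
  obtain ⟨w, hw⟩ := hu.2 (Pc x f)
  rw [hAa] at hw
  have h1 : Pc x w = w := by
    have e : w - Pc x w = 0 := by
      have h3 := congrArg (Pc x) hw
      rw [map_add, map_sub, idem, idem, idem, sub_self, add_zero] at h3
      rw [h3] at hw
      simpa using hw
    rw [sub_eq_zero] at e
    exact e.symm
  refine ⟨w, h1, ?_⟩
  rw [h1, sub_self, add_zero] at hw
  exact hw

lemma Sol_energy {x : ℝ} {f w : HH} (h : Sol T x f w) (v : HH) (hv : Pc x v = v) :
    inner ℂ v (w + T w) = inner ℂ v f := by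
  rw [← hv, Pc_symm, h.2, ← Pc_symm]

lemma Sol_norm {κ : ℝ} (hκ : 0 < κ) (hco : ∀ f : HH, κ * ‖f‖ ^ 2 ≤ (inner ℂ f (f + T f)).re)
    {x : ℝ} {f w : HH} (h : Sol T x f w) : ‖w‖ ≤ ‖f‖ / κ := by
  have h1 := hco w
  rw [Sol_energy h w h.1] at h1
  have h2 : (inner ℂ w f).re ≤ ‖w‖ * ‖f‖ :=
    (Complex.re_le_norm _).trans (norm_inner_le_norm _ _)
  rw [le_div_iff₀ hκ]
  by_cases hw : ‖w‖ = 0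
  · rw [hw, zero_mul]; positivity
  · have : 0 < ‖w‖ := lt_of_le_of_ne (norm_nonneg _) (Ne.symm hw)
    nlinarith

/-- Solutions with bounded data are bounded, uniformly in `x`. -/
lemma Sol_bdd (S : Sys lam al Hf T) (U : ℝ) (hU : 0 ≤ U) : ∃ N : ℝ, 0 ≤ N ∧
    ∀ (x : ℝ) (u : ℝ → E2) (w : HH), MemLp u 2 μ01 → (∀ t ∈ Ioo (0:ℝ) 1, ‖u t‖ ≤ U) →
      Sol T x (emb u) w → Bdd w N := by
  obtain ⟨κ, hκ, hco⟩ := S.coer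
  obtain ⟨ι, _, c, l, h1, h2⟩ := S.approx (1/4) (by norm_num)
  set R := U + (∑ i, |c i|) * (U / κ) with hR
  have hR0 : 0 ≤ R := by positivity
  refine ⟨2 * R, by positivity, fun x u w hu hub hw => ?_⟩
  have hwn : ‖w‖ ≤ U / κ := (Sol_norm hκ hco hw).trans
    (div_le_div_of_nonneg_right (norm_emb_le hu hU hub) hκ.le)
  set E := T - fr c l with hE
  set b : HH := emb u - fr c l w with hb
  have hbb : Bdd b R := by
    rw [hb, fr_ae, ← emb_sub hu (frfun_memLp c l w)]
    refine Bdd_emb (hu.sub (frfun_memLp c l w)) (fun t ht => ?_)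
    refine (norm_sub_le _ _).trans (add_le_add (hub t ht) ((frfun_le c l w t).trans ?_))
    exact mul_le_mul_of_nonneg_left hwn (by positivity)
  have hEb : ∀ a : HH, Bdd a (2 * R) → Bdd (E a) R := by
    intro a ha
    have e1 := T_ae S ha
    have e2 : fr c l a =ᵐ[μ01] fun s => ∑ i, (c i : ℂ) • (inner ℂ (cv (l i)) a • c0E (l i) s) := by
      rw [fr_ae]; exact emb_coe (frfun_memLp c l a)
    have e3 : E a = T a - fr c l a := rfl
    unfold Bdd
    rw [e3]
    filter_upwards [e1, e2, Lp.coeFn_sub (T a) (fr c l a), ae_mem_Ioo] with t h3 h4 h5 h6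
    rw [h5, Pi.sub_apply, h3, h4, ← Fap_hfun c l a (Ioo_subset_Icc_self h6),
      ← Fap_sub_ker S.int (integrable_tr (integrable_hfun c l)) ha]
    refine (Fap_le (integrable_diff S c l) ha t).trans ?_
    nlinarith
  have hfix : w = Pc x (b - E w) := by
    have e : b - E w = emb u - T w := by
      rw [hb, hE, _root_.sub_apply]; abel
    have := hw.2
    rw [map_add, hw.1] at this
    rw [e, map_sub, ← this]; abel
  set Φ : HH → HH := fun a => Pc x (b - E a) with hΦ
  have hbd : ∀ n, Bdd (Φ^[n] 0) (2 * R) := by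
    intro n
    induction n with
    | zero => exact Bdd_zero (by positivity)
    | succ n ih =>
      rw [Function.iterate_succ_apply']
      have := (hbb.sub (hEb _ ih)).Pc x
      rw [two_mul]
      exact this
  have hcv : ∀ n, ‖Φ^[n] 0 - w‖ ≤ (1/4) ^ n * ‖w‖ := by
    intro n
    induction n with
    | zero => simp
    | succ n ih =>
      rw [Function.iterate_succ_apply']
      have e : Φ (Φ^[n] 0) - w = Pc x (E (w - Φ^[n] 0)) := by
        conv_lhs => rw [hfix]
        show Pc x (b - E (Φ^[n] 0)) - Pc x (b - E w) = _
        rw [← map_sub, map_sub E]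
        congr 1; abel
      rw [e]
      refine (norm_Pc_le _ _).trans ((E.le_opNorm _).trans ?_)
      rw [norm_sub_rev w]
      calc ‖E‖ * ‖Φ^[n] 0 - w‖ ≤ (1/4) * ((1/4)^n * ‖w‖) :=
            mul_le_mul h1 ih (norm_nonneg _) (by norm_num)
        _ = _ := by ring
  refine Bdd_lim hbd ?_
  rw [tendsto_iff_norm_sub_tendsto_zero]
  refine squeeze_zero (fun _ => norm_nonneg _) hcv ?_
  have := (tendsto_pow_atTop_nhds_zero_of_lt_one (r := (1/4:ℝ)) (by norm_num) (by norm_num)).mul_const ‖w‖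
  simpa using this

end SysLemmas


/-- Bounded data. -/
structure Nice (U : ℝ) (u : ℝ → E2) : Prop where
  mem : MemLp u 2 μ01
  bd : ∀ t ∈ Ioo (0:ℝ) 1, ‖u t‖ ≤ U

lemma norm_integral_Ico_le {V : Type*} [NormedAddCommGroup V] [NormedSpace ℝ V] (f : ℝ → V)
    {C x y : ℝ} (hC : 0 ≤ C) (hxy : x ≤ y)
    (h : ∀ᵐ s ∂μ01, s ∈ Ico x y → ‖f s‖ ≤ C) :
    ‖∫ s, (Ico x y).indicator f s ∂μ01‖ ≤ C * (y - x) := by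
  have hi : Integrable ((Ico x y).indicator (fun _ : ℝ => C)) μ01 :=
    (integrable_const C).indicator measurableSet_Ico
  refine (norm_integral_le_of_norm_le hi ?_).trans ?_
  · filter_upwards [h] with s hs
    by_cases hm : s ∈ Ico x y
    · rw [indicator_of_mem hm, indicator_of_mem hm]; exact hs hm
    · rw [indicator_of_notMem hm, indicator_of_notMem hm, norm_zero]
  · rw [integral_indicator_const _ measurableSet_Ico, smul_eq_mul, mul_comm]
    refine mul_le_mul_of_nonneg_left ?_ hC
    have : μ01 (Ico x y) ≤ ENNReal.ofReal (y - x) := by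
      unfold μ01
      refine (Measure.restrict_apply_le _ _).trans ?_
      rw [Real.volume_Ico]
    have h2 := ENNReal.toReal_mono ENNReal.ofReal_ne_top this
    rwa [ENNReal.toReal_ofReal (by linarith)] at h2

lemma const_of_small (ψ : ℝ → ℂ) (h : ∀ η > (0:ℝ), ∃ δ > (0:ℝ), ∀ x y, 0 ≤ x → x ≤ y → y ≤ 1 →
    y - x < δ → ‖ψ y - ψ x‖ ≤ η * (y - x)) {y : ℝ} (hy : y ∈ Icc (0:ℝ) 1) : ψ y = ψ 0 := by
  rw [← sub_eq_zero, ← norm_le_zero_iff]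
  refine le_of_forall_pos_le_add (fun η hη => ?_)
  rw [zero_add]
  obtain ⟨δ, hδ, hd⟩ := h η hη
  obtain ⟨n, hn⟩ := exists_nat_gt (1 / δ)
  have hn0 : (0:ℝ) < n := lt_trans (by positivity) hn
  have hstep : y / n < δ := by
    rw [div_lt_iff₀ hn0]
    rw [div_lt_iff₀ hδ] at hn
    nlinarith [hy.2]
  have key : ∀ k : ℕ, k ≤ n → ‖ψ (k * (y / n)) - ψ 0‖ ≤ η * (k * (y / n)) := by
    intro k
    induction k with
    | zero => intro _; simp
    | succ k ih =>
      intro hk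
      have h1 := ih (by omega)
      have hyn : 0 ≤ y / n := div_nonneg hy.1 hn0.le
      have h2 := hd (k * (y / n)) ((k + 1 : ℕ) * (y / n)) (by positivity)
        (by push_cast; nlinarith) (by
          have : ((k + 1 : ℕ) : ℝ) ≤ n := by exact_mod_cast hk
          calc ((k + 1 : ℕ) : ℝ) * (y / n) ≤ n * (y / n) := mul_le_mul_of_nonneg_right this hyn
            _ = y := by field_simp
            _ ≤ 1 := hy.2) (by push_cast; linarith)
      have h3 := norm_sub_le_norm_sub_add_norm_sub (ψ ((k + 1 : ℕ) * (y / n))) (ψ (k * (y / n))) (ψ 0)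
      push_cast at *
      linarith
  have := key n le_rfl
  rw [mul_div_cancel₀ _ hn0.ne'] at this
  have h2 : η * y ≤ η := mul_le_of_le_one_right hη.le hy.2
  linarith

section SysLemmas
variable {lam al : ℤ → ℝ} {Hf : ℝ → M2} {T : HH →L[ℂ] HH}

/-- The solution of the truncated equation. -/
def wsol (S : Sys lam al Hf T) (x : ℝ) (f : HH) : HH := (Sol_exists S x f).choose

lemma wsol_sol (S : Sys lam al Hf T) (x : ℝ) (f : HH) : Sol T x f (wsol S x f) :=
  (Sol_exists S x f).choose_spec

/-- Residual function. -/
def gres (S : Sys lam al Hf T) (u : ℝ → E2) (x s : ℝ) : E2 := u s - Fap Hf (wsol S x (emb u)) s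

/-- The transformed function. -/
def acc (S : Sys lam al Hf T) (u : ℝ → E2) (s : ℝ) : E2 := gres S u s s

lemma Sol_energy' (S : Sys lam al Hf T) {x : ℝ} {f w : HH} (h : Sol T x f w) (z : HH)
    (hz : Pc x z = z) : inner ℂ w (z + T z) = inner ℂ f z := by
  have h1 := Sol_energy h z hz
  have h2 : inner ℂ w (z + T z) = inner ℂ (w + T w) z := by
    rw [inner_add_right, inner_add_left, S.symm]
  rw [h2, ← inner_conj_symm, h1, inner_conj_symm]

lemma wsol_cut (S : Sys lam al Hf T) {x y : ℝ} (h : x ≤ y) (f : HH) :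
    Pc y (wsol S x f) = wsol S x f := by
  have := (wsol_sol S x f).1
  rw [← this, Pc_right h]

lemma wsol_ae (S : Sys lam al Hf T) {U N x : ℝ} {u : ℝ → E2} (hu : Nice U u)
    (hb : Bdd (wsol S x (emb u)) N) : ∀ᵐ s ∂μ01,
      wsol S x (emb u) s = (Iio x).indicator (gres S u x) s ∧
      (emb u - (wsol S x (emb u) + T (wsol S x (emb u)))) s = (Ici x).indicator (gres S u x) s := by
  have hs := wsol_sol S x (emb u)
  set w := wsol S x (emb u) with hw
  have c1 := Pc_ae x w
  have c2 := Pc_ae x (w + T w)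
  have c3 := Pc_ae x (emb u)
  rw [hs.1] at c1
  rw [hs.2] at c2
  filter_upwards [c1, c2, c3, emb_coe hu.mem, T_ae S hb, Lp.coeFn_add w (T w),
    Lp.coeFn_sub (emb u) (w + T w)] with s h1 h2 h3 h4 h5 h6 h7
  have hg : gres S u x s = u s - Fap Hf w s := rfl
  rw [h7, Pi.sub_apply, h6, Pi.add_apply, h4, h5]
  by_cases hx : s ∈ Iio x
  · have hx' : s ∉ Ici x := by simpa using hx
    rw [indicator_of_mem hx, indicator_of_notMem hx', hg]
    rw [indicator_of_mem hx, h6] at h2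
    rw [h3, indicator_of_mem hx, h4, Pi.add_apply, h5] at h2
    rw [h2]
    simp
  · have hx' : s ∈ Ici x := by simpa using hx
    rw [indicator_of_notMem hx] at h1
    rw [indicator_of_notMem hx, indicator_of_mem hx', hg, h1]
    simp

lemma wsol_diff_inner (S : Sys lam al Hf T) {x y : ℝ} (h : x ≤ y) (f g : HH) :
    inner ℂ g (wsol S y f) - inner ℂ g (wsol S x f) =
      inner ℂ (wsol S y g) (f - (wsol S x f + T (wsol S x f))) := by
  rw [inner_sub_right, Sol_energy' S (wsol_sol S y g) _ (wsol_cut S h f)]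
  congr 1
  rw [← Sol_energy' S (wsol_sol S y g) _ (wsol_cut S le_rfl f),
    Sol_energy (wsol_sol S y f) _ (wsol_cut S le_rfl g)]

lemma wsol_diff_int (S : Sys lam al Hf T) {U N x y : ℝ} (h : x ≤ y) {u v : ℝ → E2}
    (hu : Nice U u) (hv : Nice U v)
    (hbu : Bdd (wsol S x (emb u)) N) (hbv : Bdd (wsol S y (emb v)) N) :
    inner ℂ (emb v) (wsol S y (emb u)) - inner ℂ (emb v) (wsol S x (emb u)) =
      ∫ s, (Ico x y).indicator (fun s => inner ℂ (gres S v y s) (gres S u x s)) s ∂μ01 := by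
  rw [wsol_diff_inner S h, L2.inner_def]
  refine integral_congr_ae ?_
  filter_upwards [wsol_ae S hu hbu, wsol_ae S hv hbv] with s h1 h2
  rw [h1.2, h2.1]
  by_cases a : s ∈ Iio y
  · by_cases b : s ∈ Ici x
    · rw [indicator_of_mem a, indicator_of_mem b, indicator_of_mem (show s ∈ Ico x y from ⟨b, a⟩)]
    · rw [indicator_of_notMem b, indicator_of_notMem (fun hh : s ∈ Ico x y => b hh.1),
        inner_zero_right]
  · rw [indicator_of_notMem a, indicator_of_notMem (fun hh : s ∈ Ico x y => a hh.2),
        inner_zero_left]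

lemma gres_le (S : Sys lam al Hf T) {U N x s : ℝ} {u : ℝ → E2} (hu : Nice U u)
    (hb : Bdd (wsol S x (emb u)) N) (hs : s ∈ Ioo (0:ℝ) 1) :
    ‖gres S u x s‖ ≤ U + 2 * (∫ s, ‖Hf s‖) * N :=
  (norm_sub_le _ _).trans (add_le_add (hu.bd s hs) (Fap_le S.int hb s))

lemma gres_meas (S : Sys lam al Hf T) {U x : ℝ} {u : ℝ → E2} (hu : Nice U u) :
    AEStronglyMeasurable (gres S u x) μ01 := hu.mem.1.sub (Fap_meas S _)

lemma wsol_lip (S : Sys lam al Hf T) {κ : ℝ} (hκ : 0 < κ)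
    (hco : ∀ f : HH, κ * ‖f‖ ^ 2 ≤ (inner ℂ f (f + T f)).re) {U N M x y : ℝ} (h : x ≤ y)
    {u : ℝ → E2} (hu : Nice U u) (hM0 : 0 ≤ M) (hb : ∀ x, Bdd (wsol S x (emb u)) N)
    (hM : ∀ x, ∀ s ∈ Ioo (0:ℝ) 1, ‖gres S u x s‖ ≤ M) :
    ‖wsol S y (emb u) - wsol S x (emb u)‖ ^ 2 ≤ M ^ 2 / κ * (y - x) := by
  set d := wsol S y (emb u) - wsol S x (emb u) with hd
  have hG : d + T d = (wsol S y (emb u) + T (wsol S y (emb u)))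
      - (wsol S x (emb u) + T (wsol S x (emb u))) := by
    rw [hd, map_sub]; abel
  have cx := wsol_cut S (le_refl x) (emb u)
  have cy := wsol_cut S (le_refl y) (emb u)
  have cxy := wsol_cut S h (emb u)
  have e1 : inner ℂ d (d + T d) = inner ℂ (emb u) d := by
    have a1 : inner ℂ (wsol S y (emb u)) (d + T d) = inner ℂ (emb u) d :=
      Sol_energy' S (wsol_sol S y (emb u)) d (by rw [hd, map_sub, cy, cxy])
    have a2 : inner ℂ (wsol S x (emb u)) (d + T d) = 0 := by
      rw [hG, inner_sub_right, Sol_energy (wsol_sol S y (emb u)) _ cxy,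
        Sol_energy (wsol_sol S x (emb u)) _ cx, sub_self]
    conv_lhs => rw [hd]
    rw [inner_sub_left, ← hd, a1, a2, sub_zero]
  have e2 : ‖inner ℂ (emb u) d‖ ≤ M * M * (y - x) := by
    rw [hd, inner_sub_right, wsol_diff_int S h hu hu (hb x) (hb y)]
    refine norm_integral_Ico_le _ (by positivity) h ?_
    filter_upwards [ae_mem_Ioo] with s hs _
    refine (norm_inner_le_norm _ _).trans (mul_le_mul (hM _ s hs) (hM _ s hs) (norm_nonneg _) hM0)
  have h3 := hco d
  rw [e1] at h3
  have h4 := Complex.re_le_norm (inner ℂ (emb u) d)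
  rw [div_mul_eq_mul_div, le_div_iff₀ hκ]
  nlinarith

/-- The factorisation identity `∫₀ˣ ⟨a_v, a_u⟩ = ⟨v, w_x(u)⟩`. -/
lemma factor (S : Sys lam al Hf T) {U : ℝ} {u v : ℝ → E2} (hu : Nice U u) (hv : Nice U v)
    (hmu : AEStronglyMeasurable (acc S u) μ01) (hmv : AEStronglyMeasurable (acc S v) μ01)
    {x : ℝ} (hx : x ∈ Icc (0:ℝ) 1) :
    ∫ s, (Iio x).indicator (fun s => inner ℂ (acc S v s) (acc S u s)) s ∂μ01 =
      inner ℂ (emb v) (wsol S x (emb u)) := by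
  have hU : 0 ≤ U := (norm_nonneg _).trans (hu.bd (1/2) (by norm_num))
  obtain ⟨κ, hκ, hco⟩ := S.coer
  obtain ⟨N, hN0, hN⟩ := Sol_bdd S U hU
  have hbu : ∀ x, Bdd (wsol S x (emb u)) N := fun x => hN x u _ hu.mem hu.bd (wsol_sol S x _)
  have hbv : ∀ x, Bdd (wsol S x (emb v)) N := fun x => hN x v _ hv.mem hv.bd (wsol_sol S x _)
  set M := U + 2 * (∫ s, ‖Hf s‖) * N with hM
  have hM0 : 0 ≤ M := by
    have : 0 ≤ ∫ s, ‖Hf s‖ := integral_nonneg fun _ => norm_nonneg _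
    positivity
  have hMu : ∀ x, ∀ s ∈ Ioo (0:ℝ) 1, ‖gres S u x s‖ ≤ M := fun x s hs => gres_le S hu (hbu x) hs
  have hMv : ∀ x, ∀ s ∈ Ioo (0:ℝ) 1, ‖gres S v x s‖ ≤ M := fun x s hs => gres_le S hv (hbv x) hs
  set q : ℝ → ℂ := fun s => inner ℂ (acc S v s) (acc S u s) with hq
  have hqi : Integrable q μ01 := by
    refine integrable_inner_memLp ?_ ?_
    · exact memLp_of_bdd hmv M (fun s hs => hMv s s hs)
    · exact memLp_of_bdd hmu M (fun s hs => hMu s s hs)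
  have hdiff : ∀ (z : ℝ → E2), Nice U z → (∀ x, Bdd (wsol S x (emb z)) N) →
      (∀ x, ∀ s ∈ Ioo (0:ℝ) 1, ‖gres S z x s‖ ≤ M) → ∀ η > (0:ℝ), ∃ δ > (0:ℝ),
      ∀ x y, x ≤ y → y - x < δ → ∀ s ∈ Ioo (0:ℝ) 1, ‖gres S z y s - gres S z x s‖ ≤ η := by
    intro z hz hbz hMz η hη
    obtain ⟨C, hC0, hC⟩ := Fap_split S (η / (4 * (N + 1))) (by positivity)
    set L := M ^ 2 / κ with hL
    have hL0 : 0 ≤ L := by positivity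
    refine ⟨η ^ 2 / (4 * (C ^ 2 + 1) * (L + 1)), by positivity, fun x y hxy hd s hs => ?_⟩
    have e : gres S z y s - gres S z x s =
        - Fap Hf (wsol S y (emb z) - wsol S x (emb z)) s := by
      rw [Fap_sub S.int (hbz y) (hbz x)]
      unfold gres; abel
    rw [e, norm_neg]
    refine (hC _ _ ((hbz y).sub (hbz x)) s (Ioo_subset_Icc_self hs)).trans ?_
    have b1 : η / (4 * (N + 1)) * (N + N) ≤ η / 2 := by
      rw [div_mul_eq_mul_div, div_le_div_iff₀ (by positivity) (by norm_num)]
      nlinarith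
    have b2 : C * ‖wsol S y (emb z) - wsol S x (emb z)‖ ≤ η / 2 := by
      have hl := wsol_lip S hκ hco hxy hz hM0 hbz hMz
      refine abs_le_of_sq_le_sq' ?_ (by positivity) |>.2
      rw [mul_pow]
      rw [lt_div_iff₀ (by positivity)] at hd
      have hyx : 0 ≤ y - x := by linarith
      calc C ^ 2 * ‖wsol S y (emb z) - wsol S x (emb z)‖ ^ 2 ≤ C ^ 2 * (L * (y - x)) :=
            mul_le_mul_of_nonneg_left hl (by positivity)
        _ ≤ (C ^ 2 + 1) * ((L + 1) * (y - x)) := by gcongr <;> linarith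
        _ ≤ (η / 2) ^ 2 := by nlinarith
    linarith
  set ψ : ℝ → ℂ := fun x => inner ℂ (emb v) (wsol S x (emb u)) - ∫ s, (Iio x).indicator q s ∂μ01
    with hψ
  have hc : ψ x = ψ 0 := by
    refine const_of_small ψ (fun η hη => ?_) hx
    obtain ⟨δ1, hδ1, hd1⟩ := hdiff u hu hbu hMu (η / (2 * (M + 1))) (by positivity)
    obtain ⟨δ2, hδ2, hd2⟩ := hdiff v hv hbv hMv (η / (2 * (M + 1))) (by positivity)
    refine ⟨min δ1 δ2, lt_min hδ1 hδ2, fun x y _ hxy _ hd => ?_⟩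
    have hde1 : y - x < δ1 := hd.trans_le (min_le_left _ _)
    have hde2 : y - x < δ2 := hd.trans_le (min_le_right _ _)
    have i1 : Integrable (fun s => inner ℂ (gres S v y s) (gres S u x s)) μ01 :=
      integrable_inner_memLp (memLp_of_bdd (gres_meas S hv) M (hMv y))
        (memLp_of_bdd (gres_meas S hu) M (hMu x))
    have e : ψ y - ψ x = ∫ s, (Ico x y).indicator
        (fun s => inner ℂ (gres S v y s) (gres S u x s) - q s) s ∂μ01 := by
      have e1 := wsol_diff_int S hxy hu hv (hbu x) (hbv y)
      have e2 : ∫ s, (Iio y).indicator q s ∂μ01 - ∫ s, (Iio x).indicator q s ∂μ01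
          = ∫ s, (Ico x y).indicator q s ∂μ01 := by
        rw [← integral_sub (hqi.indicator measurableSet_Iio) (hqi.indicator measurableSet_Iio)]
        congr 1
        funext s
        by_cases h1 : s < x
        · have h2 : s < y := by linarith
          simp [indicator, h1, h2, not_le.2 h1]
        · simp [indicator, h1, not_lt.1 h1]
      have e3 : ∫ s, (Ico x y).indicator
          (fun s => inner ℂ (gres S v y s) (gres S u x s) - q s) s ∂μ01 =
          ∫ s, (Ico x y).indicator (fun s => inner ℂ (gres S v y s) (gres S u x s)) s ∂μ01
          - ∫ s, (Ico x y).indicator q s ∂μ01 := by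
        rw [← integral_sub (i1.indicator measurableSet_Ico) (hqi.indicator measurableSet_Ico)]
        congr 1
        funext s
        by_cases hs : s ∈ Ico x y <;> simp [hs]
      rw [e3, ← e1, ← e2, hψ]
      ring
    rw [e]
    refine norm_integral_Ico_le _ hη.le hxy ?_
    filter_upwards [ae_mem_Ioo] with s hs hsx
    have d1 : ‖gres S u x s - acc S u s‖ ≤ η / (2 * (M + 1)) := by
      rw [norm_sub_rev]
      exact hd1 x s hsx.1 (by linarith [hsx.2]) s hs
    have d2 : ‖gres S v y s - acc S v s‖ ≤ η / (2 * (M + 1)) :=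
      hd2 s y hsx.2.le (by linarith [hsx.1]) s hs
    have e4 : inner ℂ (gres S v y s) (gres S u x s) - q s =
        inner ℂ (gres S v y s - acc S v s) (gres S u x s)
          + inner ℂ (acc S v s) (gres S u x s - acc S u s) := by
      rw [inner_sub_left, inner_sub_right, hq]; ring
    rw [e4]
    refine (norm_add_le _ _).trans ?_
    have f1 : ‖inner ℂ (gres S v y s - acc S v s) (gres S u x s)‖ ≤ η / (2 * (M + 1)) * M :=
      (norm_inner_le_norm _ _).trans (mul_le_mul d2 (hMu x s hs) (norm_nonneg _) (by positivity))
    have f2 : ‖inner ℂ (acc S v s) (gres S u x s - acc S u s)‖ ≤ M * (η / (2 * (M + 1))) :=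
      (norm_inner_le_norm _ _).trans (mul_le_mul (hMv s s hs) d1 (norm_nonneg _) hM0)
    have f3 : η / (2 * (M + 1)) * M ≤ η / 2 := by
      rw [div_mul_eq_mul_div, div_le_div_iff₀ (by positivity) (by norm_num)]
      nlinarith
    linarith
  have h0 : ψ 0 = 0 := by
    have w0 : wsol S 0 (emb u) = 0 := by rw [← (wsol_sol S 0 (emb u)).1, Pc_zero]
    have i0 : ∫ s, (Iio (0:ℝ)).indicator q s ∂μ01 = 0 := by
      rw [integral_congr_ae (g := fun _ => (0:ℂ)), integral_zero]
      filter_upwards [ae_mem_Ioo] with s hs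
      exact indicator_of_notMem (by simpa using hs.1.le) _
    simp only [hψ, w0, i0, inner_zero_right, sub_zero]
  rw [h0] at hc
  exact (sub_eq_zero.1 hc).symm

end SysLemmas


lemma ii_tri {V : Type*} [NormedAddCommGroup V] [NormedSpace ℝ V] (f : ℝ → V) {x : ℝ}
    (hx : x ∈ Icc (0:ℝ) 1) (hf : ∀ t, x < t → f t = 0) :
    ∫ t in (0:ℝ)..x, f t = ∫ t, f t ∂μ01 := by
  rw [intervalIntegral.integral_of_le hx.1, mu01_eq_Ioc]
  refine (setIntegral_eq_of_subset_of_forall_sdiff_eq_zero measurableSet_Ioc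
    (Ioc_subset_Ioc_right hx.2) (fun t ht => hf t ?_)).symm
  by_contra h
  exact ht.2 ⟨ht.1.1, not_lt.1 h⟩

lemma ae_affine {P : ℝ → Prop} (h : ∀ᵐ r, P r) {a : ℝ} (ha : a ≠ 0) (b : ℝ) :
    ∀ᵐ s, P (s * a + b) := by
  have q1 : Measure.QuasiMeasurePreserving (fun s : ℝ => s + b) volume volume :=
    (measurePreserving_add_right volume b).quasiMeasurePreserving
  have q2 : Measure.QuasiMeasurePreserving (fun s : ℝ => s * a) volume volume := by
    refine ⟨measurable_id.mul_const a, ?_⟩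
    rw [Real.map_volume_mul_right ha]
    exact Measure.smul_absolutelyContinuous
  exact (q1.comp q2).ae h

lemma Fker_congr_col {H Hf : ℝ → M2} (hae : Hf =ᵐ[μ11] H) {t : ℝ} (ht : t ∈ Ioo (0:ℝ) 1) :
    ∀ᵐ s ∂μ01, Fker H s t = Fker Hf s t := by
  have h : ∀ᵐ r, r ∈ Ioo (-1:ℝ) 1 → Hf r = H r := by
    unfold μ11 at hae
    exact (ae_restrict_iff' measurableSet_Ioo).1 hae
  unfold μ01
  rw [ae_restrict_iff' measurableSet_Ioo]
  filter_upwards [ae_affine h (a := 1/2) (by norm_num) (-t/2),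
    ae_affine h (a := 1/2) (by norm_num) (t/2)] with s h1 h2 hs
  have e1 : s * (1/2) + -t/2 = (s - t)/2 := by ring
  have e2 : s * (1/2) + t/2 = (s + t)/2 := by ring
  rw [e1] at h1
  rw [e2] at h2
  unfold Fker
  rw [h1 ⟨by linarith [hs.1, ht.2], by linarith [hs.2, ht.1]⟩,
    h2 ⟨by linarith [hs.1, ht.1], by linarith [hs.2, ht.2]⟩]

lemma Fker_congr_row {H Hf : ℝ → M2} (hae : Hf =ᵐ[μ11] H) {x : ℝ} (hx : x ∈ Ioo (0:ℝ) 1) :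
    ∀ᵐ t ∂μ01, Fker H x t = Fker Hf x t := by
  have h : ∀ᵐ r, r ∈ Ioo (-1:ℝ) 1 → Hf r = H r := by
    unfold μ11 at hae
    exact (ae_restrict_iff' measurableSet_Ioo).1 hae
  unfold μ01
  rw [ae_restrict_iff' measurableSet_Ioo]
  filter_upwards [ae_affine h (a := -1/2) (by norm_num) (x/2),
    ae_affine h (a := 1/2) (by norm_num) (x/2)] with t h1 h2 ht
  have e1 : t * (-1/2) + x/2 = (x - t)/2 := by ring
  have e2 : t * (1/2) + x/2 = (x + t)/2 := by ring
  rw [e1] at h1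
  rw [e2] at h2
  unfold Fker
  rw [h1 ⟨by linarith [hx.1, ht.2], by linarith [hx.2, ht.1]⟩,
    h2 ⟨by linarith [hx.1, ht.1], by linarith [hx.2, ht.2]⟩]

lemma opM_integral {f : ℝ → M2} (hf : Integrable f μ01) (v : E2) :
    opM (∫ s, f s ∂μ01) v = ∫ s, opM (f s) v ∂μ01 := by
  have := ContinuousLinearMap.integral_comp_comm
    ((ContinuousLinearMap.apply ℂ E2 v).comp opML) hf
  exact this.symm

instance instProbMu01 : IsProbabilityMeasure μ01 := ⟨mu01_univ⟩

/-- The transformation operator applied to `u`. -/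
def Ktr (K : ℝ → ℝ → M2) (u : ℝ → E2) (x : ℝ) : E2 := u x + ∫ t, opM (K x t) (u t) ∂μ01

lemma K_integrable {p : ℝ≥0∞} (hp : 1 ≤ p) {K : ℝ → ℝ → M2} (hK : MemGp p K) {x : ℝ}
    (hx : x ∈ Icc (0:ℝ) 1) : Integrable (K x) μ01 :=
  (hK.1 x hx).integrable hp

lemma opM_integrable {f : ℝ → M2} (hf : Integrable f μ01) {u : ℝ → E2}
    (hm : AEStronglyMeasurable u μ01) {U : ℝ} (hu : ∀ᵐ t ∂μ01, ‖u t‖ ≤ U) :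
    Integrable (fun t => opM (f t) (u t)) μ01 := by
  refine (hf.norm.mul_const U).mono' ?_ ?_
  · exact opML.aestronglyMeasurable_comp₂ hf.aestronglyMeasurable hm
  · filter_upwards [hu] with t ht
    exact (opM_le _ _).trans (mul_le_mul_of_nonneg_left ht (norm_nonneg _))

lemma Nice.ae_bd {U : ℝ} {u : ℝ → E2} (hu : Nice U u) : ∀ᵐ t ∂μ01, ‖u t‖ ≤ U := by
  filter_upwards [ae_mem_Ioo] with t ht
  exact hu.bd t ht

lemma K_cont {p : ℝ≥0∞} (hp : 1 ≤ p) {K : ℝ → ℝ → M2} (hK : MemGp p K) {U : ℝ} {u : ℝ → E2}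
    (hu : Nice U u) : ContinuousOn (fun x => ∫ t, opM (K x t) (u t) ∂μ01) (Icc 0 1) := by
  have hU : 0 ≤ U := (norm_nonneg _).trans (hu.bd (1/2) (by norm_num))
  rw [Metric.continuousOn_iff]
  intro x0 hx0 ε hε
  obtain ⟨δ, hδ, hd⟩ := hK.2.2.1 x0 hx0 (ε / (U + 1)) (by positivity)
  refine ⟨δ, hδ, fun x hx hxd => ?_⟩
  have h1 := hd x hx (by rwa [Real.dist_eq] at hxd)
  have ix := K_integrable hp hK hx
  have ix0 := K_integrable hp hK hx0
  have id : Integrable (fun t => K x t - K x0 t) μ01 := ix.sub ix0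
  have h2 : ∫ t, ‖K x t - K x0 t‖ ∂μ01 < ε / (U + 1) := by
    have h3 : eLpNorm (fun t => K x t - K x0 t) 1 μ01 < ENNReal.ofReal (ε / (U + 1)) :=
      (eLpNorm_le_eLpNorm_of_exponent_le hp id.aestronglyMeasurable).trans_lt h1
    rw [integral_norm_eq_lintegral_enorm id.aestronglyMeasurable]
    rw [eLpNorm_one_eq_lintegral_enorm] at h3
    exact (ENNReal.lt_ofReal_iff_toReal_lt h3.ne_top).1 h3
  rw [dist_eq_norm, ← integral_sub (opM_integrable ix hu.mem.1 hu.ae_bd)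
    (opM_integrable ix0 hu.mem.1 hu.ae_bd)]
  refine (norm_integral_le_of_norm_le (id.norm.mul_const U) ?_).trans_lt ?_
  · filter_upwards [hu.ae_bd] with t ht
    have : opM (K x t) (u t) - opM (K x0 t) (u t) = opM (K x t - K x0 t) (u t) := by
      rw [opM_sub]; rfl
    rw [this]
    exact (opM_le _ _).trans (mul_le_mul_of_nonneg_left ht (norm_nonneg _))
  · rw [integral_mul_const]
    rw [lt_div_iff₀ (by positivity)] at h2
    have : 0 ≤ ∫ t, ‖K x t - K x0 t‖ ∂μ01 := integral_nonneg fun _ => norm_nonneg _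
    nlinarith

lemma Ktr_meas {p : ℝ≥0∞} (hp : 1 ≤ p) {K : ℝ → ℝ → M2} (hK : MemGp p K) {U : ℝ} {u : ℝ → E2}
    (hu : Nice U u) : AEStronglyMeasurable (Ktr K u) μ01 := by
  refine hu.mem.1.add ?_
  unfold μ01
  exact ((K_cont hp hK hu).mono Ioo_subset_Icc_self).aestronglyMeasurable measurableSet_Ioo

section SysLemmas
variable {lam al : ℤ → ℝ} {Hf : ℝ → M2} {T : HH →L[ℂ] HH}

lemma Ktr_eq_acc (S : Sys lam al Hf T) {H : ℝ → M2} (hae : Hf =ᵐ[μ11] H) {p : ℝ≥0∞} (hp : 1 ≤ p)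
    {K : ℝ → ℝ → M2} (hK : MemGp p K) (hsol : SolvesGLMwith (Fker H) K) {U : ℝ} {u : ℝ → E2}
    (hu : Nice U u) {x : ℝ} (hx : x ∈ Ioo (0:ℝ) 1) : Ktr K u x = acc S u x := by
  have hU : 0 ≤ U := (norm_nonneg _).trans (hu.bd (1/2) (by norm_num))
  have hx' := Ioo_subset_Icc_self hx
  obtain ⟨N, hN0, hN⟩ := Sol_bdd S U hU
  have hb : Bdd (wsol S x (emb u)) N := hN x u _ hu.mem hu.bd (wsol_sol S x _)
  have hwae := wsol_ae S hu hb
  have hacc : acc S u x = u x - Fap Hf (wsol S x (emb u)) x := rfl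
  have hgr : ∀ s, gres S u x s = u s - Fap Hf (wsol S x (emb u)) s := fun s => rfl
  set w := wsol S x (emb u) with hw
  have iK := K_integrable hp hK hx'
  have hK0 : ∀ t, x < t → K x t = 0 := fun t ht => hsol.1 x t (fun h => absurd h.2.1 (not_le.2 ht))
  have hne : ∀ᵐ s ∂μ01, s ≠ x := by
    unfold μ01
    exact ae_restrict_of_ae (Measure.ae_ne volume x)
  -- first splitting
  have e1 : ∀ᵐ s ∂μ01, opM (K x s) (u s) = opM (K x s) (w s) + opM (K x s) (Fap Hf w s) := by
    filter_upwards [hwae, hne] with s h1 h2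
    rcases lt_or_gt_of_ne h2 with h3 | h3
    · rw [h1.1, indicator_of_mem (show s ∈ Iio x from h3), hgr, ← map_add, sub_add_cancel]
    · rw [hK0 s h3, opM_zero]; simp
  have i1 : Integrable (fun s => opM (K x s) (w s)) μ01 :=
    opM_integrable iK (Lp.aestronglyMeasurable w) hb
  have i2 : Integrable (fun s => opM (K x s) (Fap Hf w s)) μ01 :=
    opM_integrable iK (Fap_meas S w) (Eventually.of_forall fun s => Fap_le S.int hb s)
  -- product integrability
  have hFm := stronglyMeasurable_Fker S.meas
  have iprod : Integrable (fun z : ℝ × ℝ => K x z.1 * Fker Hf z.1 z.2) (μ01.prod μ01) := by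
    obtain ⟨j1, _⟩ := schur_half (k := fun z : ℝ × ℝ => ‖Fker Hf z.1 z.2‖) hFm.norm
      (fun z => norm_nonneg _) (R := 2 * ∫ s, ‖Hf s‖)
      (fun y => ⟨(Fker_row01 S.int y).1.norm, (Fker_row01 S.int y).2⟩)
      (q := fun s => ‖K x s‖) iK.norm (fun _ => norm_nonneg _)
    refine j1.mono' (iK.aestronglyMeasurable.comp_fst.mul hFm.aestronglyMeasurable) ?_
    refine Eventually.of_forall fun z => ?_
    rw [mul_comm]
    exact norm_mul_le _ _
  have iprod2 : Integrable (fun z : ℝ × ℝ => opM (K x z.1 * Fker Hf z.1 z.2) (w z.2))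
      (μ01.prod μ01) := by
    refine (iprod.norm.mul_const N).mono' ?_ ?_
    · exact opML.aestronglyMeasurable_comp₂ iprod.aestronglyMeasurable
        (Lp.aestronglyMeasurable w).comp_snd
    · have hb2 : ∀ᵐ z : ℝ × ℝ ∂(μ01.prod μ01), ‖w z.2‖ ≤ N :=
        Measure.quasiMeasurePreserving_snd.ae hb
      filter_upwards [hb2] with z hz
      exact (opM_le _ _).trans (mul_le_mul_of_nonneg_left hz (norm_nonneg _))
  have e2 : ∫ s, opM (K x s) (Fap Hf w s) ∂μ01 =
      ∫ t, opM (∫ s, K x s * Fker Hf s t ∂μ01) (w t) ∂μ01 := by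
    have a1 : ∫ s, opM (K x s) (Fap Hf w s) ∂μ01 =
        ∫ s, ∫ t, opM (K x s * Fker Hf s t) (w t) ∂μ01 ∂μ01 := by
      congr 1
      funext s
      unfold Fap
      rw [← ContinuousLinearMap.integral_comp_comm _ (Fap_integrable S.int hb s)]
      congr 1
      funext t
      rw [opM_mul_apply]
    rw [a1, integral_integral_swap iprod2]
    refine integral_congr_ae ?_
    filter_upwards [iprod.prod_left_ae] with t ht
    rw [opM_integral ht]
  have i3 : Integrable (fun t => opM (∫ s, K x s * Fker Hf s t ∂μ01) (w t)) μ01 := by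
    have iR : Integrable (fun t => ∫ s, K x s * Fker Hf s t ∂μ01) μ01 := iprod.integral_prod_right
    exact opM_integrable iR (Lp.aestronglyMeasurable w) hb
  have i4 : Integrable (fun t => opM (Fker Hf x t) (w t)) μ01 := Fap_integrable S.int hb x
  -- GLM
  have hglm : ∀ᵐ t ∂μ01, t < x → K x t + Fker Hf x t + ∫ s, K x s * Fker Hf s t ∂μ01 = 0 := by
    have g1 := hsol.2 x hx'
    rw [ae_restrict_iff' measurableSet_Ioo] at g1
    have g2 : ∀ᵐ t ∂μ01, t ∈ Ioo 0 x →
        K x t + Fker H x t + ∫ s in (0:ℝ)..x, K x s * Fker H s t = 0 := by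
      unfold μ01
      exact ae_restrict_of_ae g1
    filter_upwards [g2, Fker_congr_row hae hx, ae_mem_Ioo] with t h1 h2 h3 h4
    have h5 := h1 ⟨h3.1, h4⟩
    rw [h2, ii_tri _ hx' (fun s hs => by rw [hK0 s hs, zero_mul])] at h5
    rw [← h5]
    congr 1
    refine integral_congr_ae ?_
    filter_upwards [Fker_congr_col hae h3] with s hs
    rw [hs]
  have e3 : (∫ t, opM (K x t) (w t) ∂μ01) + (∫ t, opM (Fker Hf x t) (w t) ∂μ01)
      + ∫ t, opM (∫ s, K x s * Fker Hf s t ∂μ01) (w t) ∂μ01 = 0 := by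
    have i5 : Integrable (fun t => opM (K x t) (w t) + opM (Fker Hf x t) (w t)) μ01 := i1.add i4
    rw [← integral_add i1 i4, ← integral_add i5 i3]
    rw [integral_congr_ae (g := fun _ => (0:E2)), integral_zero]
    filter_upwards [hglm, hwae] with t h1 h2
    by_cases ht : t < x
    · have h3 := h1 ht
      show opM (K x t) (w t) + opM (Fker Hf x t) (w t) + _ = _
      have h4 : opM (K x t + Fker Hf x t + ∫ s, K x s * Fker Hf s t ∂μ01) (w t) = 0 := by
        rw [h3, opM_zero]; rfl
      rw [opM_add, opM_add] at h4
      exact h4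
    · rw [h2.1, indicator_of_notMem (by simpa using ht)]
      simp
  rw [hacc]
  unfold Ktr
  rw [integral_congr_ae e1, integral_add i1 i2, e2]
  have e4 : Fap Hf w x = ∫ t, opM (Fker Hf x t) (w t) ∂μ01 := rfl
  rw [e4]
  rw [sub_eq_add_neg]
  congr 1
  rw [← sub_eq_zero, sub_neg_eq_add, ← e3]
  abel

lemma acc_meas (S : Sys lam al Hf T) {H : ℝ → M2} (hae : Hf =ᵐ[μ11] H) {p : ℝ≥0∞} (hp : 1 ≤ p)
    {K : ℝ → ℝ → M2} (hK : MemGp p K) (hsol : SolvesGLMwith (Fker H) K) {U : ℝ} {u : ℝ → E2}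
    (hu : Nice U u) : AEStronglyMeasurable (acc S u) μ01 := by
  refine (Ktr_meas hp hK hu).congr ?_
  filter_upwards [ae_mem_Ioo] with x hx
  exact Ktr_eq_acc S hae hp hK hsol hu hx

end SysLemmas


lemma ae_zero_of_prim {q : ℝ → ℂ} (hq : Integrable q μ01)
    (h : ∀ x ∈ Icc (0:ℝ) 1, ∫ s, (Iio x).indicator q s ∂μ01 = 0) : ∀ᵐ s ∂μ01, q s = 0 := by
  have hi : IntervalIntegrable q volume 0 1 := by
    rw [intervalIntegrable_iff_integrableOn_Ioo_of_le zero_le_one]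
    exact hq
  have hz : ∀ x ∈ Icc (0:ℝ) 1, ∫ s in (0:ℝ)..x, q s = 0 := by
    intro x hx
    rw [← h x hx, intervalIntegral.integral_of_le hx.1, integral_indicator measurableSet_Iio, μ01,
      Measure.restrict_restrict measurableSet_Iio, integral_Ioc_eq_integral_Ioo]
    congr 2
    ext t
    exact ⟨fun h => ⟨h.2, h.1, h.2.trans_le hx.2⟩, fun h => ⟨h.2.1, h.1⟩⟩
  have hd := hi.ae_hasDerivAt_integral
  unfold μ01
  rw [ae_restrict_iff' measurableSet_Ioo]
  filter_upwards [hd] with x hx hx1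
  have h1 := hx (by rw [uIcc_of_le zero_le_one]; exact Ioo_subset_Icc_self hx1) 0 (by simp)
  have h2 : HasDerivAt (fun x => ∫ s in (0:ℝ)..x, q s) 0 x := by
    refine (hasDerivAt_const x (0:ℂ)).congr_of_eventuallyEq ?_
    filter_upwards [Ioo_mem_nhds hx1.1 hx1.2] with y hy
    exact hz y (Ioo_subset_Icc_self hy)
  exact h1.unique h2

lemma nice_c0E (l : ℝ) : Nice 1 (c0E l) := ⟨memLp_c0E l, fun t _ => (norm_c0E l t).le⟩

section SysLemmas
variable {lam al : ℤ → ℝ} {Hf : ℝ → M2} {T : HH →L[ℂ] HH}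

lemma acc_memLp (S : Sys lam al Hf T) {u : ℝ → E2} (hu : Nice 1 u)
    (hm : AEStronglyMeasurable (acc S u) μ01) : MemLp (acc S u) 2 μ01 := by
  obtain ⟨N, hN0, hN⟩ := Sol_bdd S 1 zero_le_one
  exact memLp_of_bdd hm _ (fun s hs => gres_le S hu (hN s u _ hu.mem hu.bd (wsol_sol S s _)) hs)

lemma wsol_one (S : Sys lam al Hf T) (f : HH) : wsol S 1 f + T (wsol S 1 f) = f := by
  have := (wsol_sol S 1 f).2
  rwa [Pc_one, Pc_one] at this

lemma G_inj (S : Sys lam al Hf T) {f : HH} (h : f + T f = 0) : f = 0 := by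
  obtain ⟨κ, hκ, hco⟩ := S.coer
  have := hco f
  rw [h, inner_zero_right, Complex.zero_re] at this
  have h2 : ‖f‖ ^ 2 ≤ 0 := by
    by_contra hc
    push Not at hc
    nlinarith
  have h3 : ‖f‖ = 0 := by nlinarith [norm_nonneg f]
  exact norm_eq_zero.1 h3

lemma G_norm {κ : ℝ} (hκ : 0 < κ) (hco : ∀ f : HH, κ * ‖f‖ ^ 2 ≤ (inner ℂ f (f + T f)).re)
    (f : HH) : ‖f‖ ≤ ‖f + T f‖ / κ := by
  have h1 := hco f
  have h2 : (inner ℂ f (f + T f)).re ≤ ‖f‖ * ‖f + T f‖ :=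
    (Complex.re_le_norm _).trans (norm_inner_le_norm _ _)
  rw [le_div_iff₀ hκ]
  by_cases hw : ‖f‖ = 0
  · rw [hw, zero_mul]; positivity
  · have : 0 < ‖f‖ := lt_of_le_of_ne (norm_nonneg _) (Ne.symm hw)
    nlinarith

lemma inner_acc (S : Sys lam al Hf T) {u v : ℝ → E2} (hu : Nice 1 u) (hv : Nice 1 v)
    (hmu : AEStronglyMeasurable (acc S u) μ01) (hmv : AEStronglyMeasurable (acc S v) μ01)
    {x : ℝ} (hx : x ∈ Icc (0:ℝ) 1) :
    inner ℂ (emb (acc S v)) (Pc x (emb (acc S u))) = inner ℂ (emb v) (wsol S x (emb u)) := by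
  rw [← factor S hu hv hmu hmv hx, L2.inner_def]
  refine integral_congr_ae ?_
  filter_upwards [emb_coe (acc_memLp S hu hmu), emb_coe (acc_memLp S hv hmv),
    Pc_ae x (emb (acc S u))] with s h1 h2 h3
  rw [h2, h3]
  by_cases h : s ∈ Iio x
  · rw [indicator_of_mem h, indicator_of_mem h, h1]
  · rw [indicator_of_notMem h, indicator_of_notMem h, inner_zero_right]

lemma inner_acc_one (S : Sys lam al Hf T) {u v : ℝ → E2} (hu : Nice 1 u) (hv : Nice 1 v)
    (hmu : AEStronglyMeasurable (acc S u) μ01) (hmv : AEStronglyMeasurable (acc S v) μ01) :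
    inner ℂ (emb (acc S v)) (emb (acc S u)) = inner ℂ (emb v) (wsol S 1 (emb u)) := by
  rw [← inner_acc S hu hv hmu hmv (by simp), Pc_one]

/-- Orthogonality relations. -/
lemma orth_acc (S : Sys lam al Hf T) (hal : ∀ n, 0 < al n)
    (hm : ∀ u, Nice 1 u → AEStronglyMeasurable (acc S u) μ01) (l k : ℤ) :
    inner ℂ (emb (acc S (c0E (lam l)))) (emb (acc S (c0E (lam k)))) =
      if l = k then (((al k)⁻¹ : ℝ) : ℂ) else 0 := by
  rw [inner_acc_one S (nice_c0E _) (nice_c0E _) (hm _ (nice_c0E _)) (hm _ (nice_c0E _))]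
  obtain ⟨w, h1, h2⟩ := S.bio k
  have hne : (al k : ℂ) ≠ 0 := by exact_mod_cast (hal k).ne'
  have e : wsol S 1 (cv (lam k)) = (al k : ℂ)⁻¹ • w := by
    rw [← sub_eq_zero]
    refine G_inj S ?_
    rw [map_sub, map_smul]
    have h3 := wsol_one S (cv (lam k))
    have h4 : (al k : ℂ)⁻¹ • w + (al k : ℂ)⁻¹ • T w = cv (lam k) := by
      rw [← smul_add, h2, smul_smul, inv_mul_cancel₀ hne, one_smul]
    rw [sub_add_sub_comm, h3, h4, sub_self]
  show inner ℂ (cv (lam l)) (wsol S 1 (cv (lam k))) = _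
  rw [e, inner_smul_right, h1 l]
  by_cases h : l = k
  · rw [if_pos h, if_pos h]; push_cast; ring
  · rw [if_neg h, if_neg h, mul_zero]

lemma perp_acc (S : Sys lam al Hf T) (hc : ComplSys lam)
    (hm : ∀ u, Nice 1 u → AEStronglyMeasurable (acc S u) μ01) {V : HH}
    (hV : ∀ k, inner ℂ V (emb (acc S (c0E (lam k)))) = 0) {u : ℝ → E2} (hu : Nice 1 u)
    {x : ℝ} (hx : x ∈ Icc (0:ℝ) 1) : inner ℂ V (Pc x (emb (acc S u))) = 0 := by
  obtain ⟨κ, hκ, hco⟩ := S.coer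
  set w := wsol S x (emb u) with hw
  set z := Pc x (emb (acc S u)) with hz
  set F := w + T w with hF
  have hdense : (Submodule.span ℂ (range fun k : ℤ => cv (lam k))).topologicalClosure = ⊤ := by
    rw [Submodule.topologicalClosure_eq_top_iff, Submodule.eq_bot_iff]
    intro f hf
    refine hc f (fun n => ?_)
    exact (Submodule.mem_orthogonal _ _).1 hf _ (Submodule.subset_span ⟨n, rfl⟩)
  have hFm : F ∈ closure (Submodule.span ℂ (range fun k : ℤ => cv (lam k)) : Set HH) := by
    rw [← Submodule.topologicalClosure_coe, hdense]; trivial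
  have hzz : inner ℂ z z = inner ℂ w F := by
    have e1 : inner ℂ z z = inner ℂ (emb (acc S u)) z := by
      conv_lhs => rw [hz, Pc_symm, Pc_left le_rfl]
    rw [e1, hz, inner_acc S hu hu (hm u hu) (hm u hu) hx, hF,
      Sol_energy' S (wsol_sol S x (emb u)) w (wsol_cut S le_rfl _)]
  have symG : ∀ a b : HH, inner ℂ (a + T a) b = inner ℂ a (b + T b) := by
    intro a b
    rw [inner_add_right, inner_add_left, S.symm]
  have key : ∀ ε > 0, ‖inner ℂ V z‖ ^ 2 ≤ ‖V‖ ^ 2 * (ε ^ 2 / κ) := by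
    intro ε hε
    obtain ⟨f, hf, hfd⟩ := Metric.mem_closure_iff.1 hFm ε hε
    rw [SetLike.mem_coe, Finsupp.mem_span_range_iff_exists_finsupp] at hf
    obtain ⟨c, hcf⟩ := hf
    set g : HH := ∑ k ∈ c.support, c k • emb (acc S (c0E (lam k))) with hg
    set h : HH := ∑ k ∈ c.support, c k • wsol S 1 (cv (lam k)) with hh
    have hfs : f = ∑ k ∈ c.support, c k • cv (lam k) := hcf.symm
    have hGh : h + T h = f := by
      rw [hh, map_sum, ← Finset.sum_add_distrib, hfs]
      refine Finset.sum_congr rfl (fun k _ => ?_)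
      rw [map_smul, ← smul_add, wsol_one]
    have gz : inner ℂ g z = inner ℂ f w := by
      rw [hg, hfs, sum_inner, sum_inner]
      refine Finset.sum_congr rfl (fun k _ => ?_)
      rw [inner_smul_left, inner_smul_left, hz, inner_acc S hu (nice_c0E _) (hm _ hu)
        (hm _ (nice_c0E _)) hx]
      rfl
    have gg : inner ℂ g g = inner ℂ f h := by
      rw [hg, hfs, hh, sum_inner, sum_inner]
      refine Finset.sum_congr rfl (fun k _ => ?_)
      rw [inner_sum, inner_sum]
      refine Finset.sum_congr rfl (fun j _ => ?_)
      rw [inner_smul_left, inner_smul_left, inner_smul_right, inner_smul_right,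
        inner_acc_one S (nice_c0E _) (nice_c0E _) (hm _ (nice_c0E _)) (hm _ (nice_c0E _))]
      rfl
    have zg : inner ℂ z g = inner ℂ F h := by
      have : inner ℂ z g = inner ℂ w f := by
        rw [← inner_conj_symm, gz, inner_conj_symm]
      rw [this, hF, symG, hGh]
    have e : inner ℂ (z - g) (z - g) = inner ℂ (F - f) (w - h) := by
      rw [inner_sub_left, inner_sub_right, inner_sub_right, inner_sub_left, inner_sub_right,
        inner_sub_right, hzz, gz, gg, zg]
      rw [show inner ℂ w F = inner ℂ F w by rw [hF, symG]]
    have b1 : ‖w - h‖ ≤ ‖F - f‖ / κ := by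
      have e2 : F - f = (w - h) + T (w - h) := by
        rw [← hGh, hF, map_sub]; abel
      rw [e2]
      exact G_norm hκ hco _
    have hFf : ‖F - f‖ ≤ ε := by rw [← dist_eq_norm]; exact hfd.le
    have b2 : ‖z - g‖ ^ 2 ≤ ε ^ 2 / κ := by
      have e3 : ‖z - g‖ ^ 2 = ‖inner ℂ (z - g) (z - g)‖ := by
        rw [inner_self_eq_norm_sq_to_K]; simp
      rw [e3, e]
      refine (norm_inner_le_norm _ _).trans ?_
      calc ‖F - f‖ * ‖w - h‖ ≤ ε * (ε / κ) := by
            refine mul_le_mul hFf (b1.trans ?_) (norm_nonneg _) hε.le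
            exact div_le_div_of_nonneg_right hFf hκ.le
        _ = ε ^ 2 / κ := by ring
    have hVg : inner ℂ V g = 0 := by
      rw [hg, inner_sum]
      refine Finset.sum_eq_zero (fun k _ => ?_)
      rw [inner_smul_right, hV, mul_zero]
    have e4 : inner ℂ V z = inner ℂ V (z - g) := by rw [inner_sub_right, hVg, sub_zero]
    rw [e4]
    calc ‖inner ℂ V (z - g)‖ ^ 2 ≤ (‖V‖ * ‖z - g‖) ^ 2 :=
          pow_le_pow_left₀ (norm_nonneg _) (norm_inner_le_norm _ _) 2
      _ = ‖V‖ ^ 2 * ‖z - g‖ ^ 2 := by ring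
      _ ≤ _ := mul_le_mul_of_nonneg_left b2 (by positivity)
  have hlim : ‖inner ℂ V z‖ ^ 2 ≤ 0 := by
    have ht : Tendsto (fun ε : ℝ => ‖V‖ ^ 2 * (ε ^ 2 / κ)) (nhdsWithin 0 (Ioi 0)) (nhds 0) := by
      have : Continuous (fun ε : ℝ => ‖V‖ ^ 2 * (ε ^ 2 / κ)) := by fun_prop
      have h2 := this.tendsto 0
      simp only [ne_eq, OfNat.ofNat_ne_zero, not_false_eq_true, zero_pow, zero_div, mul_zero] at h2
      exact h2.mono_left nhdsWithin_le_nhds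
    refine ge_of_tendsto ht ?_
    filter_upwards [self_mem_nhdsWithin] with ε hε
    exact key ε hε
  have h3 : ‖inner ℂ V z‖ = 0 := by nlinarith [norm_nonneg (inner ℂ V z)]
  exact norm_eq_zero.1 h3

lemma nice_step (a : ℝ) (e : E2) (he : ‖e‖ ≤ 1) : Nice 1 ((Ici a).indicator fun _ => e) := by
  have hb : ∀ t ∈ Ioo (0:ℝ) 1, ‖(Ici a).indicator (fun _ => e) t‖ ≤ 1 := fun t _ =>
    (norm_indicator_le_norm_self _ _).trans he
  exact ⟨memLp_of_bdd (stronglyMeasurable_const.indicator measurableSet_Ici).aestronglyMeasurable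
    1 hb, hb⟩

/-- Completeness. -/
lemma compl_acc (S : Sys lam al Hf T) (hc : ComplSys lam) {H : ℝ → M2} (hae : Hf =ᵐ[μ11] H)
    {p : ℝ≥0∞} (hp : 1 ≤ p) {K : ℝ → ℝ → M2} (hK : MemGp p K) (hsol : SolvesGLMwith (Fker H) K)
    {V : HH} (hV : ∀ k, inner ℂ V (emb (acc S (c0E (lam k)))) = 0) : V = 0 := by
  have hm : ∀ u, Nice 1 u → AEStronglyMeasurable (acc S u) μ01 :=
    fun u hu => acc_meas S hae hp hK hsol hu
  set e : Fin 2 → E2 := fun j => EuclideanSpace.single j (1:ℂ) with he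
  have he1 : ∀ j, ‖e j‖ ≤ 1 := fun j => by simp [he]
  have h1 : ∀ u, Nice 1 u → ∀ᵐ s ∂μ01, inner ℂ (V s) (Ktr K u s) = 0 := by
    intro u hu
    have hq : Integrable (fun s => inner ℂ (V s) (acc S u s)) μ01 :=
      integrable_inner_memLp (Lp.memLp V) (acc_memLp S hu (hm u hu))
    have hz := ae_zero_of_prim hq (fun x hx => by
      rw [← perp_acc S hc hm hV hu hx, L2.inner_def]
      refine integral_congr_ae ?_
      filter_upwards [emb_coe (acc_memLp S hu (hm u hu)), Pc_ae x (emb (acc S u))] with s h1 h3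
      rw [h3]
      by_cases h : s ∈ Iio x
      · rw [indicator_of_mem h, indicator_of_mem h, h1]
      · rw [indicator_of_notMem h, indicator_of_notMem h, inner_zero_right])
    filter_upwards [hz, ae_mem_Ioo] with s hs hs1
    rw [Ktr_eq_acc S hae hp hK hsol hu hs1]; exact hs
  have h2 : ∀ᵐ s ∂μ01, ∀ (a : ℚ) (j : Fin 2),
      inner ℂ (V s) (Ktr K ((Ici (a:ℝ)).indicator fun _ => e j) s) = 0 := by
    rw [ae_all_iff]; intro a
    rw [ae_all_iff]; intro j
    exact h1 _ (nice_step a (e j) (he1 j))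
  refine Lp.ext ?_
  filter_upwards [h2, ae_mem_Ioo, Lp.coeFn_zero E2 2 μ01] with y hy hy1 hz
  rw [hz]
  have hcoord : ∀ j, inner ℂ (V y) (e j) = 0 := by
    intro j
    obtain ⟨a, ha1, ha2, ha3⟩ := Real.exists_seq_rat_strictMono_tendsto y
    have iK := K_integrable hp hK (Ioo_subset_Icc_self hy1)
    have hlim : Tendsto (fun n => ∫ t, opM (K y t) ((Ici (a n:ℝ)).indicator (fun _ => e j) t) ∂μ01)
        atTop (nhds (∫ t, (0:E2) ∂μ01)) := by
      refine tendsto_integral_of_dominated_convergence (fun t => ‖K y t‖) ?_ iK.norm ?_ ?_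
      · intro n
        exact (opM_integrable iK (nice_step (a n) (e j) (he1 j)).mem.1
          (nice_step (a n) (e j) (he1 j)).ae_bd).aestronglyMeasurable
      · intro n
        filter_upwards [(nice_step (a n) (e j) (he1 j)).ae_bd] with t ht
        exact (opM_le _ _).trans (mul_le_of_le_one_right (norm_nonneg _) ht)
      · have hne : ∀ᵐ s ∂μ01, s ≠ y := by
          unfold μ01
          exact ae_restrict_of_ae (Measure.ae_ne volume y)
        filter_upwards [hne] with t ht
        rcases lt_or_gt_of_ne ht with h3 | h3
        · refine tendsto_const_nhds.congr' ?_
          filter_upwards [ha3.eventually (lt_mem_nhds h3)] with n hn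
          rw [indicator_of_notMem (by simpa using hn), map_zero]
        · have : K y t = 0 := hsol.1 y t (fun h => absurd h.2.1 (not_le.2 h3))
          rw [this]
          simp only [opM_zero]
          exact tendsto_const_nhds
    rw [integral_zero] at hlim
    have hlim2 : Tendsto (fun n => inner ℂ (V y) (Ktr K ((Ici (a n:ℝ)).indicator fun _ => e j) y))
        atTop (nhds (inner ℂ (V y) (e j + 0))) := by
      refine tendsto_const_nhds.inner ?_
      refine Tendsto.add ?_ hlim
      refine tendsto_const_nhds.congr (fun n => ?_)
      rw [indicator_of_mem (show y ∈ Ici (a n : ℝ) from (ha2 n).le)]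
    rw [add_zero] at hlim2
    refine tendsto_nhds_unique hlim2 (tendsto_const_nhds.congr (fun n => ?_))
    exact (hy (a n) j).symm
  have hj : ∀ j, V y j = 0 := by
    intro j
    have := hcoord j
    rw [he, EuclideanSpace.inner_single_right] at this
    simpa using this
  exact E2_ext (hj 0) (hj 1)

end SysLemmas


lemma fc_tendsto (g : ℝ → ℂ) : Tendsto (fun n : ℤ => fc g n) cofinite (nhds 0) := by
  have h := (Real.tendsto_integral_exp_smul_cocompact ((Ioc (0:ℝ) 1).indicator g)).comp
    Int.tendsto_coe_cofinite
  refine h.congr fun n => ?_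
  simp only [Function.comp, fc]
  rw [intervalIntegral.integral_of_le zero_le_one, ← integral_indicator measurableSet_Ioc]
  refine integral_congr_ae (Eventually.of_forall fun x => ?_)
  by_cases hx : x ∈ Ioc (0:ℝ) 1
  · simp only [indicator_of_mem hx, Circle.smul_def, Real.fourierChar_apply, smul_eq_mul]
    congr 2
    push_cast
    ring
  · simp [indicator_of_notMem hx]

lemma lam_tendsto {p : ℝ≥0∞} {lam : ℤ → ℝ} (h : LamAsymp p lam) :
    Tendsto (fun n => lam n - lam0 n) cofinite (nhds 0) := by
  obtain ⟨g, -, hg⟩ := h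
  rw [tendsto_zero_iff_norm_tendsto_zero]
  refine (tendsto_zero_iff_norm_tendsto_zero.1 (fc_tendsto g)).congr fun n => ?_
  have e : fc g n = ((lam n - lam0 n : ℝ) : ℂ) := by
    have := hg n
    unfold lam0
    push_cast
    rw [this]
    ring
  rw [e, Complex.norm_real]

lemma lam_inj {p : ℝ≥0∞} {lam mu : ℤ → ℝ} (h : MemSD p lam mu) : Function.Injective lam := by
  refine (strictMono_int_of_lt_succ fun n => ?_).injective
  have := h.1 (n + 1)
  rw [add_sub_cancel_right] at this
  exact this.1.trans this.2

lemma ip2_eq (v w : Fin 2 → ℂ) :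
    ip2 v w = inner ℂ (WithLp.toLp 2 w : E2) (WithLp.toLp 2 v : E2) := by
  simp [ip2, PiLp.inner_apply, Fin.sum_univ_two]

lemma ck_eq {K : ℝ → ℝ → M2} {F : ℝ → ℝ → M2} (hsol : SolvesGLMwith F K) (l : ℝ) {x : ℝ}
    (hx : x ∈ Ioo (0:ℝ) 1) :
    (WithLp.toLp 2 (c0 l x + ∫ t in (0:ℝ)..x, (K x t).mulVec (c0 l t)) : E2) =
      Ktr K (c0E l) x := by
  have hz : ∀ t, x < t → (K x t).mulVec (c0 l t) = 0 := by
    intro t ht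
    rw [hsol.1 x t (fun h => absurd h.2.1 (not_le.2 ht)), Matrix.zero_mulVec]
  rw [ii_tri _ (Ioo_subset_Icc_self hx) hz, Ktr, WithLp.toLp_add]
  congr 1
  have h := (PiLp.continuousLinearEquiv 2 ℂ (fun _ : Fin 2 => ℂ)).symm.integral_comp_comm
    (μ := μ01) (fun t => (K x t).mulVec (c0 l t))
  refine h.symm.trans (integral_congr_ae (Eventually.of_forall fun t => ?_))
  simp only [c0E, opM_toLp]
  rfl

/-- The functions `c_k = (I + 𝒦)c₀(·,λ_k)` form a complete orthogonal
system in `ℍ` with `⟨c_k, c_l⟩ = α_k⁻¹ δ_{kl}`. -/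
theorem statement15 (p : ℝ≥0∞) (hp : 1 ≤ p) (hp' : p ≠ ∞)
    (lam mu : ℤ → ℝ) (hSD : MemSD p lam mu)
    (phi psi : ℂ → ℂ)
    (hphi : ∀ S : Set ℂ, IsCompact S →
      TendstoUniformlyOn
        (fun (N : ℕ) (l : ℂ) =>
          ∏ n ∈ Finset.Icc (-(N:ℤ)) (N:ℤ), ((lam n : ℂ) - l) / (Real.pi * ((n : ℂ) + 1/2)))
        phi atTop S)
    (hpsi : ∀ S : Set ℂ, IsCompact S →
      TendstoUniformlyOn
        (fun (N : ℕ) (l : ℂ) => (l - (mu 0 : ℂ)) *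
          ∏ n ∈ (Finset.Icc (-(N:ℤ)) (N:ℤ)).erase 0, ((mu n : ℂ) - l) / (Real.pi * (n : ℂ)))
        psi atTop S)
    (al : ℤ → ℝ)
    (hal : ∀ n : ℤ, (al n : ℂ) = -1 / (deriv phi (lam n) * psi (lam n)))
    (halpos : ∀ n : ℤ, 0 < al n)
    (H : ℝ → M2) (hH : IsHSum p lam al H)
    (K : ℝ → ℝ → M2) (hK : MemGp p K) (hKsol : SolvesGLMwith (Fker H) K)
    (ck : ℤ → ℝ → Fin 2 → ℂ)
    (hck : ∀ (k : ℤ) (x : ℝ),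
      ck k x = c0 (lam k) x + ∫ t in (0:ℝ)..x, (K x t).mulVec (c0 (lam k) t)) :
    (∀ k l : ℤ,
      (∫ x in Set.Ioo (0:ℝ) 1, ip2 (ck k x) (ck l x)) =
        if k = l then (((al k)⁻¹ : ℝ) : ℂ) else 0) ∧
    (∀ u : ℝ → Fin 2 → ℂ, MemLp u 2 μ01 →
      (∀ k : ℤ, (∫ x in Set.Ioo (0:ℝ) 1, ip2 (u x) (ck k x)) = 0) →
      u =ᵐ[μ01] 0) := by
  obtain ⟨hc, hbi⟩ := compl_biorth lam (lam_inj hSD) (lam_tendsto hSD.2.1)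
  obtain ⟨th, h0, h1, ht, hlim⟩ := exists_weights hp hH
  have hHi : Integrable H μ11 := hH.1.integrable hp
  obtain ⟨Hf, hm, hsupp, hae⟩ : ∃ Hf : ℝ → M2, StronglyMeasurable Hf ∧ tr Hf = Hf ∧
      Hf =ᵐ[μ11] H := by
    refine ⟨tr (hH.1.1.mk H), hH.1.1.stronglyMeasurable_mk.indicator measurableSet_Ioo, ?_, ?_⟩
    · simp [tr]
    · have h2 : ∀ᵐ s ∂μ11, s ∈ Ioo (-1:ℝ) 1 := ae_restrict_mem measurableSet_Ioo
      filter_upwards [hH.1.1.ae_eq_mk, h2] with s hs hs2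
      rw [hs]
      simp only [tr, indicator_of_mem hs2]
  obtain ⟨T, S⟩ := exists_Sys hc hbi halpos hHi hm hsupp hae th h0 h1 ht hlim
  have hmm : ∀ u, Nice 1 u → AEStronglyMeasurable (acc S u) μ01 :=
    fun u hu => acc_meas S hae hp hK hKsol hu
  have hL : ∀ k, MemLp (acc S (c0E (lam k))) 2 μ01 :=
    fun k => acc_memLp S (nice_c0E _) (hmm _ (nice_c0E _))
  have hcx : ∀ k, ∀ x ∈ Ioo (0:ℝ) 1,
      (WithLp.toLp 2 (ck k x) : E2) = acc S (c0E (lam k)) x := by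
    intro k x hx
    rw [hck, ck_eq hKsol (lam k) hx]
    exact Ktr_eq_acc S hae hp hK hKsol (nice_c0E _) hx
  refine ⟨fun k l => ?_, fun u hu hz => ?_⟩
  · have e : (∫ x in Set.Ioo (0:ℝ) 1, ip2 (ck k x) (ck l x)) =
        inner ℂ (emb (acc S (c0E (lam l)))) (emb (acc S (c0E (lam k)))) := by
      rw [inner_emb (hL l) (hL k)]
      refine setIntegral_congr_fun measurableSet_Ioo fun x hx => ?_
      simp only [ip2_eq, hcx k x hx, hcx l x hx]
    rw [e, orth_acc S halpos hmm]
    simp only [eq_comm]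
  · have hv : MemLp (fun x => (WithLp.toLp 2 (u x) : E2)) 2 μ01 :=
      (PiLp.continuousLinearEquiv 2 ℂ
        (fun _ : Fin 2 => ℂ)).symm.toContinuousLinearMap.comp_memLp' hu
    have hV : emb (fun x => (WithLp.toLp 2 (u x) : E2)) = 0 := by
      refine compl_acc S hc hae hp hK hKsol fun k => ?_
      have e : (∫ x in Set.Ioo (0:ℝ) 1, ip2 (u x) (ck k x)) =
          inner ℂ (emb (acc S (c0E (lam k)))) (emb (fun x => (WithLp.toLp 2 (u x) : E2))) := by
        rw [inner_emb (hL k) hv]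
        refine setIntegral_congr_fun measurableSet_Ioo fun x hx => ?_
        simp only [ip2_eq, hcx k x hx]
      rw [inner_eq_zero_symm, ← e, hz k]
    have h2 := emb_coe hv
    rw [hV] at h2
    have h3 := Lp.coeFn_zero E2 2 μ01
    filter_upwards [h2, h3] with x hx hx3
    rw [hx3] at hx
    simpa using hx.symm
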